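/- arXiv:1703.02841 — 3 statements merged into one kernel-verified Lean document; each statement's English description precedes it below -/
import Mathlib

section
/- Let 1 < p < 2 and β > 0 with βq ≤ 1, where q = p/(p−1), let f ∈ A^1_β(𝕋), and let k be a positive integer with q/2 ≤ k ≤ 1/(2β). If C_α(k × Z(f)) = 0, where α = 1 − 2kβ, then f is cyclic in A^p_β(𝕋). -/
open MeasureTheory Real Set Filter Topology ENNReal

noncomputable section

instance : Fact (0 < 2 * Real.pi) := ⟨by positivity⟩

/-- The weighted sum `∑ ‖c n‖^p (1+|n|)^{pβ}` of a Fourier-coefficient sequence,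
i.e. `‖c‖_{ℓ^p_β}^p`. -/
def wSum (p β : ℝ) (c : ℤ → ℂ) : ℝ :=
  ∑' n : ℤ, ‖c n‖ ^ p * (1 + |(n : ℝ)|) ^ (p * β)

/-- Membership in `A^p_β(𝕋)` (equivalently `ℓ^p_β(ℤ)`), expressed via the
Fourier coefficient sequence `c`. -/
def MemA (p β : ℝ) (c : ℤ → ℂ) : Prop :=
  Summable fun n : ℤ => ‖c n‖ ^ p * (1 + |(n : ℝ)|) ^ (p * β)

/-- The `A^p_β(𝕋)` (i.e. `ℓ^p_β(ℤ)`) norm of a Fourier-coefficient sequence. -/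
def normA (p β : ℝ) (c : ℤ → ℂ) : ℝ := (wSum p β c) ^ (1 / p)

/-- The function on the circle `𝕋 = ℝ/2πℤ` whose Fourier coefficient sequence is `c`,
namely `t ↦ ∑_{n ∈ ℤ} c_n e^{int}`. -/
def fSum (c : ℤ → ℂ) (t : AddCircle (2 * Real.pi)) : ℂ :=
  ∑' n : ℤ, c n * fourier n t

/-- The zero set `Z(f)` of the function `f` with Fourier coefficients `c`. -/
def zeroSet (c : ℤ → ℂ) : Set (AddCircle (2 * Real.pi)) := {t | fSum c t = 0}

/-- Convolution of coefficient sequences: the Fourier coefficients of the product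
of the corresponding functions/distributions. -/
def convSeq (a c : ℤ → ℂ) (n : ℤ) : ℂ := ∑' k : ℤ, a k * c (n - k)

/-- Cyclicity of (the element with coefficients) `c` in `A^p_β(𝕋)`: there are
trigonometric polynomials `P` (finitely supported coefficient sequences `a`) with
`‖1 - P·f‖_{A^p_β}` arbitrarily small. -/
def IsCyclicA (p β : ℝ) (c : ℤ → ℂ) : Prop :=
  ∀ ε : ℝ, 0 < ε → ∃ a : ℤ → ℂ, (Function.support a).Finite ∧
    normA p β (fun n => (if n = 0 then 1 else 0) - convSeq a c n) < ε

/-- Fourier coefficient `μ̂(n) = ∫ e^{-int} dμ(t)` of a measure on `ℝ/2πℤ`. -/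
def muHat (μ : Measure (AddCircle (2 * Real.pi))) (n : ℤ) : ℂ :=
  ∫ t, fourier (-n) t ∂μ

/-- The `α`-energy `I_α(μ) = ∑_{n ≥ 1} |μ̂(n)|²/(1+n)^{1-α}` of `μ` is finite. -/
def HasFiniteEnergy (α : ℝ) (μ : Measure (AddCircle (2 * Real.pi))) : Prop :=
  Summable fun n : ℕ => ‖muHat μ (n + 1)‖ ^ 2 / (1 + ((n : ℝ) + 1)) ^ (1 - α)

/-- `C_α(E) = 0`: every probability measure supported on a compact subset of `E`
has infinite `α`-energy. -/
def CapacityZero (α : ℝ) (E : Set (AddCircle (2 * Real.pi))) : Prop :=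
  ∀ μ : Measure (AddCircle (2 * Real.pi)), IsProbabilityMeasure μ →
    (∃ K, K ⊆ E ∧ IsCompact K ∧ μ Kᶜ = 0) → ¬ HasFiniteEnergy α μ

/-- `C_α(E) > 0`: some probability measure supported on a compact subset of `E`
has finite `α`-energy. -/
def CapacityPos (α : ℝ) (E : Set (AddCircle (2 * Real.pi))) : Prop :=
  ∃ μ : Measure (AddCircle (2 * Real.pi)), IsProbabilityMeasure μ ∧
    (∃ K, K ⊆ E ∧ IsCompact K ∧ μ Kᶜ = 0) ∧ HasFiniteEnergy α μ

/-- The `k`-fold Minkowski sum `k × E = E + ⋯ + E`. -/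
def kFold (k : ℕ) (E : Set (AddCircle (2 * Real.pi))) : Set (AddCircle (2 * Real.pi)) :=
  {x | ∃ g : Fin k → AddCircle (2 * Real.pi), (∀ i, g i ∈ E) ∧ x = ∑ i, g i}

/-- Smoothness (`C^∞`) of a function on the circle, via its lift to `ℝ`. -/
def SmoothOnCircle (φ : AddCircle (2 * Real.pi) → ℂ) : Prop :=
  ContDiff ℝ (⊤ : ℕ∞) fun x : ℝ => φ (↑x)

/-- `supp S ⊆ E` for the distribution `S` with Fourier coefficients `s`:
`⟨S, φ⟩ = ∑ₙ Ŝ(n) φ̂(−n) = 0` for every `C^∞` function `φ` supported in `𝕋 ∖ E`. -/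
def DistSuppIn (s : ℤ → ℂ) (E : Set (AddCircle (2 * Real.pi))) : Prop :=
  ∀ φ : AddCircle (2 * Real.pi) → ℂ, SmoothOnCircle φ → tsupport φ ⊆ Eᶜ →
    ∑' n : ℤ, s n * fourierCoeff φ (-n) = 0

theorem aux_fourier_coe (n : ℤ) (h : ℝ) :
    fourier n (h : AddCircle (2 * Real.pi)) = Complex.exp (((n * h : ℝ) : ℂ) * Complex.I) := by
  rw [fourier_coe_apply]
  congr 1
  push_cast
  have : (Real.pi : ℂ) ≠ 0 := by exact_mod_cast Real.pi_ne_zero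
  field_simp

theorem aux_fourierCoeff_translate (F : AddCircle (2 * Real.pi) → ℂ) (h : AddCircle (2 * Real.pi)) (n : ℤ) :
    fourierCoeff (fun x => F (x + h)) n = fourier n h * fourierCoeff F n := by
  unfold fourierCoeff
  rw [← MeasureTheory.integral_add_right_eq_self (fun x => fourier (-n) x • F x) h,
    ← integral_const_mul]
  congr 1
  ext x
  have h1 : fourier (-n) (x + h) = fourier (-n) x * fourier (-n) h := by
    simp [fourier_apply, smul_add, AddCircle.toCircle_add]
  have h2 : fourier n h * fourier (-n) h = 1 := by
    rw [← fourier_add]; simp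
  simp only [smul_eq_mul, h1]
  linear_combination (- fourier (-n) x * F (x + h)) * h2

theorem aux_parseval (F : C(AddCircle (2 * Real.pi), ℂ)) :
    HasSum (fun n : ℤ => ‖fourierCoeff F n‖ ^ 2) (∫ x, ‖F x‖ ^ 2 ∂AddCircle.haarAddCircle) := by
  have := hasSum_sq_fourierCoeff (ContinuousMap.toLp (E := ℂ) 2 AddCircle.haarAddCircle ℂ F)
  simp only [fourierCoeff_toLp] at this
  convert this using 1
  apply integral_congr_ae
  filter_upwards [ContinuousMap.coeFn_toLp (p := 2) (𝕜 := ℂ) AddCircle.haarAddCircle F] with x hx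
  rw [hx]

theorem aux_parseval_ofReal (F : C(AddCircle (2 * Real.pi), ℂ)) :
    ∑' n : ℤ, ENNReal.ofReal (‖fourierCoeff F n‖ ^ 2) =
      ENNReal.ofReal (∫ x, ‖F x‖ ^ 2 ∂AddCircle.haarAddCircle) := by
  rw [← (aux_parseval F).tsum_eq, ENNReal.ofReal_tsum_of_nonneg (fun _ => by positivity)
    (aux_parseval F).summable]

/-- translate -/
def trC (F : C(AddCircle (2 * Real.pi), ℂ)) (h : ℝ) : C(AddCircle (2 * Real.pi), ℂ) :=
  ⟨fun x => F (x + (h : AddCircle (2 * Real.pi))) - F x, by fun_prop⟩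

theorem aux_parseval_tr (F : C(AddCircle (2 * Real.pi), ℂ)) (h : ℝ) :
    ∑' n : ℤ, ENNReal.ofReal (‖fourierCoeff F n‖ ^ 2) *
      ENNReal.ofReal (‖Complex.exp (((n * h : ℝ) : ℂ) * Complex.I) - 1‖ ^ 2) =
      ENNReal.ofReal (∫ x, ‖F (x + (h : AddCircle (2 * Real.pi))) - F x‖ ^ 2
        ∂AddCircle.haarAddCircle) := by
  have := aux_parseval_ofReal (trC F h)
  have e : ∀ x, trC F h x = F (x + (h : AddCircle (2 * Real.pi))) - F x := fun x => rfl
  simp only [e] at this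
  rw [← this]
  congr 1
  ext n
  rw [← ENNReal.ofReal_mul (by positivity)]
  congr 1
  have h1 : fourierCoeff (trC F h) n = fourierCoeff F n *
      (Complex.exp (((n * h : ℝ) : ℂ) * Complex.I) - 1) := by
    have h2 : (fun x => F (x + (h : AddCircle (2 * Real.pi)))) =
       (⇑(trC F h) + ⇑F) := by ext x; simp [e]
    have h3 := aux_fourierCoeff_translate F h n
    rw [h2, fourierCoeff.add] at h3
    · rw [aux_fourier_coe, Pi.add_apply] at h3
      linear_combination h3
    · exact (ContinuousMap.continuous _).integrable_of_hasCompactSupport (HasCompactSupport.of_compactSpace _)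
    · exact (ContinuousMap.continuous _).integrable_of_hasCompactSupport (HasCompactSupport.of_compactSpace _)
  rw [h1, norm_mul, mul_pow]

def gKer (θ : ℝ) : ℝ := ‖Complex.exp ((θ : ℂ) * Complex.I) - 1‖ ^ 2

theorem gKer_cont : Continuous gKer := by unfold gKer; fun_prop

theorem gKer_neg (θ : ℝ) : gKer (-θ) = gKer θ := by
  unfold gKer
  rw [← Complex.norm_conj]
  simp [← Complex.exp_conj]

theorem gKer_abs (θ : ℝ) : gKer |θ| = gKer θ := by
  rcases abs_choice θ with h | h <;> rw [h]
  exact gKer_neg θ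

theorem gKer_nonneg (θ : ℝ) : 0 ≤ gKer θ := by unfold gKer; positivity

theorem gKer_le_four (θ : ℝ) : gKer θ ≤ 4 := by
  unfold gKer
  have : ‖Complex.exp ((θ : ℂ) * Complex.I) - 1‖ ≤ 2 := by
    refine (norm_sub_le _ _).trans ?_
    rw [Complex.norm_exp_ofReal_mul_I]; norm_num
  nlinarith [norm_nonneg (Complex.exp ((θ : ℂ) * Complex.I) - 1)]

theorem norm_exp_sub_one_le (θ : ℝ) : ‖Complex.exp ((θ : ℂ) * Complex.I) - 1‖ ≤ |θ| := by
  have := Real.norm_exp_I_mul_ofReal_sub_one_le (x := θ)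
  rw [mul_comm]
  simpa using this

theorem gKer_le_sq (θ : ℝ) : gKer θ ≤ θ ^ 2 := by
  unfold gKer
  rw [← sq_abs θ]
  gcongr
  exact norm_exp_sub_one_le θ

def gInt (σ : ℝ) : ℝ≥0∞ :=
  ∫⁻ h in Ioi (0:ℝ), ENNReal.ofReal (gKer h) * ENNReal.ofReal (h ^ (-1 - 2 * σ))

def gMin (σ : ℝ) : ℝ≥0∞ :=
  ∫⁻ h in Ioi (0:ℝ), ENNReal.ofReal (min 1 (h ^ 2)) * ENNReal.ofReal (h ^ (-1 - 2 * σ))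

theorem gMin_lt_top {σ : ℝ} (h0 : 0 < σ) (h1 : σ < 1) : gMin σ < ∞ := by
  unfold gMin
  rw [← Ioc_union_Ioi_eq_Ioi (zero_le_one' ℝ)]
  refine (lintegral_union_le _ _ _).trans_lt ?_
  refine ENNReal.add_lt_top.2 ⟨?_, ?_⟩
  · have hi : IntegrableOn (fun h : ℝ => h ^ (1 - 2 * σ)) (Ioc 0 1) := by
      rw [← intervalIntegrable_iff_integrableOn_Ioc_of_le zero_le_one]
      exact intervalIntegral.intervalIntegrable_rpow' (by linarith)
    refine lt_of_le_of_lt ?_ hi.lintegral_lt_top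
    refine setLIntegral_mono' measurableSet_Ioc fun x hx => ?_
    rw [← ENNReal.ofReal_mul (by positivity)]
    apply ENNReal.ofReal_le_ofReal
    calc min 1 (x^2) * x ^ (-1 - 2 * σ) ≤ x^2 * x ^ (-1 - 2 * σ) := by
          gcongr
          · exact Real.rpow_nonneg hx.1.le _
          · exact min_le_right _ _
      _ = x ^ (1 - 2 * σ) := by
          rw [← Real.rpow_natCast, ← Real.rpow_add hx.1]; congr 1; push_cast; ring
  · have hi : IntegrableOn (fun h : ℝ => h ^ (-1 - 2 * σ)) (Ioi 1) :=
      integrableOn_Ioi_rpow_of_lt (by linarith) one_pos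
    refine lt_of_le_of_lt ?_ hi.lintegral_lt_top
    refine setLIntegral_mono' measurableSet_Ioi fun x hx => ?_
    refine mul_le_of_le_one_left (by positivity) ?_
    rw [← ENNReal.ofReal_one]
    exact ENNReal.ofReal_le_ofReal (min_le_left _ _)

theorem gInt_le (σ : ℝ) : gInt σ ≤ 4 * gMin σ := by
  unfold gInt gMin
  rw [← lintegral_const_mul']
  · refine lintegral_mono fun x => ?_
    rw [← mul_assoc]
    gcongr
    rw [show (4:ℝ≥0∞) = ENNReal.ofReal 4 by simp, ← ENNReal.ofReal_mul (by norm_num)]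
    apply ENNReal.ofReal_le_ofReal
    rcases min_choice 1 (x^2) with h | h <;> rw [h]
    · linarith [gKer_le_four x]
    · nlinarith [gKer_le_sq x, sq_nonneg x]
  · simp

theorem gInt_lt_top {σ : ℝ} (h0 : 0 < σ) (h1 : σ < 1) : gInt σ < ∞ :=
  (gInt_le σ).trans_lt (ENNReal.mul_lt_top (by simp) (gMin_lt_top h0 h1))

theorem gInt_pos (σ : ℝ) : 0 < gInt σ := by
  unfold gInt
  rw [lintegral_pos_iff_support]
  swap
  · have := gKer_cont.measurable
    fun_prop
  have hsub : Ioo (0:ℝ) 1 ⊆ Function.support (fun h : ℝ => ENNReal.ofReal (gKer h) *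
      ENNReal.ofReal (h ^ (-1 - 2 * σ))) := by
    intro x hx
    rw [Function.mem_support]
    refine mul_ne_zero ?_ ?_
    · rw [Ne, ENNReal.ofReal_eq_zero, not_le]
      unfold gKer
      have : Complex.exp ((x : ℂ) * Complex.I) - 1 ≠ 0 := by
        intro h0
        have h1 := congrArg Complex.im h0
        rw [Complex.sub_im, Complex.exp_ofReal_mul_I_im, Complex.one_im] at h1
        have := Real.sin_pos_of_pos_of_le_one hx.1 hx.2.le
        simp at h1
        linarith
      positivity
    · rw [Ne, ENNReal.ofReal_eq_zero, not_le]
      exact Real.rpow_pos_of_pos hx.1 _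
  have h2 : (volume.restrict (Ioi (0:ℝ))) (Ioo 0 1) = 1 := by
    rw [Measure.restrict_apply measurableSet_Ioo, inter_eq_left.2 Ioo_subset_Ioi_self]
    simp
  calc (0:ℝ≥0∞) < 1 := one_pos
    _ = _ := h2.symm
    _ ≤ _ := measure_mono hsub

theorem gInt_scale {σ : ℝ} (h0 : 0 < σ) (n : ℤ) :
    ∫⁻ h in Ioi (0:ℝ), ENNReal.ofReal (gKer (n * h)) * ENNReal.ofReal (h ^ (-1 - 2 * σ)) =
      ENNReal.ofReal (|(n:ℝ)| ^ (2 * σ)) * gInt σ := by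
  by_cases hn : n = 0
  · subst hn
    have : gKer 0 = 0 := by simp [gKer]
    simp [this, Real.zero_rpow (show (2 * σ) ≠ 0 by positivity)]
  have ha : 0 < |(n:ℝ)| := by positivity
  set a := |(n:ℝ)| with hadef
  have himg : (fun x => a * x) '' Ioi (0:ℝ) = Ioi 0 := by
    rw [image_mul_left_Ioi ha]; simp
  have key := lintegral_image_eq_lintegral_abs_deriv_mul (s := Ioi (0:ℝ)) (f := fun x => a * x)
    (f' := fun _ => a) measurableSet_Ioi
    (fun x _ => by simpa using ((hasDerivAt_id x).const_mul a).hasDerivWithinAt)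
    (fun x _ y _ h => mul_left_cancel₀ ha.ne' h)
    (fun h => ENNReal.ofReal (gKer h) * ENNReal.ofReal (h ^ (-1 - 2 * σ)))
  rw [himg] at key
  rw [gInt, key, ← lintegral_const_mul']
  swap
  · simp
  refine setLIntegral_congr_fun measurableSet_Ioi fun x hx => ?_
  have hx' : (0:ℝ) < x := hx
  rw [← gKer_abs (n * x), abs_mul, abs_of_pos hx', ← hadef, abs_of_pos ha,
    Real.mul_rpow ha.le hx'.le]
  rw [ENNReal.ofReal_mul (by positivity), mul_comm (ENNReal.ofReal (gKer (a * x))),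
    mul_comm (ENNReal.ofReal (gKer (a * x)))]
  simp only [← mul_assoc]
  have : a ^ (2 * σ) * a * a ^ (-1 - 2 * σ) = 1 := by
    nth_rw 2 [← Real.rpow_one a]
    rw [← Real.rpow_add ha, ← Real.rpow_add ha]
    ring_nf
    simp
  rw [← ENNReal.ofReal_mul (p := a ^ (2 * σ)) (by positivity),
    ← ENNReal.ofReal_mul (p := a ^ (2 * σ) * a) (by positivity), this]; simp

/-- The Gagliardo identity. -/
theorem gagliardo {σ : ℝ} (h0 : 0 < σ) (F : C(AddCircle (2 * Real.pi), ℂ)) :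
    (∑' n : ℤ, ENNReal.ofReal (‖fourierCoeff F n‖ ^ 2) * ENNReal.ofReal (|(n:ℝ)| ^ (2 * σ)))
      * gInt σ =
    ∫⁻ h in Ioi (0:ℝ), ENNReal.ofReal (∫ x, ‖F (x + (h : AddCircle (2 * Real.pi))) - F x‖ ^ 2
        ∂AddCircle.haarAddCircle) * ENNReal.ofReal (h ^ (-1 - 2 * σ)) := by
  simp_rw [← aux_parseval_tr, ← ENNReal.tsum_mul_right]
  rw [lintegral_tsum]
  · congr 1
    ext n
    rw [mul_assoc, ← gInt_scale h0, ← lintegral_const_mul']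
    · simp only [mul_assoc]; rfl
    · simp
  · intro n
    fun_prop

theorem haar_integrable_sq (F : C(AddCircle (2 * Real.pi), ℂ)) :
    Integrable (fun x => ‖F x‖ ^ 2) AddCircle.haarAddCircle :=
  (by fun_prop : Continuous fun x => ‖F x‖ ^ 2).integrable_of_hasCompactSupport
    (HasCompactSupport.of_compactSpace _)

theorem gagliardo_contract {σ : ℝ} (h0 : 0 < σ) (h1 : σ < 1)
    (F G : C(AddCircle (2 * Real.pi), ℂ)) (L : ℝ) (hL : 0 ≤ L)
    (hFG : ∀ x y, ‖F x - F y‖ ≤ L * ‖G x - G y‖) :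
    (∑' n : ℤ, ENNReal.ofReal (‖fourierCoeff F n‖ ^ 2) * ENNReal.ofReal (|(n:ℝ)| ^ (2 * σ))) ≤
    ENNReal.ofReal (L ^ 2) *
    ∑' n : ℤ, ENNReal.ofReal (‖fourierCoeff G n‖ ^ 2) * ENNReal.ofReal (|(n:ℝ)| ^ (2 * σ)) := by
  have hne := (gInt_pos σ).ne'
  have hnt := (gInt_lt_top h0 h1).ne
  rw [← ENNReal.mul_le_mul_iff_left hne hnt, mul_assoc, gagliardo h0, gagliardo h0,
    ← lintegral_const_mul' _ _ (by simp)]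
  refine lintegral_mono fun h => ?_
  rw [← mul_assoc, ← ENNReal.ofReal_mul (p := L ^ 2) (by positivity)]
  refine mul_le_mul' (ENNReal.ofReal_le_ofReal ?_) le_rfl
  rw [← integral_const_mul]
  refine integral_mono (haar_integrable_sq (trC F h)) ((haar_integrable_sq (trC G h)).const_mul _) ?_
  intro x
  simp only
  rw [← mul_pow]
  gcongr
  exact hFG _ _

theorem gagliardo_lip {σ : ℝ} (h0 : 0 < σ)
    (F : C(AddCircle (2 * Real.pi), ℂ)) (L M : ℝ) (hL : 0 ≤ L) (hM : ∀ x, ‖F x‖ ≤ M)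
    (hF : ∀ x (h : ℝ), ‖F (x + (h : AddCircle (2 * Real.pi))) - F x‖ ≤ L * |h|) :
    (∑' n : ℤ, ENNReal.ofReal (‖fourierCoeff F n‖ ^ 2) * ENNReal.ofReal (|(n:ℝ)| ^ (2 * σ)))
      * gInt σ ≤ ENNReal.ofReal ((L + 2 * M) ^ 2) * gMin σ := by
  have hM0 : 0 ≤ M := (norm_nonneg _).trans (hM 0)
  rw [gagliardo h0, gMin, ← lintegral_const_mul' _ _ (by simp)]
  refine lintegral_mono fun h => ?_
  rw [← mul_assoc, ← ENNReal.ofReal_mul (p := (L + 2 * M) ^ 2) (by positivity)]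
  refine mul_le_mul' (ENNReal.ofReal_le_ofReal ?_) le_rfl
  have : (L + 2 * M) ^ 2 * min 1 (h ^ 2) =
      ∫ x : AddCircle (2 * Real.pi), (L + 2 * M) ^ 2 * min 1 (h ^ 2) ∂AddCircle.haarAddCircle := by
    simp
  rw [this]
  refine integral_mono (haar_integrable_sq (trC F h)) (integrable_const _) ?_
  intro x
  simp only
  rcases min_choice 1 (h^2) with h' | h' <;> rw [h']
  · rw [mul_one]
    gcongr
    refine (norm_sub_le _ _).trans ?_
    linarith [hM x, hM (x + h)]
  · rw [← sq_abs h, ← mul_pow]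
    gcongr
    refine (hF x h).trans ?_
    gcongr
    linarith

theorem wt_le {σ t : ℝ} (h0 : 0 < σ) (h1 : σ < 1) (ht : 0 ≤ t) :
    (1 + t) ^ (2 * σ) ≤ 4 * (1 + t ^ (2 * σ)) := by
  have h4 : (2:ℝ) ^ (2 * σ) ≤ 4 := by
    calc (2:ℝ) ^ (2 * σ) ≤ 2 ^ (2:ℝ) := Real.rpow_le_rpow_of_exponent_le (by norm_num) (by linarith)
      _ = 4 := by norm_num
  have hp : 0 ≤ t ^ (2 * σ) := by positivity
  rcases le_total t 1 with h | h
  · calc (1 + t) ^ (2 * σ) ≤ 2 ^ (2 * σ) := by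
          apply Real.rpow_le_rpow <;> linarith
      _ ≤ _ := by linarith
  · calc (1 + t) ^ (2 * σ) ≤ (2 * t) ^ (2 * σ) := by
          apply Real.rpow_le_rpow <;> linarith
      _ = 2 ^ (2 * σ) * t ^ (2 * σ) := Real.mul_rpow (by norm_num) ht
      _ ≤ 4 * t ^ (2 * σ) := by gcongr
      _ ≤ _ := by linarith

theorem wt_ge {σ t : ℝ} (h0 : 0 < σ) (ht : 0 ≤ t) :
    1 + t ^ (2 * σ) ≤ 2 * (1 + t) ^ (2 * σ) := by
  have h1 : 1 ≤ (1 + t) ^ (2 * σ) := Real.one_le_rpow (by linarith) (by linarith)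
  have h2 : t ^ (2 * σ) ≤ (1 + t) ^ (2 * σ) := Real.rpow_le_rpow ht (by linarith) (by linarith)
  linarith

/-- Sobolev norm squared -/
def sobSq (σ : ℝ) (a : ℤ → ℂ) : ℝ≥0∞ :=
  ∑' n : ℤ, ENNReal.ofReal (‖a n‖ ^ 2) * ENNReal.ofReal ((1 + |(n:ℝ)|) ^ (2 * σ))

theorem sobSq_le {σ : ℝ} (h0 : 0 < σ) (h1 : σ < 1) (a : ℤ → ℂ) :
    sobSq σ a ≤ 4 * (∑' n : ℤ, ENNReal.ofReal (‖a n‖ ^ 2) +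
      ∑' n : ℤ, ENNReal.ofReal (‖a n‖ ^ 2) * ENNReal.ofReal (|(n:ℝ)| ^ (2 * σ))) := by
  rw [← ENNReal.tsum_add, ← ENNReal.tsum_mul_left]
  refine ENNReal.tsum_le_tsum fun n => ?_
  rw [← mul_one_add, mul_left_comm]
  gcongr
  rw [show (1:ℝ≥0∞) = ENNReal.ofReal 1 by simp, ← ENNReal.ofReal_add (by norm_num) (by positivity),
    show (4:ℝ≥0∞) = ENNReal.ofReal 4 by simp, ← ENNReal.ofReal_mul (by norm_num)]
  exact ENNReal.ofReal_le_ofReal (wt_le h0 h1 (abs_nonneg _))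

theorem le_sobSq {σ : ℝ} (h0 : 0 < σ) (a : ℤ → ℂ) :
    (∑' n : ℤ, ENNReal.ofReal (‖a n‖ ^ 2) +
      ∑' n : ℤ, ENNReal.ofReal (‖a n‖ ^ 2) * ENNReal.ofReal (|(n:ℝ)| ^ (2 * σ))) ≤
    2 * sobSq σ a := by
  rw [sobSq, ← ENNReal.tsum_add, ← ENNReal.tsum_mul_left]
  refine ENNReal.tsum_le_tsum fun n => ?_
  rw [← mul_one_add, mul_left_comm]
  gcongr
  rw [show (1:ℝ≥0∞) = ENNReal.ofReal 1 by simp, ← ENNReal.ofReal_add (by norm_num) (by positivity),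
    show (2:ℝ≥0∞) = ENNReal.ofReal 2 by simp, ← ENNReal.ofReal_mul (by norm_num)]
  exact ENNReal.ofReal_le_ofReal (wt_ge h0 (abs_nonneg _))

theorem sobSq_contract {σ : ℝ} (h0 : 0 < σ) (h1 : σ < 1)
    (F G : C(AddCircle (2 * Real.pi), ℂ)) (L : ℝ) (hL : 0 ≤ L)
    (hFG : ∀ x y, ‖F x - F y‖ ≤ L * ‖G x - G y‖) (hFG' : ∀ x, ‖F x‖ ≤ L * ‖G x‖) :
    sobSq σ (fourierCoeff F) ≤ ENNReal.ofReal (8 * L ^ 2) * sobSq σ (fourierCoeff G) := by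
  have hA : ∑' n : ℤ, ENNReal.ofReal (‖fourierCoeff F n‖ ^ 2) ≤
      ENNReal.ofReal (L ^ 2) * ∑' n : ℤ, ENNReal.ofReal (‖fourierCoeff G n‖ ^ 2) := by
    rw [aux_parseval_ofReal, aux_parseval_ofReal, ← ENNReal.ofReal_mul (by positivity)]
    refine ENNReal.ofReal_le_ofReal ?_
    rw [← integral_const_mul]
    refine integral_mono (haar_integrable_sq F) ((haar_integrable_sq G).const_mul _) fun x => ?_
    simp only
    rw [← mul_pow]
    gcongr
    exact hFG' x
  refine (sobSq_le h0 h1 _).trans ?_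
  calc _ ≤ 4 * (ENNReal.ofReal (L ^ 2) * ∑' n : ℤ, ENNReal.ofReal (‖fourierCoeff G n‖ ^ 2) +
        ENNReal.ofReal (L ^ 2) * ∑' n : ℤ, ENNReal.ofReal (‖fourierCoeff G n‖ ^ 2) *
          ENNReal.ofReal (|(n:ℝ)| ^ (2 * σ))) := by
        exact mul_le_mul' le_rfl (add_le_add hA (gagliardo_contract h0 h1 F G L hL hFG))
    _ ≤ 4 * (ENNReal.ofReal (L ^ 2) * (2 * sobSq σ (fourierCoeff G))) := by
        rw [← mul_add]
        gcongr
        exact le_sobSq h0 _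
    _ = _ := by
        rw [ENNReal.ofReal_mul (by norm_num)]
        simp only [ENNReal.ofReal_ofNat]
        rw [show (8:ℝ≥0∞) = 4 * 2 by norm_num]
        ring

theorem sobSq_lip {σ : ℝ} (h0 : 0 < σ) (h1 : σ < 1) : ∃ K : ℝ, 0 ≤ K ∧
    ∀ (F : C(AddCircle (2 * Real.pi), ℂ)) (L M : ℝ), 0 ≤ L → (∀ x, ‖F x‖ ≤ M) →
    (∀ x (h : ℝ), ‖F (x + (h : AddCircle (2 * Real.pi))) - F x‖ ≤ L * |h|) →
    sobSq σ (fourierCoeff F) ≤ ENNReal.ofReal (K * (L + 2 * M) ^ 2) := by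
  have hne := (gInt_pos σ).ne'
  have hnt := (gInt_lt_top h0 h1).ne
  have hmt := (gMin_lt_top h0 h1).ne
  refine ⟨4 * (1 + (gMin σ / gInt σ).toReal), by positivity, ?_⟩
  intro F L M hL hM hF
  have hM0 : 0 ≤ M := (norm_nonneg _).trans (hM 0)
  have hg := gagliardo_lip h0 F L M hL hM hF
  rw [← ENNReal.le_div_iff_mul_le (Or.inl hne) (Or.inl hnt), mul_div_assoc] at hg
  have hA : ∑' n : ℤ, ENNReal.ofReal (‖fourierCoeff F n‖ ^ 2) ≤
      ENNReal.ofReal ((L + 2 * M) ^ 2) := by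
    rw [aux_parseval_ofReal]
    refine ENNReal.ofReal_le_ofReal ?_
    have : (L + 2 * M) ^ 2 =
      ∫ x : AddCircle (2 * Real.pi), (L + 2 * M) ^ 2 ∂AddCircle.haarAddCircle := by
      simp
    rw [this]
    refine integral_mono (haar_integrable_sq F) (integrable_const _) fun x => ?_
    simp only
    gcongr
    linarith [hM x]
  refine (sobSq_le h0 h1 _).trans ?_
  have hdt : gMin σ / gInt σ ≠ ∞ := ENNReal.div_ne_top hmt hne
  calc _ ≤ 4 * (ENNReal.ofReal ((L + 2 * M) ^ 2) +
        ENNReal.ofReal ((L + 2 * M) ^ 2) * (gMin σ / gInt σ)) := by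
        exact mul_le_mul' le_rfl (add_le_add hA hg)
    _ = _ := by
        rw [show 4 * (1 + (gMin σ / gInt σ).toReal) * (L + 2 * M) ^ 2 =
          4 * ((L + 2 * M) ^ 2 + (L + 2 * M) ^ 2 * (gMin σ / gInt σ).toReal) by ring,
          ENNReal.ofReal_mul (by norm_num), ENNReal.ofReal_add (by positivity) (by positivity),
          ENNReal.ofReal_mul (by positivity), ENNReal.ofReal_toReal hdt]
        simp

theorem sobSq_real {σ : ℝ} {a : ℤ → ℂ} {B : ℝ} (hB : 0 ≤ B) (h : sobSq σ a ≤ ENNReal.ofReal B) :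
    Summable (fun n : ℤ => ‖a n‖ ^ 2 * (1 + |(n:ℝ)|) ^ (2 * σ)) ∧
    ∑' n : ℤ, ‖a n‖ ^ 2 * (1 + |(n:ℝ)|) ^ (2 * σ) ≤ B := by
  have h' : ∑' n : ℤ, ENNReal.ofReal (‖a n‖ ^ 2 * (1 + |(n:ℝ)|) ^ (2 * σ)) ≤ ENNReal.ofReal B := by
    refine le_trans (le_of_eq ?_) h
    unfold sobSq
    congr 1; ext n
    rw [ENNReal.ofReal_mul (by positivity)]
  have hs : Summable (fun n : ℤ => ‖a n‖ ^ 2 * (1 + |(n:ℝ)|) ^ (2 * σ)) := by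
    have := ENNReal.summable_toReal (ne_top_of_le_ne_top ENNReal.ofReal_ne_top h')
    refine this.congr fun n => ?_
    rw [ENNReal.toReal_ofReal (by positivity)]
  refine ⟨hs, ?_⟩
  rw [← ENNReal.ofReal_tsum_of_nonneg (fun _ => by positivity) hs] at h'
  exact (ENNReal.ofReal_le_ofReal_iff hB).1 h'

theorem summable_wt {r : ℝ} (hr : 1 < r) : Summable (fun n : ℤ => (1 + |(n:ℝ)|) ^ (-r)) := by
  have hN : Summable (fun n : ℕ => (1 + (n:ℝ)) ^ (-r)) := by
    have := (summable_nat_add_iff 1).2 (Real.summable_nat_rpow.2 (show -r < -1 by linarith))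
    refine this.congr fun n => ?_
    push_cast
    rw [add_comm]
  refine Summable.of_nat_of_neg ?_ ?_
  · simpa using hN
  · simpa using hN

/-- Bernstein-type bound -/
theorem lip_wiener {β : ℝ} (hβ : β ≤ 1/4) : ∃ C : ℝ, 0 ≤ C ∧
    ∀ (F : C(AddCircle (2 * Real.pi), ℂ)) (L M : ℝ), 0 ≤ L → 0 < M → (∀ x, ‖F x‖ ≤ M) →
    (∀ x (h : ℝ), ‖F (x + (h : AddCircle (2 * Real.pi))) - F x‖ ≤ L * |h|) →
    Summable (fun n : ℤ => ‖fourierCoeff F n‖ * (1 + |(n:ℝ)|) ^ β) ∧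
    ∑' n : ℤ, ‖fourierCoeff F n‖ * (1 + |(n:ℝ)|) ^ β ≤ C * (L + 2 * M) := by
  obtain ⟨K, hK, hF⟩ := sobSq_lip (σ := 7/8) (by norm_num) (by norm_num)
  have hw := summable_wt (r := 5/4) (by norm_num)
  refine ⟨(K + ∑' n : ℤ, (1 + |(n:ℝ)|) ^ (-(5/4) : ℝ)), by positivity, ?_⟩
  intro F L M hL hM h1 h2
  obtain ⟨hs, hs'⟩ := sobSq_real (by positivity) (hF F L M hL h1 h2)
  set B := L + 2 * M with hB
  have hB0 : 0 < B := by positivity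
  have hle : ∀ n : ℤ, ‖fourierCoeff F n‖ * (1 + |(n:ℝ)|) ^ β ≤
      B⁻¹ * (‖fourierCoeff F n‖ ^ 2 * (1 + |(n:ℝ)|) ^ (2 * (7/8) : ℝ)) +
      B * (1 + |(n:ℝ)|) ^ (-(5/4) : ℝ) := by
    intro n
    have hpos : 0 < 1 + |(n:ℝ)| := by positivity
    set u := 1 + |(n:ℝ)|
    set x := ‖fourierCoeff F n‖
    have hx : 0 ≤ x := norm_nonneg _
    have e1 : u ^ β ≤ u ^ (7/8 : ℝ) * u ^ (-(5/8) : ℝ) := by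
      rw [← Real.rpow_add hpos]
      apply Real.rpow_le_rpow_of_exponent_le
      · simp [u]
      · linarith
    have e2 : u ^ (2 * (7/8) : ℝ) = (u ^ (7/8 : ℝ)) ^ 2 := by
      rw [← Real.rpow_natCast, ← Real.rpow_mul hpos.le]; norm_num
    have e3 : u ^ (-(5/4) : ℝ) = (u ^ (-(5/8) : ℝ)) ^ 2 := by
      rw [← Real.rpow_natCast, ← Real.rpow_mul hpos.le]; norm_num
    rw [e2, e3]
    set P := u ^ (7/8 : ℝ)
    set Q := u ^ (-(5/8) : ℝ)
    have hP : 0 ≤ P := by positivity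
    have hQ : 0 ≤ Q := by positivity
    calc x * u ^ β ≤ x * (P * Q) := by gcongr
      _ ≤ B⁻¹ * (x ^ 2 * P ^ 2) + B * Q ^ 2 := by
        have hh : B⁻¹ * (x ^ 2 * P ^ 2) + B * Q ^ 2 - x * (P * Q) =
            B⁻¹ * ((x * P - B * Q / 2) ^ 2 + 3 / 4 * (B * Q) ^ 2) := by
          field_simp; ring
        have : 0 ≤ B⁻¹ * ((x * P - B * Q / 2) ^ 2 + 3 / 4 * (B * Q) ^ 2) := by positivity
        linarith
  have hsum := (hs.mul_left B⁻¹).add (hw.mul_left B)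
  have hS := Summable.of_nonneg_of_le (fun n => by positivity) hle hsum
  refine ⟨hS, (hS.tsum_le_tsum hle hsum).trans ?_⟩
  rw [(hs.mul_left B⁻¹).tsum_add (hw.mul_left B), tsum_mul_left, tsum_mul_left]
  calc _ ≤ B⁻¹ * (K * B ^ 2) + B * ∑' n : ℤ, (1 + |(n:ℝ)|) ^ (-(5/4) : ℝ) := by gcongr
    _ = _ := by field_simp

theorem norm_fourier_apply (n : ℤ) (t : AddCircle (2 * Real.pi)) : ‖fourier n t‖ = 1 := by
  rw [fourier_apply]; exact Circle.norm_coe _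

theorem fSum_summable {a : ℤ → ℂ} (ha : Summable fun n => ‖a n‖) (t : AddCircle (2 * Real.pi)) :
    Summable fun n : ℤ => a n * fourier n t := by
  refine Summable.of_norm ?_
  simpa only [norm_mul, norm_fourier_apply, mul_one, one_mul, integral_const, probReal_univ, one_smul] using ha

theorem fSum_continuous {a : ℤ → ℂ} (ha : Summable fun n => ‖a n‖) : Continuous (fSum a) := by
  unfold fSum
  refine continuous_tsum (fun n => by fun_prop) ha (fun n x => ?_)
  rw [norm_mul, norm_fourier_apply, mul_one]

theorem fSum_norm_le {a : ℤ → ℂ} (ha : Summable fun n => ‖a n‖) (t : AddCircle (2 * Real.pi)) :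
    ‖fSum a t‖ ≤ ∑' n, ‖a n‖ := by
  unfold fSum
  refine (norm_tsum_le_tsum_norm ?_).trans ?_
  · simpa only [norm_mul, norm_fourier_apply, mul_one, one_mul, integral_const, probReal_univ, one_smul] using ha
  · simp only [norm_mul, norm_fourier_apply, mul_one, le_refl]

theorem fourierCoeff_fSum {a : ℤ → ℂ} (ha : Summable fun n => ‖a n‖) (n : ℤ) :
    fourierCoeff (fSum a) n = a n := by
  unfold fourierCoeff
  have h1 : ∀ t : AddCircle (2 * Real.pi), fourier (-n) t • fSum a t =
      ∑' m : ℤ, fourier (-n) t * (a m * fourier m t) := by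
    intro t
    rw [fSum, smul_eq_mul, tsum_mul_left]
  simp_rw [h1]
  have h2 : ∀ m : ℤ, ∫ t : AddCircle (2 * Real.pi), fourier (-n) t * (a m * fourier m t)
      ∂AddCircle.haarAddCircle = a m * (Pi.single m (1:ℂ) : ℤ → ℂ) n := by
    intro m
    rw [← fourierCoeff_fourier (T := 2 * Real.pi), fourierCoeff, ← integral_const_mul]
    congr 1; ext t; simp only [smul_eq_mul]; ring
  rw [← integral_tsum_of_summable_integral_norm]
  · simp_rw [h2]
    rw [tsum_eq_single n]
    · simp
    · intro m hm
      rw [Pi.single_eq_of_ne hm.symm, mul_zero]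
  · intro m
    exact (by fun_prop : Continuous fun t : AddCircle (2 * Real.pi) =>
      fourier (-n) t * (a m * fourier m t)).integrable_of_hasCompactSupport
      (HasCompactSupport.of_compactSpace _)
  · simpa only [norm_mul, norm_fourier_apply, mul_one, one_mul, integral_const, probReal_univ, one_smul] using ha

theorem fourier_add_apply (n : ℤ) (x y : AddCircle (2 * Real.pi)) :
    fourier n (x + y) = fourier n x * fourier n y := by
  simp [fourier_apply, smul_add, AddCircle.toCircle_add]

theorem fourier_lip (n : ℤ) (x : AddCircle (2 * Real.pi)) (h : ℝ) :
    ‖fourier n (x + (h : AddCircle (2 * Real.pi))) - fourier n x‖ ≤ |(n:ℝ)| * |h| := by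
  rw [fourier_add_apply, ← mul_sub_one, norm_mul, norm_fourier_apply, one_mul, aux_fourier_coe,
    ← abs_mul]
  exact norm_exp_sub_one_le _

theorem fSum_lip {a : ℤ → ℂ} (ha : Summable fun n => ‖a n‖ * (1 + |(n:ℝ)|))
    (x : AddCircle (2 * Real.pi)) (h : ℝ) :
    ‖fSum a (x + (h : AddCircle (2 * Real.pi))) - fSum a x‖ ≤
      (∑' n : ℤ, ‖a n‖ * (1 + |(n:ℝ)|)) * |h| := by
  have ha' : Summable fun n => ‖a n‖ := Summable.of_nonneg_of_le (fun n => norm_nonneg _)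
    (fun n => le_mul_of_one_le_right (norm_nonneg _) (by simp)) ha
  unfold fSum
  rw [← (fSum_summable ha' _).tsum_sub (fSum_summable ha' _), ← tsum_mul_right]
  refine tsum_of_norm_bounded (ha.mul_right _).hasSum fun n => ?_
  rw [← mul_sub, norm_mul, mul_assoc]
  gcongr
  refine (fourier_lip n x h).trans ?_
  gcongr
  linarith

theorem cont_of_lip {F : AddCircle (2 * Real.pi) → ℂ} {L : ℝ}
    (hF : ∀ x (h : ℝ), ‖F (x + (h : AddCircle (2 * Real.pi))) - F x‖ ≤ L * |h|) : Continuous F := by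
  have hq : IsQuotientMap (QuotientAddGroup.mk : ℝ → AddCircle (2 * Real.pi)) :=
    QuotientAddGroup.isQuotientMap_mk _
  rw [hq.continuous_iff]
  have hL : 0 ≤ L := by
    have := (norm_nonneg _).trans (hF 0 1)
    simpa using this
  refine LipschitzWith.continuous (K := ⟨L, hL⟩) (LipschitzWith.of_dist_le_mul fun x y => ?_)
  rw [dist_eq_norm, dist_eq_norm]
  have := hF (y : AddCircle (2 * Real.pi)) (x - y)
  rw [← AddCircle.coe_add, add_sub_cancel] at this
  exact this

theorem pow_lip {u v : ℂ} {r D : ℝ} (hr : 0 ≤ r) (hu : ‖u‖ ≤ r) (hv : ‖v‖ ≤ r)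
    (huv : ‖u - v‖ ≤ r ^ 2 * D) (i : ℕ) : ‖u ^ i - v ^ i‖ ≤ i * r ^ (i + 1) * D := by
  induction i with
  | zero => simp
  | succ i ih =>
    have : u ^ (i + 1) - v ^ (i + 1) = u * (u ^ i - v ^ i) + (u - v) * v ^ i := by ring
    rw [this]
    refine (norm_add_le _ _).trans ?_
    rw [norm_mul, norm_mul, norm_pow]
    calc _ ≤ r * (i * r ^ (i + 1) * D) + (r ^ 2 * D) * r ^ i := by
          gcongr
          exact (norm_nonneg _).trans huv
      _ = _ := by push_cast; ring

theorem wt_submul {β : ℝ} (hβ : 0 ≤ β) (m n : ℤ) :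
    (1 + |((m + n : ℤ) : ℝ)|) ^ β ≤ (1 + |(m:ℝ)|) ^ β * (1 + |(n:ℝ)|) ^ β := by
  rw [← Real.mul_rpow (by positivity) (by positivity)]
  apply Real.rpow_le_rpow (by positivity) _ hβ
  push_cast
  nlinarith [abs_add_le (m:ℝ) n, abs_nonneg (m:ℝ), abs_nonneg (n:ℝ), mul_nonneg (abs_nonneg (m:ℝ)) (abs_nonneg (n:ℝ))]

/-- quotient functions are Lipschitz -/
theorem quot_lip {φ P : AddCircle (2 * Real.pi) → ℂ} {U : Set (AddCircle (2 * Real.pi))}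
    {Lφ LP M ρ : ℝ} (hρ : 0 < ρ) (hM : ∀ x, ‖φ x‖ ≤ M)
    (hφ : ∀ x (h : ℝ), ‖φ (x + (h : AddCircle (2 * Real.pi))) - φ x‖ ≤ Lφ * |h|)
    (hP : ∀ x (h : ℝ), ‖P (x + (h : AddCircle (2 * Real.pi))) - P x‖ ≤ LP * |h|)
    (hU : ∀ t ∈ U, φ t = 0) (hPU : ∀ t ∉ U, ρ ≤ ‖P t‖) (i : ℕ) :
    (∀ x, ‖φ x * (P x)⁻¹ ^ i‖ ≤ ρ⁻¹ ^ i * M) ∧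
    ∀ x (h : ℝ), ‖φ (x + (h : AddCircle (2 * Real.pi))) *
        (P (x + (h : AddCircle (2 * Real.pi))))⁻¹ ^ i - φ x * (P x)⁻¹ ^ i‖ ≤
      ρ⁻¹ ^ i * (Lφ + M * i * ρ⁻¹ * LP) * |h| := by
  have hM0 : 0 ≤ M := (norm_nonneg _).trans (hM 0)
  have hLP : 0 ≤ LP := by simpa using (norm_nonneg _).trans (hP 0 1)
  have hLφ : 0 ≤ Lφ := by simpa using (norm_nonneg _).trans (hφ 0 1)
  set r := ρ⁻¹ with hr
  have hr0 : 0 < r := by positivity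
  have hinv : ∀ t ∉ U, ‖(P t)⁻¹‖ ≤ r := by
    intro t ht
    rw [norm_inv]
    exact inv_anti₀ hρ (hPU t ht)
  have hinvp : ∀ t ∉ U, ‖(P t)⁻¹ ^ i‖ ≤ r ^ i := by
    intro t ht
    rw [norm_pow]
    exact pow_le_pow_left₀ (norm_nonneg _) (hinv t ht) _
  constructor
  · intro x
    by_cases hx : x ∈ U
    · rw [hU x hx, zero_mul, norm_zero]; positivity
    · rw [norm_mul, mul_comm]
      gcongr
      · exact hinvp x hx
      · exact hM x
  · intro x h
    set y := x + (h : AddCircle (2 * Real.pi)) with hy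
    by_cases hx : x ∈ U
    · by_cases hyU : y ∈ U
      · rw [hU x hx, hU y hyU]; simp; positivity
      · have h1 := hφ x h
        rw [← hy, hU x hx, sub_zero] at h1
        rw [hU x hx, zero_mul, sub_zero, norm_mul]
        calc _ ≤ (Lφ * |h|) * r ^ i := by
              gcongr
              exact hinvp y hyU
          _ = r ^ i * Lφ * |h| := by ring
          _ ≤ _ := by
              gcongr
              have : 0 ≤ M * i * r * LP := by positivity
              linarith
    · by_cases hyU : y ∈ U
      · have h1 := hφ x h
        rw [← hy, hU y hyU, zero_sub, norm_neg] at h1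
        rw [hU y hyU, zero_mul, zero_sub, norm_neg, norm_mul]
        calc _ ≤ (Lφ * |h|) * r ^ i := by
              gcongr
              exact hinvp x hx
          _ = r ^ i * Lφ * |h| := by ring
          _ ≤ _ := by
              gcongr
              have : 0 ≤ M * i * r * LP := by positivity
              linarith
      · have hPx : P x ≠ 0 := by
          have := hPU x hx
          intro h0; rw [h0, norm_zero] at this; linarith
        have hPy : P y ≠ 0 := by
          have := hPU y hyU
          intro h0; rw [h0, norm_zero] at this; linarith
        have e : φ y * (P y)⁻¹ ^ i - φ x * (P x)⁻¹ ^ i =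
          (φ y - φ x) * (P y)⁻¹ ^ i + φ x * ((P y)⁻¹ ^ i - (P x)⁻¹ ^ i) := by ring
        have huv : ‖(P y)⁻¹ - (P x)⁻¹‖ ≤ r ^ 2 * (LP * |h|) := by
          have e2 : (P y)⁻¹ - (P x)⁻¹ = (P y)⁻¹ * (P x)⁻¹ * (P x - P y) := by
            field_simp
          rw [e2, norm_mul, norm_mul, sq, norm_sub_rev]
          gcongr
          · exact hinv y hyU
          · exact hinv x hx
          · exact hP x h
        rw [e]
        refine (norm_add_le _ _).trans ?_
        rw [norm_mul, norm_mul]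
        calc _ ≤ (Lφ * |h|) * r ^ i + M * (i * r ^ (i + 1) * (LP * |h|)) := by
              gcongr
              · exact hφ x h
              · exact hinvp y hyU
              · exact hM x
              · exact pow_lip hr0.le (hinv y hyU) (hinv x hx) huv i
          _ = _ := by ring

theorem wt_one_le {β : ℝ} (hβ : 0 ≤ β) (n : ℤ) : 1 ≤ (1 + |(n:ℝ)|) ^ β :=
  Real.one_le_rpow (by simp) hβ

theorem summable_norm_of_wt {β : ℝ} (hβ : 0 ≤ β) {a : ℤ → ℂ}
    (ha : Summable fun n : ℤ => ‖a n‖ * (1 + |(n:ℝ)|) ^ β) : Summable fun n => ‖a n‖ :=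
  Summable.of_nonneg_of_le (fun n => norm_nonneg _)
    (fun n => le_mul_of_one_le_right (norm_nonneg _) (wt_one_le hβ n)) ha

/-- pairing is summable -/
theorem pair_summable {β B : ℝ} {s a : ℤ → ℂ}
    (hs : ∀ n, ‖s n‖ ≤ B * (1 + |(n:ℝ)|) ^ β)
    (ha : Summable fun n : ℤ => ‖a n‖ * (1 + |(n:ℝ)|) ^ β) :
    Summable (fun n => s n * a n) ∧ ‖∑' n, s n * a n‖ ≤ B * ∑' n : ℤ, ‖a n‖ * (1 + |(n:ℝ)|) ^ β := by
  have hle : ∀ n, ‖s n * a n‖ ≤ B * (‖a n‖ * (1 + |(n:ℝ)|) ^ β) := by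
    intro n
    rw [norm_mul]
    calc _ ≤ B * (1 + |(n:ℝ)|) ^ β * ‖a n‖ := by gcongr; exact hs n
      _ = _ := by ring
  refine ⟨Summable.of_norm_bounded (ha.mul_left B) hle, ?_⟩
  rw [← tsum_mul_left]
  exact tsum_of_norm_bounded (ha.mul_left B).hasSum hle

theorem shift_bound {β B : ℝ} (hβ : 0 ≤ β) {s : ℤ → ℂ}
    (hs : ∀ n, ‖s n‖ ≤ B * (1 + |(n:ℝ)|) ^ β) (m n : ℤ) :
    ‖s (n + m)‖ ≤ (B * (1 + |(m:ℝ)|) ^ β) * (1 + |(n:ℝ)|) ^ β := by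
  have hB : 0 ≤ B := by
    have := (norm_nonneg _).trans (hs 0)
    simpa using this
  calc _ ≤ _ := hs (n + m)
    _ ≤ B * ((1 + |(n:ℝ)|) ^ β * (1 + |(m:ℝ)|) ^ β) := by
      gcongr; exact wt_submul hβ n m
    _ = _ := by ring

def opM (J : Finset ℤ) (c s : ℤ → ℂ) (m : ℤ) : ℂ := ∑ j ∈ J, c j * s (j + m)

theorem opM_prop {β B ε : ℝ} (hβ : 0 ≤ β) {s c : ℤ → ℂ} (J : Finset ℤ)
    (hs : ∀ n, ‖s n‖ ≤ B * (1 + |(n:ℝ)|) ^ β)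
    (hc : Summable fun n : ℤ => ‖c n‖ * (1 + |(n:ℝ)|) ^ β)
    (hJ : ∑' n : ℤ, ‖(if n ∈ J then 0 else c n)‖ * (1 + |(n:ℝ)|) ^ β ≤ ε)
    (hann : ∀ m, ∑' j, c j * s (j + m) = 0) :
    (∀ n, ‖opM J c s n‖ ≤ (ε * B) * (1 + |(n:ℝ)|) ^ β) ∧
    ∀ m, ∑' j, c j * opM J c s (j + m) = 0 := by
  have hB : 0 ≤ B := by
    have := (norm_nonneg _).trans (hs 0)
    simpa using this
  have hsum : ∀ m, Summable fun j => c j * s (j + m) := by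
    intro m
    have := (pair_summable (shift_bound hβ hs m) hc).1
    simpa only [mul_comm] using this
  constructor
  · intro m
    have hd : Summable fun n : ℤ => ‖(if n ∈ J then 0 else c n)‖ * (1 + |(n:ℝ)|) ^ β := by
      refine Summable.of_nonneg_of_le (fun n => by positivity) (fun n => ?_) hc
      gcongr
      split_ifs <;> simp
    have h1 := pair_summable (shift_bound hβ hs m) hd
    have e : opM J c s m = - ∑' n, s (n + m) * (if n ∈ J then 0 else c n) := by
      have e1 : opM J c s m = ∑' n, (if n ∈ J then c n * s (n + m) else 0) := by
        rw [tsum_eq_sum (s := J)]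
        · rw [opM]; exact Finset.sum_congr rfl fun j hj => by simp [hj]
        · intro b hb; simp [hb]
      have hs1 : Summable fun n => (if n ∈ J then c n * s (n + m) else 0) :=
        summable_of_ne_finset_zero (s := J) (fun b hb => by simp [hb])
      rw [eq_neg_iff_add_eq_zero, e1, ← hs1.tsum_add h1.1]
      refine Eq.trans ?_ (hann m)
      congr 1; ext n
      split_ifs <;> simp [mul_comm]
    rw [e, norm_neg]
    refine h1.2.trans ?_
    calc _ ≤ B * (1 + |(m:ℝ)|) ^ β * ε := by gcongr
      _ = _ := by ring
  · intro m
    simp only [opM, Finset.mul_sum]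
    rw [Summable.tsum_finsetSum]
    · refine Finset.sum_eq_zero fun i _ => ?_
      have := hann (i + m)
      calc _ = ∑' j, c i * (c j * s (j + (i + m))) := by
            congr 1; ext j
            rw [show i + (j + m) = j + (i + m) by ring]; ring
        _ = 0 := by rw [tsum_mul_left, this, mul_zero]
    · intro i _
      refine ((hsum (i + m)).mul_left (c i)).congr fun j => ?_
      rw [show i + (j + m) = j + (i + m) by ring]; ring

theorem fourierCoeff_mul_trig (J : Finset ℤ) (c : ℤ → ℂ) (g : C(AddCircle (2 * Real.pi), ℂ)) (n : ℤ) :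
    fourierCoeff (fun t => (∑ j ∈ J, c j * fourier j t) * g t) n =
      ∑ j ∈ J, c j * fourierCoeff g (n - j) := by
  simp only [fourierCoeff, smul_eq_mul, Finset.sum_mul, Finset.mul_sum]
  rw [integral_finsetSum]
  · refine Finset.sum_congr rfl fun j _ => ?_
    rw [← integral_const_mul]
    congr 1; ext t
    rw [show -(n - j) = -n + j by ring, fourier_add]
    ring
  · intro j _
    exact (by fun_prop : Continuous fun t : AddCircle (2 * Real.pi) =>
      fourier (-n) t * (c j * fourier j t * g t)).integrable_of_hasCompactSupport
      (HasCompactSupport.of_compactSpace _)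

theorem pair_opM {β B : ℝ} (hβ : 0 ≤ β) {s c γ : ℤ → ℂ} (J : Finset ℤ)
    (hs : ∀ n, ‖s n‖ ≤ B * (1 + |(n:ℝ)|) ^ β)
    (hγ : Summable fun n : ℤ => ‖γ n‖ * (1 + |(n:ℝ)|) ^ β) :
    ∑' n, s n * (∑ j ∈ J, c j * γ (n - j)) = ∑' n, opM J c s n * γ n := by
  have hsum : ∀ j, Summable fun n => s (n + j) * γ n := fun j =>
    (pair_summable (shift_bound hβ hs j) hγ).1
  have hsum' : ∀ j, Summable fun n => s n * γ (n - j) := fun j => by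
    rw [← (Equiv.addRight j).summable_iff]
    refine (hsum j).congr fun n => ?_
    simp
  simp only [opM, Finset.mul_sum, Finset.sum_mul]
  rw [Summable.tsum_finsetSum, Summable.tsum_finsetSum]
  · refine Finset.sum_congr rfl fun j _ => ?_
    calc _ = c j * ∑' n, s n * γ (n - j) := by
          rw [← tsum_mul_left]; congr 1; ext n; ring
      _ = c j * ∑' n, s (n + j) * γ n := by
          rw [← (Equiv.addRight j).tsum_eq]; simp
      _ = _ := by
          rw [← tsum_mul_left]; congr 1; ext n; rw [add_comm n j]; ring
  · intro j _
    refine ((hsum j).mul_left (c j)).congr fun n => ?_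
    rw [add_comm n j]; ring
  · intro j _
    refine ((hsum' j).mul_left (c j)).congr fun n => ?_
    ring

theorem newman {β B : ℝ} (hβ : 0 ≤ β) (hβ' : β ≤ 1/4) {s c : ℤ → ℂ}
    (hs : ∀ n, ‖s n‖ ≤ B * (1 + |(n:ℝ)|) ^ β)
    (hc : Summable fun n : ℤ => ‖c n‖ * (1 + |(n:ℝ)|) ^ β)
    (hann : ∀ m, ∑' j, c j * s (j + m) = 0)
    {a : ℤ → ℂ} (ha : Summable fun n => ‖a n‖ * (1 + |(n:ℝ)|))
    {U : Set (AddCircle (2 * Real.pi))} (hU : IsOpen U) (hZ : zeroSet c ⊆ U)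
    (hφ : ∀ t ∈ U, fSum a t = 0) : ∑' n, s n * a n = 0 := by
  have hB : 0 ≤ B := by
    have := (norm_nonneg _).trans (hs 0)
    simpa using this
  have hc1 := summable_norm_of_wt hβ hc
  have ha1 : Summable fun n => ‖a n‖ := Summable.of_nonneg_of_le (fun n => norm_nonneg _)
    (fun n => le_mul_of_one_le_right (norm_nonneg _) (by simp)) ha
  -- lower bound
  obtain ⟨δ, hδ, hδf⟩ : ∃ δ : ℝ, 0 < δ ∧ ∀ t ∉ U, δ ≤ ‖fSum c t‖ := by
    have hK : IsCompact Uᶜ := hU.isClosed_compl.isCompact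
    rcases (Uᶜ).eq_empty_or_nonempty with h | h
    · refine ⟨1, one_pos, fun t ht => ?_⟩
      have : t ∈ Uᶜ := ht
      rw [h] at this; exact this.elim
    · obtain ⟨t0, ht0, hmin⟩ := hK.exists_isMinOn h (fSum_continuous hc1).norm.continuousOn
      refine ⟨‖fSum c t0‖, ?_, fun t ht => hmin ht⟩
      rw [norm_pos_iff]
      intro h0
      exact ht0 (hZ h0)
  obtain ⟨J, hJ⟩ : ∃ J : Finset ℤ,
      ∑' n : ℤ, ‖(if n ∈ J then 0 else c n)‖ * (1 + |(n:ℝ)|) ^ β ≤ δ / 3 := by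
    have h1 := tendsto_tsum_compl_atTop_zero (fun n : ℤ => ‖c n‖ * (1 + |(n:ℝ)|) ^ β)
    obtain ⟨J, hJ⟩ := (h1.eventually (gt_mem_nhds (show (0:ℝ) < δ / 3 by positivity))).exists
    refine ⟨J, le_trans (le_of_eq ?_) hJ.le⟩
    have := tsum_subtype ({x | x ∉ J}) (fun n : ℤ => ‖c n‖ * (1 + |(n:ℝ)|) ^ β)
    refine Eq.trans ?_ this.symm
    congr 1; ext n
    by_cases h : n ∈ J <;> simp [h]
  set P : AddCircle (2 * Real.pi) → ℂ := fun t => ∑ j ∈ J, c j * fourier j t with hPdef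
  have hPU : ∀ t ∉ U, 2 * δ / 3 ≤ ‖P t‖ := by
    intro t ht
    have hd : Summable fun n : ℤ => ‖(if n ∈ J then 0 else c n)‖ * (1 + |(n:ℝ)|) ^ β := by
      refine Summable.of_nonneg_of_le (fun n => by positivity) (fun n => ?_) hc
      gcongr
      split_ifs <;> simp
    have hd1 := summable_norm_of_wt hβ hd
    have h1 : fSum c t = P t + fSum (fun n => if n ∈ J then 0 else c n) t := by
      have hs1 : Summable fun n => (if n ∈ J then c n * fourier n t else 0) :=
        summable_of_ne_finset_zero (s := J) (fun b hb => by simp [hb])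
      have e1 : P t = ∑' n, (if n ∈ J then c n * fourier n t else 0) := by
        rw [tsum_eq_sum (s := J)]
        · exact Finset.sum_congr rfl fun j hj => by rw [if_pos hj]
        · intro b hb; simp [hb]
      rw [e1, fSum, fSum, ← hs1.tsum_add (fSum_summable hd1 t)]
      congr 1; ext n
      split_ifs <;> simp
    have h2 : ‖fSum (fun n => if n ∈ J then 0 else c n) t‖ ≤ δ / 3 := by
      refine (fSum_norm_le hd1 t).trans (le_trans ?_ hJ)
      exact hd1.tsum_le_tsum (fun n => le_mul_of_one_le_right (norm_nonneg _) (wt_one_le hβ n)) hd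
    have h3 := hδf t ht
    rw [h1] at h3
    have := norm_add_le (P t) (fSum (fun n => if n ∈ J then 0 else c n) t)
    linarith
  obtain ⟨LP, hLP⟩ : ∃ LP : ℝ, ∀ x (h : ℝ), ‖P (x + (h : AddCircle (2 * Real.pi))) - P x‖ ≤ LP * |h| := by
    refine ⟨∑ j ∈ J, ‖c j‖ * |(j:ℝ)|, fun x h => ?_⟩
    simp only [hPdef]
    rw [← Finset.sum_sub_distrib, Finset.sum_mul]
    refine norm_sum_le_of_le _ fun j _ => ?_
    rw [← mul_sub, norm_mul, mul_assoc]
    gcongr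
    exact fourier_lip j x h
  set Lφ := ∑' n : ℤ, ‖a n‖ * (1 + |(n:ℝ)|) with hLφ
  set M := 1 + ∑' n : ℤ, ‖a n‖ with hM
  have hM0 : 0 < M := by positivity
  have hLφ0 : 0 ≤ Lφ := by positivity
  have hLP0 : 0 ≤ LP := by simpa using (norm_nonneg _).trans (hLP 0 1)
  have hρ : 0 < 2 * δ / 3 := by positivity
  set r := (2 * δ / 3)⁻¹ with hr
  have hr0 : 0 < r := by positivity
  have hq := fun i : ℕ => quot_lip (φ := fSum a) (P := P) (U := U) (M := M) hρ
    (fun x => (fSum_norm_le ha1 x).trans (by linarith)) (fSum_lip ha) hLP hφ hPU i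
  set G : ℕ → C(AddCircle (2 * Real.pi), ℂ) := fun i =>
    ⟨fun x => fSum a x * (P x)⁻¹ ^ i, cont_of_lip (hq i).2⟩ with hG
  obtain ⟨C, hC0, hC⟩ := lip_wiener hβ'
  have hGw := fun i : ℕ => hC (G i) (r ^ i * (Lφ + M * i * r * LP)) (r ^ i * M) (by positivity)
    (by positivity) (hq i).1 (hq i).2
  set S : ℕ → ℤ → ℂ := fun i => (opM J c)^[i] s with hS
  have hSp : ∀ i, (∀ n, ‖S i n‖ ≤ ((δ / 3) ^ i * B) * (1 + |(n:ℝ)|) ^ β) ∧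
      ∀ m, ∑' j, c j * S i (j + m) = 0 := by
    intro i
    induction i with
    | zero => simpa [hS] using ⟨hs, hann⟩
    | succ i ih =>
      have := opM_prop hβ J ih.1 hc hJ ih.2
      simp only [hS, Function.iterate_succ_apply']
      refine ⟨fun n => (this.1 n).trans (le_of_eq (by ring)), this.2⟩
  have hstep : ∀ i, ∑' n, S i n * fourierCoeff (G i) n = ∑' n, s n * a n := by
    intro i
    induction i with
    | zero =>
      have : (G 0 : AddCircle (2 * Real.pi) → ℂ) = fSum a := by ext x; simp [hG]
      rw [this]
      simp only [fourierCoeff_fSum ha1]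
      rfl
    | succ i ih =>
      rw [← ih]
      simp only [hS, Function.iterate_succ_apply']
      rw [← pair_opM hβ J (hSp i).1 (hGw (i + 1)).1]
      congr 1; ext n
      rw [← fourierCoeff_mul_trig]
      congr 2
      ext t
      simp only [hG, ContinuousMap.coe_mk]
      by_cases ht : t ∈ U
      · rw [hφ t ht]; simp
      · have hP0 : P t ≠ 0 := by
          have := hPU t ht
          intro h0; rw [h0, norm_zero] at this; linarith
        have : ∑ j ∈ J, c j * fourier j t = P t := rfl
        rw [this]
        have h1 : P t * (P t)⁻¹ = 1 := mul_inv_cancel₀ hP0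
        rw [pow_succ]
        linear_combination (fSum a t * (P t)⁻¹ ^ i) * h1
  have hbound : ∀ i : ℕ, ‖∑' n, s n * a n‖ ≤
      (B * C * (Lφ + 2 * M)) * (1 / 2) ^ i + (B * C * (M * r * LP)) * (i * (1 / 2) ^ i) := by
    intro i
    rw [← hstep i]
    refine ((pair_summable (hSp i).1 (hGw i).1).2).trans ?_
    calc _ ≤ (δ / 3) ^ i * B * (C * (r ^ i * (Lφ + M * i * r * LP) + 2 * (r ^ i * M))) := by
          gcongr
          exact (hGw i).2
      _ = ((δ / 3) * r) ^ i * (B * C * (Lφ + 2 * M) + (B * C * (M * r * LP)) * i) := by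
          rw [mul_pow]; ring
      _ = _ := by
          have : δ / 3 * r = 1 / 2 := by rw [hr]; field_simp
          rw [this]; ring
  have hlim : Tendsto (fun i : ℕ => (B * C * (Lφ + 2 * M)) * (1 / 2 : ℝ) ^ i +
      (B * C * (M * r * LP)) * (i * (1 / 2) ^ i)) atTop (𝓝 0) := by
    have h1 := tendsto_pow_atTop_nhds_zero_of_lt_one (r := (1/2:ℝ)) (by norm_num) (by norm_num)
    have h2 := tendsto_self_mul_const_pow_of_lt_one (r := (1/2:ℝ)) (by norm_num) (by norm_num)
    simpa using (h1.const_mul (B * C * (Lφ + 2 * M))).add (h2.const_mul (B * C * (M * r * LP)))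
  have := ge_of_tendsto' hlim hbound
  exact norm_le_zero_iff.1 this

/-- rapidly decreasing -/
def Rapid (a : ℤ → ℂ) : Prop := ∀ m : ℕ, Summable fun n : ℤ => ‖a n‖ * (1 + |(n:ℝ)|) ^ m

theorem kfold_van {β B : ℝ} (hβ : 0 ≤ β) (hβ' : β ≤ 1/4) {s c : ℤ → ℂ}
    (hs : ∀ n, ‖s n‖ ≤ B * (1 + |(n:ℝ)|) ^ β)
    (hc : Summable fun n : ℤ => ‖c n‖ * (1 + |(n:ℝ)|) ^ β)
    (hann : ∀ m, ∑' j, c j * s (j + m) = 0) (k : ℕ) :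
    ∀ a : ℤ → ℂ, Rapid a → ∀ U : Set (AddCircle (2 * Real.pi)), IsOpen U →
      kFold k (zeroSet c) ⊆ U → (∀ t ∈ U, fSum a t = 0) → ∑' n, s n ^ k * a n = 0 := by
  have hB : 0 ≤ B := by
    have := (norm_nonneg _).trans (hs 0)
    simpa using this
  have hc1 := summable_norm_of_wt hβ hc
  have hZc : IsCompact (zeroSet c) :=
    (isClosed_singleton.preimage (fSum_continuous hc1) : IsClosed (fSum c ⁻¹' {0})).isCompact
  have hs1 : ∀ n, ‖s n‖ ≤ B * (1 + |(n:ℝ)|) := by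
    intro n
    refine (hs n).trans ?_
    gcongr
    nth_rw 2 [← Real.rpow_one (1 + |(n:ℝ)|)]
    exact Real.rpow_le_rpow_of_exponent_le (by simp) (by linarith)
  have hmul : ∀ a, Rapid a → Rapid (fun n => s n * a n) := by
    intro a ha m
    refine Summable.of_nonneg_of_le (fun n => by positivity) (fun n => ?_) ((ha (m+1)).mul_left B)
    rw [norm_mul]
    calc _ ≤ (B * (1 + |(n:ℝ)|)) * ‖a n‖ * (1 + |(n:ℝ)|) ^ m := by gcongr; exact hs1 n
      _ = _ := by ring
  have ht : ∀ (a : ℤ → ℂ) (x : AddCircle (2 * Real.pi)), Rapid a → Rapid (fun n => a n * fourier n x) := by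
    intro a x ha m
    simpa only [norm_mul, norm_fourier_apply, mul_one] using ha m
  induction k with
  | zero =>
    intro a ha U hU hZ hφ
    have h0 : (0 : AddCircle (2 * Real.pi)) ∈ U := hZ ⟨Fin.elim0, fun i => i.elim0, by simp⟩
    have := hφ 0 h0
    rw [fSum] at this
    simpa using this
  | succ k ih =>
    intro a ha U hU hZ hφ
    set U1 : Set (AddCircle (2 * Real.pi)) := {x | ∀ y ∈ zeroSet c, x + y ∈ U} with hU1
    have hU1o : IsOpen U1 := by
      rw [isOpen_iff_mem_nhds]
      intro x hx
      have : ∀ᶠ z in 𝓝 x, ∀ y ∈ zeroSet c, z + y ∈ U := by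
        refine hZc.eventually_forall_of_forall_eventually fun y hy => ?_
        have hcont : Continuous fun z : AddCircle (2 * Real.pi) × AddCircle (2 * Real.pi) =>
          z.1 + z.2 := by fun_prop
        exact (hU.preimage hcont).mem_nhds (hx y hy)
      exact this
    have hsub : kFold k (zeroSet c) ⊆ U1 := by
      rintro x ⟨g, hg, rfl⟩ y hy
      refine hZ ⟨Fin.snoc (α := fun _ => AddCircle (2 * Real.pi)) g y, ?_, ?_⟩
      · intro i
        refine Fin.lastCases ?_ (fun j => ?_) i
        · simpa using hy
        · simpa using hg j
      · rw [Fin.sum_univ_castSucc]; simp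
    have hvan : ∀ x ∈ U1, fSum (fun n => s n * a n) x = 0 := by
      intro x hx
      have hcont : Continuous fun y : AddCircle (2 * Real.pi) => x + y := by fun_prop
      have hr := ht a x ha
      have := newman hβ hβ' hs hc hann (a := fun n => a n * fourier n x)
        (by simpa using hr 1) (hU.preimage hcont) (fun y hy => hx y hy) (fun y hy => ?_)
      · rw [fSum, ← this]; congr 1; ext n; ring
      · have := hφ (x + y) hy
        rw [fSum] at this ⊢
        rw [← this]; congr 1; ext n
        rw [fourier_add_apply]; ring
    rw [← ih _ (hmul a ha) U1 hU1o hsub hvan]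
    congr 1; ext n; ring

theorem fs_summable {M : Type*} [AddCommMonoid M] [TopologicalSpace M] (a : ℤ →₀ ℂ) {g : ℤ → M}
    (hg : ∀ n, a n = 0 → g n = 0) : Summable g :=
  summable_of_ne_finset_zero (s := a.support) (fun b hb => hg b (by simpa using hb))

theorem fs_norm (a : ℤ →₀ ℂ) : Summable fun n => ‖a n‖ := fs_summable a (fun n h => by simp [h])

theorem fs_sq (a : ℤ →₀ ℂ) (σ : ℝ) : Summable fun n : ℤ => ‖a n‖ ^ 2 * (1 + |(n:ℝ)|) ^ (2 * σ) :=
  fs_summable a (fun n h => by simp [h])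

theorem riesz_circle (f : StrongDual ℝ C(AddCircle (2 * Real.pi), ℝ))
    (hf : ∀ g, (∀ t, 0 ≤ g t) → 0 ≤ f g) :
    ∃ μ : Measure (AddCircle (2 * Real.pi)), IsFiniteMeasure μ ∧
      ∀ g : C(AddCircle (2 * Real.pi), ℝ), ∫ t, g t ∂μ = f g := by
  let Λ0 : CompactlySupportedContinuousMap (AddCircle (2 * Real.pi)) ℝ →ₗ[ℝ] ℝ :=
    { toFun := fun g => f g.toContinuousMap
      map_add' := fun g h => by rw [← map_add]; rfl
      map_smul' := fun r g => by
        rw [RingHom.id_apply, ← map_smul]; rfl }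
  let Λ : CompactlySupportedContinuousMap (AddCircle (2 * Real.pi)) ℝ →ₚ[ℝ] ℝ :=
    PositiveLinearMap.mk₀ Λ0 (fun g hg => hf _ (fun t => hg t))
  refine ⟨RealRMK.rieszMeasure Λ, inferInstance, fun g => ?_⟩
  exact RealRMK.integral_rieszMeasure Λ (CompactlySupportedContinuousMap.continuousMapEquiv g)

theorem fSum_conv (a b : ℤ →₀ ℂ) (x y : ℝ) (t : AddCircle (2 * Real.pi)) :
    (fSum (x • a + y • b : ℤ →₀ ℂ) t).re = x * (fSum a t).re + y * (fSum b t).re := by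
  have : fSum (x • a + y • b : ℤ →₀ ℂ) t = x * fSum a t + y * fSum b t := by
    unfold fSum
    rw [← tsum_mul_left, ← tsum_mul_left, ← Summable.tsum_add
      (fs_summable a fun n h => by simp [h]) (fs_summable b fun n h => by simp [h])]
    congr 1; ext n
    simp only [Finsupp.add_apply, Finsupp.smul_apply, Complex.real_smul]
    ring
  rw [this]; simp

theorem sq_conv (u v : ℂ) (x y : ℝ) (hx : 0 ≤ x) (hy : 0 ≤ y) (hxy : x + y = 1) :
    ‖x • u + y • v‖ ^ 2 ≤ x * ‖u‖ ^ 2 + y * ‖v‖ ^ 2 := by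
  have h := norm_add_le (x • u) (y • v)
  rw [norm_smul, norm_smul, Real.norm_of_nonneg hx, Real.norm_of_nonneg hy] at h
  have h2 : ‖x • u + y • v‖ ^ 2 ≤ (x * ‖u‖ + y * ‖v‖) ^ 2 := by gcongr
  have : y = 1 - x := by linarith
  subst this
  nlinarith [mul_nonneg hx hy, sq_nonneg (‖u‖ - ‖v‖), mul_nonneg (mul_nonneg hx hy) (sq_nonneg (‖u‖ - ‖v‖))]

theorem capacity_dual {σ : ℝ} {E : Set (AddCircle (2 * Real.pi))} (hE : IsCompact E)
    (hne : E.Nonempty) {ε : ℝ} (hε : 0 < ε)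
    (hno : ∀ a : ℤ →₀ ℂ, (∀ t ∈ E, 1 ≤ (fSum a t).re) →
      ε ≤ ∑' n : ℤ, ‖a n‖ ^ 2 * (1 + |(n:ℝ)|) ^ (2 * σ)) :
    ∃ μ : Measure (AddCircle (2 * Real.pi)), IsFiniteMeasure μ ∧ μ univ ≠ 0 ∧ μ Eᶜ = 0 ∧
      ∃ C : ℝ, ∀ a : ℤ →₀ ℂ, ∑' n : ℤ, ‖a n‖ ^ 2 * (1 + |(n:ℝ)|) ^ (2 * σ) < ε →
        ∫ t, (fSum a t).re ∂μ ≤ C := by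
  set A : Set C(AddCircle (2 * Real.pi), ℝ) := {g | ∃ a : ℤ →₀ ℂ, ∃ η > 0,
    ∑' n : ℤ, ‖a n‖ ^ 2 * (1 + |(n:ℝ)|) ^ (2 * σ) < ε ∧ ∀ t ∈ E, g t + η ≤ (fSum a t).re} with hA
  have hconv : Convex ℝ A := by
    rintro g ⟨a, η, hη, ha, hg⟩ g' ⟨a', η', hη', ha', hg'⟩ x y hx hy hxy
    refine ⟨x • a + y • a', x * η + y * η', ?_, ?_, ?_⟩
    · rcases hx.eq_or_lt with h | h
      · have : y = 1 := by linarith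
        simp [← h, this, hη']
      · positivity
    · calc _ ≤ ∑' n : ℤ, (x * (‖a n‖ ^ 2 * (1 + |(n:ℝ)|) ^ (2 * σ)) +
            y * (‖a' n‖ ^ 2 * (1 + |(n:ℝ)|) ^ (2 * σ))) := by
            refine Summable.tsum_le_tsum (fun n => ?_) (fs_sq _ _)
              (((fs_sq a σ).mul_left x).add ((fs_sq a' σ).mul_left y))
            rw [← mul_assoc, ← mul_assoc, ← add_mul]
            gcongr
            exact sq_conv _ _ x y hx hy hxy
        _ = x * (∑' n : ℤ, (‖a n‖ ^ 2 * (1 + |(n:ℝ)|) ^ (2 * σ))) +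
            y * (∑' n : ℤ, (‖a' n‖ ^ 2 * (1 + |(n:ℝ)|) ^ (2 * σ))) := by
            rw [Summable.tsum_add ((fs_sq a σ).mul_left x) ((fs_sq a' σ).mul_left y),
              tsum_mul_left, tsum_mul_left]
        _ < ε := by
            rcases hx.eq_or_lt with h | h
            · have : y = 1 := by linarith
              simpa [← h, this] using ha'
            · nlinarith
    · intro t ht
      rw [fSum_conv]
      have h1 := mul_le_mul_of_nonneg_left (hg t ht) hx
      have h2 := mul_le_mul_of_nonneg_left (hg' t ht) hy
      simp only [ContinuousMap.add_apply, ContinuousMap.smul_apply, smul_eq_mul]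
      linarith
  have hopen : IsOpen A := by
    rw [Metric.isOpen_iff]
    rintro g ⟨a, η, hη, ha, hg⟩
    refine ⟨η / 2, by positivity, fun g' hg' => ⟨a, η / 2, by positivity, ha, fun t ht => ?_⟩⟩
    have h1 := ContinuousMap.dist_lt_iff (by positivity) |>.1 hg' t
    rw [Real.dist_eq, abs_lt] at h1
    linarith [hg t ht]
  have h1 : (1 : C(AddCircle (2 * Real.pi), ℝ)) ∉ A := by
    rintro ⟨a, η, hη, ha, hg⟩
    have := hno a (fun t ht => by have := hg t ht; simp at this; linarith)
    linarith
  obtain ⟨f, hf⟩ := geometric_hahn_banach_open_point hconv hopen h1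
  have hz : ∀ g : C(AddCircle (2 * Real.pi), ℝ), (∀ t ∈ E, g t < 0) → g ∈ A := by
    intro g hg
    obtain ⟨t0, ht0, hmax⟩ := hE.exists_isMaxOn hne g.continuous.continuousOn
    refine ⟨0, - g t0, by linarith [hg t0 ht0], by simpa using hε, fun t ht => ?_⟩
    have : g t ≤ g t0 := hmax ht
    simp [fSum]; linarith
  have hf1 : 0 < f 1 := by
    have := hf (-1) (hz _ (fun t ht => by simp))
    rw [map_neg] at this; linarith
  have hle : ∀ h : C(AddCircle (2 * Real.pi), ℝ), (∀ t ∈ E, h t ≤ 0) → f h ≤ 0 := by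
    intro h hh
    by_contra! hc
    have h2 : ∀ N : ℕ, (N : ℝ) * f h - f 1 < f 1 := by
      intro N
      have := hf ((N : ℝ) • h - 1) (hz _ (fun t ht => by
        have := mul_nonneg (Nat.cast_nonneg (α := ℝ) N) (neg_nonneg.2 (hh t ht))
        simp; linarith))
      simpa using this
    obtain ⟨N, hN⟩ := exists_nat_gt (2 * f 1 / f h)
    rw [div_lt_iff₀ hc] at hN
    linarith [h2 N]
  have hpos : ∀ g, (∀ t, 0 ≤ g t) → 0 ≤ f g := by
    intro g hg
    have := hle (-g) (fun t _ => by simpa using hg t)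
    rw [map_neg] at this; linarith
  obtain ⟨μ, hμ, hRiesz⟩ := riesz_circle f hpos
  refine ⟨μ, hμ, ?_, ?_, 2 * f 1, ?_⟩
  · intro h0
    have := hRiesz 1
    rw [Measure.measure_univ_eq_zero.1 h0] at this
    simp at this; linarith
  · let d : C(AddCircle (2 * Real.pi), ℝ) := ⟨fun t => Metric.infDist t E, by fun_prop⟩
    have hd : f d = 0 := by
      refine le_antisymm (hle d fun t ht => ?_) (hpos d fun t => Metric.infDist_nonneg)
      simp [d, Metric.infDist_zero_of_mem ht]
    have h2 := hRiesz d
    rw [hd, integral_eq_zero_iff_of_nonneg (f := fun t => d t) (fun t => Metric.infDist_nonneg)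
      (d.continuous.integrable_of_hasCompactSupport (HasCompactSupport.of_compactSpace _))] at h2
    refine measure_mono_null (fun t ht => ?_) h2
    have := (hE.isClosed.notMem_iff_infDist_pos hne).1 ht
    exact this.ne'
  · intro a ha
    have hcont : Continuous fun t => (fSum a t).re :=
      Complex.continuous_re.comp (fSum_continuous (fs_norm a))
    have h2 := hRiesz ⟨_, hcont⟩
    simp only [ContinuousMap.coe_mk] at h2
    rw [h2]
    have := hf (⟨_, hcont⟩ - 1) ⟨a, 1, one_pos, ha, fun t ht => by simp⟩
    rw [map_sub] at this; linarith

theorem capacity_approx {σ : ℝ} {E : Set (AddCircle (2 * Real.pi))} (hE : IsCompact E)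
    (hcap : CapacityZero (1 - 2 * σ) E) {ε : ℝ} (hε : 0 < ε) :
    ∃ a : ℤ →₀ ℂ, (∀ t ∈ E, 1 ≤ (fSum a t).re) ∧
      ∑' n : ℤ, ‖a n‖ ^ 2 * (1 + |(n:ℝ)|) ^ (2 * σ) < ε := by
  rcases E.eq_empty_or_nonempty with he | hne
  · exact ⟨0, by simp [he], by simpa using hε⟩
  by_contra! hno
  obtain ⟨μ, hμ, hμ0, hμE, C, hC⟩ := capacity_dual hE hne hε hno
  set m : ℤ → ℂ := fun n => ∫ t, fourier n t ∂μ with hm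
  set w : ℤ → ℝ := fun n => (1 + |(n:ℝ)|) ^ (2 * σ) with hw
  have hwp : ∀ n, 0 < w n := fun n => by positivity
  have hC' : ∀ a : ℤ →₀ ℂ, ∑' n : ℤ, ‖a n‖ ^ 2 * w n < ε → (a.sum fun n z => z * m n).re ≤ C := by
    intro a ha
    refine le_trans (le_of_eq ?_) (hC a ha)
    have h1 : ∫ t, fSum a t ∂μ = a.sum fun n z => z * m n := by
      have : ∀ t, fSum a t = ∑ n ∈ a.support, a n * fourier n t := fun t =>
        tsum_eq_sum (fun n hn => by simp at hn; simp [hn])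
      simp_rw [this]
      rw [integral_finsetSum]
      · simp only [integral_const_mul, Finsupp.sum, hm]
      · intro n _
        exact (Continuous.integrable_of_hasCompactSupport (by fun_prop)
          (HasCompactSupport.of_compactSpace _))
    rw [← h1]
    exact (integral_re ((fSum_continuous (fs_norm a)).integrable_of_hasCompactSupport
          (HasCompactSupport.of_compactSpace _))).symm
  have hbd : ∀ S : Finset ℤ, ∑ n ∈ S, ‖m n‖ ^ 2 / w n ≤ 4 * C ^ 2 / ε := by
    intro S
    set X := ∑ n ∈ S, ‖m n‖ ^ 2 / w n with hX
    have hX0 : 0 ≤ X := Finset.sum_nonneg fun n _ => by have := hwp n; positivity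
    rcases hX0.eq_or_lt with h | h
    · rw [← h]; positivity
    set τ : ℝ := √ε / (2 * √X) with hτ
    have hsX := Real.sqrt_pos.2 h
    have hsε := Real.sqrt_pos.2 hε
    set a : ℤ →₀ ℂ := Finsupp.onFinset S
      (fun n => if n ∈ S then (τ / w n : ℝ) * (starRingEnd ℂ) (m n) else 0)
      (fun n hn => by by_contra h; simp [h] at hn) with ha
    have haS : ∀ n ∈ S, a n = (τ / w n : ℝ) * (starRingEnd ℂ) (m n) := fun n hn => by
      simp [ha, hn]
    have haN : ∀ n ∉ S, a n = 0 := fun n hn => by simp [ha, hn]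
    have h1 : ∑' n : ℤ, ‖a n‖ ^ 2 * w n = τ ^ 2 * X := by
      rw [tsum_eq_sum (s := S) (fun n hn => by simp [haN n hn]), hX, Finset.mul_sum]
      refine Finset.sum_congr rfl fun n hn => ?_
      rw [haS n hn, norm_mul, RCLike.norm_conj, Complex.norm_real, mul_pow, Real.norm_eq_abs, sq_abs]
      have := (hwp n).ne'
      field_simp
    have h2 : (a.sum fun n z => z * m n) = ((τ * X : ℝ) : ℂ) := by
      rw [Finsupp.sum_of_support_subset a (s := S) Finsupp.support_onFinset_subset _ (by simp), hX,
        Finset.mul_sum, Complex.ofReal_sum]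
      refine Finset.sum_congr rfl fun n hn => ?_
      rw [haS n hn, mul_assoc, mul_comm ((starRingEnd ℂ) (m n)), Complex.mul_conj, Complex.normSq_eq_norm_sq]
      push_cast; ring
    have h3 : τ ^ 2 * X = ε / 4 := by
      rw [hτ, div_pow, mul_pow, Real.sq_sqrt hε.le, Real.sq_sqrt h.le]; field_simp; norm_num
    have h4 := hC' a (by rw [h1, h3]; linarith)
    rw [h2, Complex.ofReal_re] at h4
    have h5 : τ * X = √ε * √X / 2 := by
      rw [hτ]; nth_rw 2 [← Real.mul_self_sqrt h.le]; field_simp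
    rw [h5] at h4
    have h6 : (√ε * √X / 2) ^ 2 ≤ C ^ 2 := by gcongr
    rw [div_pow, mul_pow, Real.sq_sqrt hε.le, Real.sq_sqrt h.le] at h6
    rw [le_div_iff₀ hε]; nlinarith
  have hsum : Summable fun n => ‖m n‖ ^ 2 / w n :=
    summable_of_sum_le (fun n => by have := hwp n; positivity) hbd
  refine hcap ((μ univ)⁻¹ • μ) ⟨?_⟩ ⟨E, subset_rfl, hE, ?_⟩ ?_
  · simp only [Measure.smul_apply, smul_eq_mul]
    exact ENNReal.inv_mul_cancel hμ0 (measure_ne_top μ _)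
  · simp [hμE]
  · unfold HasFiniteEnergy
    have hinj : Function.Injective fun n : ℕ => -((n : ℤ) + 1) := fun a b h => by simpa using h
    have h := (hsum.comp_injective hinj).mul_left (((μ univ)⁻¹).toReal ^ 2)
    refine h.congr fun n => ?_
    simp only [muHat, integral_smul_measure, Function.comp, hm, hw, norm_smul, mul_pow,
      Real.norm_eq_abs, sq_abs]
    have : |((-((n:ℤ) + 1) : ℤ) : ℝ)| = (n:ℝ) + 1 := by
      push_cast; rw [abs_neg, abs_of_nonneg (by positivity)]
    rw [this, mul_div_assoc]
    congr 3; ring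

theorem smooth_decay (j : ℕ) : ∀ g : ℝ → ℂ, ContDiff ℝ (⊤ : ℕ∞) g →
    Function.Periodic g (2 * Real.pi) → ∃ C : ℝ, 0 ≤ C ∧ ∀ n : ℤ, n ≠ 0 →
      |(n:ℝ)| ^ j * ‖fourierCoeffOn (show (0:ℝ) < 2 * Real.pi by positivity) g n‖ ≤ C := by
  induction j with
  | zero =>
    intro g hg hper
    obtain ⟨M, hM⟩ := (isCompact_Icc (a := (0:ℝ)) (b := 2 * Real.pi)).exists_bound_of_continuousOn
      hg.continuous.continuousOn
    have hM0 : 0 ≤ M := (norm_nonneg _).trans (hM 0 ⟨le_rfl, by positivity⟩)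
    refine ⟨M, hM0, fun n _ => ?_⟩
    rw [pow_zero, one_mul, fourierCoeffOn_eq_integral, norm_smul]
    have h : ‖∫ x in (0:ℝ)..2 * Real.pi, fourier (-n) (x : AddCircle (2 * Real.pi - 0)) • g x‖
        ≤ M * |2 * Real.pi - 0| := by
      refine intervalIntegral.norm_integral_le_of_norm_le_const fun x hx => ?_
      rw [uIoc_of_le (by positivity)] at hx
      rw [norm_smul]
      have : ‖fourier (-n) (x : AddCircle (2 * Real.pi - 0))‖ = 1 := by
        rw [fourier_apply]; exact Circle.norm_coe _
      rw [this, one_mul]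
      exact hM x ⟨hx.1.le, hx.2⟩
    have hp : 0 < 2 * Real.pi := by positivity
    rw [sub_zero, abs_of_pos hp] at h
    rw [sub_zero, Real.norm_of_nonneg (by positivity)]
    calc _ ≤ 1 / (2 * Real.pi) * (M * (2 * Real.pi)) := by gcongr
      _ = M := by field_simp
  | succ j ih =>
    intro g hg hper
    have hd : ContDiff ℝ (⊤ : ℕ∞) (deriv g) := (contDiff_infty_iff_deriv.1 hg).2
    have hdiff : Differentiable ℝ g := (contDiff_infty_iff_deriv.1 hg).1
    have hper' : Function.Periodic (deriv g) (2 * Real.pi) := by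
      intro x
      rw [← deriv_comp_add_const]
      congr 1; ext y; exact hper y
    obtain ⟨C, hC0, hC⟩ := ih (deriv g) hd hper'
    refine ⟨C, hC0, fun n hn => ?_⟩
    have e := fourierCoeffOn_of_hasDerivAt (show (0:ℝ) < 2 * Real.pi by positivity) (f := g)
      (f' := deriv g) hn (fun x _ => (hdiff x).hasDerivAt)
      (hd.continuous.intervalIntegrable _ _)
    have h0 : g (2 * Real.pi) - g 0 = 0 := by
      have := hper 0; rw [zero_add] at this; rw [this, sub_self]
    rw [h0, mul_zero, zero_sub] at e
    rw [e, norm_mul, norm_neg, norm_mul]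
    have hn' : 0 < |(n:ℝ)| := by positivity
    have e2 : ‖(1 / (-2 * (Real.pi:ℂ) * Complex.I * n))‖ = 1 / (2 * Real.pi * |(n:ℝ)|) := by
      simp [abs_of_pos Real.pi_pos]
    have e3 : ‖(((2 * Real.pi : ℝ) : ℂ) - ((0:ℝ) : ℂ))‖ = 2 * Real.pi := by
      rw [← Complex.ofReal_sub, Complex.norm_real, sub_zero, Real.norm_of_nonneg (by positivity)]
    rw [e2, e3]
    refine le_trans (le_of_eq ?_) (hC n hn)
    have := Real.pi_pos
    field_simp
    ring

theorem rapid_smooth (F : C(AddCircle (2 * Real.pi), ℂ))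
    (hF : ContDiff ℝ (⊤ : ℕ∞) fun x : ℝ => F (x : AddCircle (2 * Real.pi))) :
    Rapid (fourierCoeff F) ∧ ∀ t, fSum (fourierCoeff F) t = F t := by
  have hR : Rapid (fourierCoeff F) := by
    intro m
    obtain ⟨C, hC0, hC⟩ := smooth_decay (m + 2) _ hF (fun x => by
      simp only [AddCircle.coe_add_period])
    have e : ∀ n, fourierCoeffOn (show (0:ℝ) < 2 * Real.pi by positivity)
        (fun x : ℝ => F (x : AddCircle (2 * Real.pi))) n = fourierCoeff F n := by
      intro n
      rw [fourierCoeffOn_eq_integral, fourierCoeff_eq_intervalIntegral _ _ 0]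
      simp only [fourier_coe_apply, sub_zero, zero_add]
    simp only [e] at hC
    have hs := (summable_wt (r := 2) (by norm_num)).mul_left (‖fourierCoeff F 0‖ + 2 ^ (m+2) * C)
    refine Summable.of_nonneg_of_le (fun n => by positivity) (fun n => ?_) hs
    rw [Real.rpow_neg (by positivity), ← div_eq_mul_inv, le_div_iff₀ (by positivity)]
    rcases eq_or_ne n 0 with h | h
    · subst h; simp; positivity
    · have h1 : (1:ℝ) ≤ |(n:ℝ)| := by exact_mod_cast Int.one_le_abs h
      have h2 : (1 + |(n:ℝ)|) ^ (m+2) ≤ 2 ^ (m+2) * |(n:ℝ)| ^ (m+2) := by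
        rw [← mul_pow]; gcongr; linarith
      have h3 : (1 + |(n:ℝ)|) ^ (2:ℝ) = (1 + |(n:ℝ)|) ^ 2 := by norm_cast
      rw [h3, mul_assoc, ← pow_add]
      calc _ ≤ ‖fourierCoeff F n‖ * (2 ^ (m+2) * |(n:ℝ)| ^ (m+2)) := by gcongr
        _ = 2 ^ (m+2) * (|(n:ℝ)| ^ (m+2) * ‖fourierCoeff F n‖) := by ring
        _ ≤ 2 ^ (m+2) * C := by gcongr; exact hC n h
        _ ≤ _ := by linarith [norm_nonneg (fourierCoeff F 0)]
  refine ⟨hR, fun t => ?_⟩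
  have hs : Summable (fourierCoeff F) := Summable.of_norm (by simpa using hR 0)
  exact (has_pointwise_sum_fourier_series_of_summable hs t).tsum_eq

theorem shift_sum {g : ℤ → ℝ} (hg : Summable g) (m : ℤ) :
    Summable (fun n => g (n - m)) ∧ ∑' n, g (n - m) = ∑' n, g n :=
  ⟨(Equiv.subRight m).summable_iff.2 hg, (Equiv.subRight m).tsum_eq g⟩

set_option maxHeartbeats 1000000 in
theorem final_van {σ : ℝ} (h0 : 0 < σ) (h1 : σ < 1) {T : ℤ → ℂ}
    (hT : Summable fun n : ℤ => ‖T n‖ ^ 2 / (1 + |(n:ℝ)|) ^ (2 * σ))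
    {E : Set (AddCircle (2 * Real.pi))} (hE : IsCompact E) (hcap : CapacityZero (1 - 2 * σ) E)
    (hvan : ∀ a : ℤ → ℂ, Rapid a → ∀ U : Set (AddCircle (2 * Real.pi)), IsOpen U →
      E ⊆ U → (∀ t ∈ U, fSum a t = 0) → ∑' n, T n * a n = 0) (m : ℤ) : T m = 0 := by
  let b : ContDiffBump (0:ℝ) := ⟨1, 2, one_pos, one_lt_two⟩
  obtain ⟨K, hK⟩ := ContDiff.lipschitzWith_of_hasCompactSupport (𝕂 := ℝ) b.hasCompactSupport
    (b.contDiff (n := 1)) (by simp)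
  set L : ℝ := 4 * K with hL
  have hL0 : 0 ≤ L := by positivity
  set X := ∑' n : ℤ, ‖T n‖ ^ 2 / (1 + |(n:ℝ)|) ^ (2 * σ) with hX
  set D : ℝ := (1 + |(m:ℝ)|) ^ (2 * σ) * (8 * L ^ 2) with hD
  have key : ∀ η : ℝ, 0 < η → ‖T m‖ ≤ η * ((X + D) / 2) := by
    intro η hη
    obtain ⟨a, ha1, ha2⟩ := capacity_approx hE hcap (ε := η ^ 2) (by positivity)
    have hca := fSum_continuous (fs_norm a)
    set G : C(AddCircle (2 * Real.pi), ℂ) := ⟨fSum a, hca⟩ with hG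
    have hbc : Continuous b := b.continuous
    set F : C(AddCircle (2 * Real.pi), ℂ) := ⟨fun t => ((1 - b (4 * (fSum a t).re) : ℝ) : ℂ), by
      fun_prop⟩ with hF
    have hb : ∀ u v : ℝ, |b u - b v| ≤ K * |u - v| := fun u v => by
      simpa [Real.dist_eq] using hK.dist_le_mul u v
    have hb0 : b 0 = 1 := b.one_of_mem_closedBall (by simp [b])
    have hFG : ∀ x y, ‖F x - F y‖ ≤ L * ‖G x - G y‖ := by
      intro x y
      simp only [hF, hG, ContinuousMap.coe_mk]
      rw [← Complex.ofReal_sub, Complex.norm_real, Real.norm_eq_abs]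
      have e1 : (1 - b (4 * (fSum a x).re) - (1 - b (4 * (fSum a y).re))) =
        b (4 * (fSum a y).re) - b (4 * (fSum a x).re) := by ring
      have e2 : |4 * (fSum a y).re - 4 * (fSum a x).re| = 4 * |(fSum a x - fSum a y).re| := by
        rw [← mul_sub, abs_mul, Complex.sub_re, abs_sub_comm]; norm_num
      rw [e1]
      refine (hb _ _).trans ?_
      rw [e2]
      calc _ = L * |(fSum a x - fSum a y).re| := by rw [hL]; ring
        _ ≤ _ := by gcongr; exact Complex.abs_re_le_norm _
    have hFG' : ∀ x, ‖F x‖ ≤ L * ‖G x‖ := by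
      intro x
      simp only [hF, hG, ContinuousMap.coe_mk]
      rw [Complex.norm_real, Real.norm_eq_abs, ← hb0]
      refine (hb _ _).trans ?_
      rw [zero_sub, abs_neg, abs_mul]
      calc _ = L * |(fSum a x).re| := by rw [hL]; norm_num; ring
        _ ≤ _ := by gcongr; exact Complex.abs_re_le_norm _
    have hsob := sobSq_contract h0 h1 F G L hL0 hFG hFG'
    have hGa : sobSq σ (fourierCoeff G) ≤ ENNReal.ofReal (η ^ 2) := by
      have : fourierCoeff G = a := by ext n; exact fourierCoeff_fSum (fs_norm a) n
      rw [this, sobSq]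
      simp_rw [← ENNReal.ofReal_mul (sq_nonneg _)]
      rw [← ENNReal.ofReal_tsum_of_nonneg (fun n => by positivity) (fs_sq a σ)]
      exact ENNReal.ofReal_le_ofReal ha2.le
    have hsob2 : sobSq σ (fourierCoeff F) ≤ ENNReal.ofReal (8 * L ^ 2 * η ^ 2) := by
      rw [ENNReal.ofReal_mul (by positivity)]
      exact hsob.trans (by gcongr)
    obtain ⟨hs1, hs2⟩ := sobSq_real (by positivity) hsob2
    -- the modulated function
    set H : C(AddCircle (2 * Real.pi), ℂ) := ⟨fun t => fourier m t * F t, by fun_prop⟩ with hH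
    have hHs : ContDiff ℝ (⊤ : ℕ∞) fun x : ℝ => H (x : AddCircle (2 * Real.pi)) := by
      have hfs : ∀ n : ℤ, ContDiff ℝ (⊤ : ℕ∞) fun x : ℝ => fourier n (x : AddCircle (2 * Real.pi)) := by
        intro n
        simp only [aux_fourier_coe]
        have hof : ContDiff ℝ (⊤ : ℕ∞) fun x : ℝ => ((n * x : ℝ) : ℂ) :=
          Complex.ofRealCLM.contDiff.comp (contDiff_const.mul contDiff_id)
        exact (hof.mul contDiff_const).cexp
      have hsum : ContDiff ℝ (⊤ : ℕ∞) fun x : ℝ => fSum a (x : AddCircle (2 * Real.pi)) := by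
        have : ∀ t, fSum a t = ∑ n ∈ a.support, a n * fourier n t := fun t =>
          tsum_eq_sum (fun n hn => by simp at hn; simp [hn])
        simp_rw [this]
        exact ContDiff.sum fun n _ => contDiff_const.mul (hfs n)
      have hre : ContDiff ℝ (⊤ : ℕ∞) fun x : ℝ => (fSum a (x : AddCircle (2 * Real.pi))).re :=
        Complex.reCLM.contDiff.comp hsum
      simp only [hH, hF, ContinuousMap.coe_mk]
      refine (hfs m).mul (Complex.ofRealCLM.contDiff.comp ?_)
      exact contDiff_const.sub (b.contDiff.comp (contDiff_const.mul hre))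
    obtain ⟨hR, hHt⟩ := rapid_smooth H hHs
    have hHc : ∀ n, fourierCoeff H n = fourierCoeff F (n - m) := by
      intro n
      have := fourierCoeff_mul_trig {m} (fun _ => 1) F n
      simp only [Finset.sum_singleton, one_mul] at this
      exact this
    set A : ℤ → ℂ := fun n => (if n = m then 1 else 0) - fourierCoeff H n with hA
    have hRA : Rapid A := by
      intro j
      have hδ : Summable fun n : ℤ => (if n = m then (1 + |(n:ℝ)|) ^ j else 0) :=
        summable_of_ne_finset_zero (s := {m}) (fun n hn => by simp at hn; simp [hn])
      refine Summable.of_nonneg_of_le (fun n => by positivity) (fun n => ?_) (hδ.add (hR j))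
      have : ‖A n‖ ≤ (if n = m then 1 else 0) + ‖fourierCoeff H n‖ := by
        refine (norm_sub_le _ _).trans ?_
        gcongr
        split_ifs <;> simp
      calc _ ≤ ((if n = m then 1 else 0) + ‖fourierCoeff H n‖) * (1 + |(n:ℝ)|) ^ j := by gcongr
        _ = _ := by split_ifs <;> ring
    have hAt : ∀ t, fSum A t = fourier m t * (1 - F t) := by
      intro t
      have hn1 : Summable fun n => ‖fourierCoeff H n‖ := by simpa using hR 0
      have e1 : fSum A t = ∑' n : ℤ, ((if n = m then 1 else 0) * fourier n t) -
          fSum (fourierCoeff H) t := by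
        rw [fSum, fSum, ← Summable.tsum_sub
          (summable_of_ne_finset_zero (s := {m}) (fun n hn => by simp at hn; simp [hn]))
          (fSum_summable hn1 t)]
        congr 1; ext n; simp only [hA]; ring
      rw [e1, hHt, tsum_eq_single m (fun n hn => by simp [hn])]
      simp only [if_true, hH, ContinuousMap.coe_mk]; ring
    have hz := hvan A hRA {t | 1 / 2 < (fSum a t).re}
      (isOpen_lt continuous_const (Complex.continuous_re.comp hca))
      (fun t ht => by
        have := ha1 t ht
        simp only [mem_ofPred_eq]; linarith)
      (fun t ht => by
        rw [hAt]
        have : b (4 * (fSum a t).re) = 0 := by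
          refine b.zero_of_le_dist ?_
          simp only [mem_ofPred_eq] at ht
          rw [Real.dist_eq, sub_zero]
          refine le_trans ?_ (le_abs_self _)
          show (2:ℝ) ≤ _
          linarith
        simp [hF, this])
    -- estimates
    have hsh := shift_sum hs1 m
    have hsh1 := hsh.1
    have hsh2 := hsh.2.trans_le hs2
    set W := (1 + |(m:ℝ)|) ^ (2 * σ) with hW
    have hterm : ∀ n, ‖T n * fourierCoeff H n‖ ≤ (η / 2) * (‖T n‖ ^ 2 / (1 + |(n:ℝ)|) ^ (2 * σ)) +
        (W / (2 * η)) * (‖fourierCoeff F (n - m)‖ ^ 2 * (1 + |((n - m : ℤ):ℝ)|) ^ (2 * σ)) := by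
      intro n
      rw [hHc, norm_mul]
      have hw := wt_submul (β := 2 * σ) (by linarith) (n - m) m
      rw [sub_add_cancel, ← hW] at hw
      set w := (1 + |(n:ℝ)|) ^ (2 * σ) with hwdef
      have hwp : 0 < w := by positivity
      set v := (1 + |((n - m : ℤ):ℝ)|) ^ (2 * σ)
      set x := ‖T n‖
      set y := ‖fourierCoeff F (n - m)‖
      have hq : x * y ≤ (η / 2) * (x ^ 2 / w) + (1 / (2 * η)) * (y ^ 2 * w) := by
        have : (η / 2) * (x ^ 2 / w) + (1 / (2 * η)) * (y ^ 2 * w) - x * y =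
          (η * x - y * w) ^ 2 / (2 * η * w) := by field_simp; ring
        have h2 : 0 ≤ (η * x - y * w) ^ 2 / (2 * η * w) := by positivity
        linarith
      refine hq.trans ?_
      refine add_le_add le_rfl ?_
      calc _ ≤ (1 / (2 * η)) * (y ^ 2 * (v * W)) := by gcongr
        _ = _ := by ring
    have hsR := (hT.mul_left (η / 2)).add (hsh1.mul_left (W / (2 * η)))
    have hTH : Summable fun n => ‖T n * fourierCoeff H n‖ :=
      Summable.of_nonneg_of_le (fun n => norm_nonneg _) hterm hsR
    have hTm : T m = ∑' n, T n * fourierCoeff H n := by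
      have e1 : ∑' n, T n * A n = ∑' n : ℤ, (T n * (if n = m then 1 else 0)) -
          ∑' n, T n * fourierCoeff H n := by
        rw [← Summable.tsum_sub
          (summable_of_ne_finset_zero (s := {m}) (fun n hn => by simp at hn; simp [hn])) hTH.of_norm]
        congr 1; ext n; simp only [hA]; ring
      rw [hz, tsum_eq_single m (fun n hn => by simp [hn])] at e1
      simp only [if_true, mul_one] at e1
      exact (sub_eq_zero.1 e1.symm)
    rw [hTm]
    refine (norm_tsum_le_tsum_norm hTH).trans ((hTH.tsum_le_tsum hterm hsR).trans ?_)
    rw [Summable.tsum_add (hT.mul_left (η / 2)) (hsh1.mul_left (W / (2 * η))), tsum_mul_left,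
      tsum_mul_left, ← hX]
    calc _ ≤ η / 2 * X + W / (2 * η) * (8 * L ^ 2 * η ^ 2) := by gcongr
      _ = _ := by rw [hD]; field_simp
  have hlim : Tendsto (fun η : ℝ => η * ((X + D) / 2)) (𝓝[>] 0) (𝓝 0) := by
    have : Tendsto (fun η : ℝ => η * ((X + D) / 2)) (𝓝 0) (𝓝 (0 * ((X + D) / 2))) :=
      tendsto_id.mul_const _
    rw [zero_mul] at this
    exact this.mono_left nhdsWithin_le_nhds
  have := ge_of_tendsto hlim (eventually_nhdsWithin_of_forall fun η hη => key η hη)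
  exact norm_le_zero_iff.1 this

theorem hb_sep {V : Type*} [NormedAddCommGroup V] [NormedSpace ℂ V] (M : Submodule ℂ V) (x : V)
    (hx : x ∉ closure (M : Set V)) :
    ∃ f : StrongDual ℂ V, (∀ y ∈ M, f y = 0) ∧ f x ≠ 0 ∧ ‖f‖ ≤ 1 := by
  letI : NormedSpace ℝ V := NormedSpace.restrictScalars ℝ ℂ V
  have hconv : Convex ℝ (closure (M : Set V)) :=
    ((M.restrictScalars ℝ).convex (𝕜 := ℝ)).closure
  obtain ⟨f, u, hf, hfx⟩ := RCLike.geometric_hahn_banach_closed_point (𝕜 := ℂ) hconv isClosed_closure hx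
  have hu : 0 < u := by
    have := hf 0 (subset_closure M.zero_mem)
    simpa using this
  have hM : ∀ y ∈ M, f y = 0 := by
    intro y hy
    by_contra hne
    have := hf (((u : ℂ) / f y) • y) (subset_closure (M.smul_mem _ hy))
    rw [map_smul, smul_eq_mul, div_mul_cancel₀ _ hne] at this
    simp at this
  have hfx0 : f x ≠ 0 := by
    intro h; rw [h] at hfx; simp at hfx; linarith
  have hf0 : f ≠ 0 := by rintro rfl; simp at hfx0
  refine ⟨((‖f‖⁻¹ : ℝ) : ℂ) • f, fun y hy => by simp [hM y hy], ?_, ?_⟩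
  · simp [hfx0, hf0]
  · rw [norm_smul, Complex.norm_real, norm_inv, norm_norm, inv_mul_cancel₀ (norm_ne_zero_iff.2 hf0)]

theorem kFold_compact (k : ℕ) {Z : Set (AddCircle (2 * Real.pi))} (hZ : IsCompact Z) :
    IsCompact (kFold k Z) := by
  have h1 : IsCompact (Set.pi univ (fun _ : Fin k => Z)) := isCompact_univ_pi fun _ => hZ
  have h2 := h1.image (f := fun g : Fin k → AddCircle (2 * Real.pi) => ∑ i, g i) (by fun_prop)
  convert h2 using 1
  ext x
  constructor
  · rintro ⟨g, hg, rfl⟩; exact ⟨g, fun i _ => hg i, rfl⟩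
  · rintro ⟨g, hg, rfl⟩; exact ⟨g, fun i => hg i trivial, rfl⟩

theorem dual_pow_summable {p : ℝ} (hp : 1 < p) [Fact (1 ≤ ENNReal.ofReal p)] {k : ℕ} (hk : 0 < k)
    (hkp : p ≤ 2 * k * (p - 1))
    (f : StrongDual ℂ (lp (fun _ : ℤ => ℂ) (ENNReal.ofReal p))) (hf : ‖f‖ ≤ 1) :
    Summable fun n : ℤ => ‖f (lp.single (ENNReal.ofReal p) n (1:ℂ))‖ ^ (2 * k) := by
  have hP : (ENNReal.ofReal p).toReal = p := ENNReal.toReal_ofReal (by linarith)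
  have hP0 : 0 < (ENNReal.ofReal p).toReal := by rw [hP]; linarith
  have hP1 : 0 < ENNReal.ofReal p := ENNReal.ofReal_pos.2 (by linarith)
  set u : ℤ → ℂ := fun n => f (lp.single (ENNReal.ofReal p) n (1:ℂ)) with hu
  have hu1 : ∀ n, ‖u n‖ ≤ 1 := by
    intro n
    have := f.le_of_opNorm_le hf (lp.single (ENNReal.ofReal p) n (1:ℂ))
    rw [lp.norm_single hP1] at this
    simpa using this
  refine summable_of_sum_le (c := 1) (fun n => by positivity) fun S => ?_
  set X := ∑ n ∈ S, ‖u n‖ ^ (2 * k) with hX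
  set z : ℤ → ℂ := fun n => ((‖u n‖ ^ (2 * k - 2) : ℝ) : ℂ) * (starRingEnd ℂ) (u n) with hz
  set x := ∑ n ∈ S, lp.single (ENNReal.ofReal p) n (z n) with hx
  have hfx : f x = (X : ℂ) := by
    rw [hx, map_sum, hX, Complex.ofReal_sum]
    refine Finset.sum_congr rfl fun n _ => ?_
    have : lp.single (E := fun _ : ℤ => ℂ) (ENNReal.ofReal p) n (z n) =
        z n • lp.single (E := fun _ : ℤ => ℂ) (ENNReal.ofReal p) n (1:ℂ) := by
      rw [← lp.single_smul, smul_eq_mul, mul_one]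
    rw [this, map_smul, smul_eq_mul]
    show z n * u n = _
    rw [hz]
    simp only
    rw [mul_assoc, mul_comm ((starRingEnd ℂ) (u n)), Complex.mul_conj, Complex.normSq_eq_norm_sq,
      ← Complex.ofReal_mul, ← pow_add, Nat.sub_add_cancel (by omega)]
  have hnx : ‖x‖ ^ p ≤ X := by
    have := lp.norm_sum_single (E := fun _ : ℤ => ℂ) hP0 z S
    rw [hP] at this
    rw [hx, this, hX]
    refine Finset.sum_le_sum fun n _ => ?_
    have e : ‖z n‖ = ‖u n‖ ^ ((2 * k - 1 : ℕ) : ℝ) := by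
      rw [hz]
      simp only [norm_mul, RCLike.norm_conj, Complex.norm_real, norm_pow, norm_norm]
      rw [← pow_succ, Real.rpow_natCast]
      congr 1; omega
    rw [e, ← Real.rpow_mul (norm_nonneg _), ← Real.rpow_natCast]
    refine Real.rpow_le_rpow_of_exponent_ge' (norm_nonneg _) (hu1 n) (by positivity) ?_
    rw [Nat.cast_sub (by omega)]
    push_cast
    linarith
  have hXx : X ≤ ‖x‖ := by
    have := f.le_of_opNorm_le hf x
    rw [hfx, Complex.norm_real, one_mul] at this
    exact (le_abs_self X).trans this
  by_contra! hgt
  have h1 : X ^ p ≤ X := (Real.rpow_le_rpow (by linarith) hXx (by linarith)).trans hnx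
  have h2 : X ^ (1:ℝ) < X ^ p := Real.rpow_lt_rpow_of_exponent_lt hgt hp
  rw [Real.rpow_one] at h2
  linarith

theorem mem_shift {p β : ℝ} (hp : 1 < p) (hβ : 0 ≤ β) {c : ℤ → ℂ}
    (hc : Summable fun n : ℤ => ‖c n‖ * (1 + |(n:ℝ)|) ^ β) (m : ℤ) :
    Memℓp (fun n : ℤ => (((1 + |(n:ℝ)|) ^ β : ℝ) : ℂ) * c (n - m)) (ENNReal.ofReal p) := by
  have h1 : Memℓp (fun n : ℤ => (((1 + |(n:ℝ)|) ^ β : ℝ) : ℂ) * c (n - m)) 1 := by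
    refine memℓp_gen ?_
    simp only [ENNReal.toReal_one, Real.rpow_one]
    refine Summable.of_nonneg_of_le (fun n => norm_nonneg _) (fun n => ?_)
      ((shift_sum hc m).1.mul_left ((1 + |(m:ℝ)|) ^ β))
    rw [norm_mul, Complex.norm_real, Real.norm_of_nonneg (by positivity)]
    have hw := wt_submul hβ (n - m) m
    rw [sub_add_cancel] at hw
    calc _ ≤ ((1 + |((n - m : ℤ):ℝ)|) ^ β * (1 + |(m:ℝ)|) ^ β) * ‖c (n - m)‖ := by gcongr
      _ = _ := by ring
  exact h1.of_exponent_ge (by simpa using hp.le)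

theorem main_thm (p q β : ℝ) (hp1 : 1 < p) (hp2 : p < 2) (hβ : 0 < β)
    (hq : q = p / (p - 1))
    (c : ℤ → ℂ) (hc : MemA 1 β c)
    (k : ℕ) (hk : 0 < k) (hk1 : q / 2 ≤ (k : ℝ)) (hk2 : (k : ℝ) ≤ 1 / (2 * β))
    (hcap : CapacityZero (1 - 2 * (k : ℝ) * β) (kFold k (zeroSet c))) :
    IsCyclicA p β c := by
  have hc' : Summable fun n : ℤ => ‖c n‖ * (1 + |(n:ℝ)|) ^ β := by
    simpa [MemA] using hc
  have hpm : 0 < p - 1 := by linarith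
  have hkp : p ≤ 2 * k * (p - 1) := by
    rw [hq, div_div, div_le_iff₀ (by positivity)] at hk1; linarith
  have hk2' : 2 ≤ k := by
    by_contra! h
    have : (k:ℝ) ≤ 1 := by exact_mod_cast Nat.lt_succ_iff.1 h
    nlinarith
  have hk2r : (2:ℝ) ≤ k := by exact_mod_cast hk2'
  have hkβ : (k:ℝ) * β ≤ 1 / 2 := by
    rw [le_div_iff₀ (by positivity)] at hk2; linarith
  have hβ4 : β ≤ 1 / 4 := by nlinarith
  haveI : Fact (1 ≤ ENNReal.ofReal p) := ⟨by simpa using hp1.le⟩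
  have hP : (ENNReal.ofReal p).toReal = p := ENNReal.toReal_ofReal (by linarith)
  have hP0 : 0 < (ENNReal.ofReal p).toReal := by rw [hP]; linarith
  have hP1 : 0 < ENNReal.ofReal p := ENNReal.ofReal_pos.2 (by linarith)
  set V := lp (fun _ : ℤ => ℂ) (ENNReal.ofReal p) with hV
  set v : ℤ → V := fun m => ⟨_, mem_shift hp1 hβ.le hc' m⟩ with hv
  have hva : ∀ m n, (v m) n = (((1 + |(n:ℝ)|) ^ β : ℝ) : ℂ) * c (n - m) := fun m n => rfl
  set e0 : V := lp.single (ENNReal.ofReal p) 0 (1:ℂ) with he0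
  by_cases hcl : e0 ∈ closure ((Submodule.span ℂ (range v) : Submodule ℂ V) : Set V)
  · intro ε hε
    obtain ⟨x, hx, hdist⟩ := Metric.mem_closure_iff.1 hcl ε hε
    obtain ⟨a, rfl⟩ := Finsupp.mem_span_range_iff_exists_finsupp.1 hx
    refine ⟨a, a.finite_support, ?_⟩
    rw [dist_eq_norm, lp.norm_eq_tsum_rpow hP0, hP] at hdist
    refine lt_of_eq_of_lt ?_ hdist
    unfold normA wSum
    congr 2
    ext n
    have e1 : (e0 - a.sum fun i z => z • v i) n =
        (((1 + |(n:ℝ)|) ^ β : ℝ) : ℂ) * ((if n = 0 then 1 else 0) - convSeq a c n) := by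
      have e2 : (a.sum fun i z => z • v i) n = (((1 + |(n:ℝ)|) ^ β : ℝ) : ℂ) * convSeq a c n := by
        rw [Finsupp.sum, lp.coeFn_sum, Finset.sum_apply, convSeq,
          tsum_eq_sum (s := a.support) (fun b hb => by simp at hb; simp [hb]), Finset.mul_sum]
        refine Finset.sum_congr rfl fun i _ => ?_
        rw [lp.coeFn_smul, Pi.smul_apply, hva, smul_eq_mul]; ring
      have e3 : e0 n = (((1 + |(n:ℝ)|) ^ β : ℝ) : ℂ) * (if n = 0 then 1 else 0) := by
        rw [he0, lp.single_apply]
        by_cases h : n = 0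
        · subst h; simp
        · simp [h]
      rw [lp.coeFn_sub, Pi.sub_apply, e2, e3]; ring
    rw [e1, norm_mul, Complex.norm_real, Real.norm_of_nonneg (by positivity),
      Real.mul_rpow (by positivity) (norm_nonneg _), ← Real.rpow_mul (by positivity), mul_comm β p,
      mul_comm]
  · exfalso
    obtain ⟨f, hfM, hfe, hf1⟩ := hb_sep _ _ hcl
    have hsum := dual_pow_summable hp1 hk hkp f hf1
    set u : ℤ → ℂ := fun n => f (lp.single (ENNReal.ofReal p) n (1:ℂ)) with hu
    set s : ℤ → ℂ := fun n => (((1 + |(n:ℝ)|) ^ β : ℝ) : ℂ) * u n with hs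
    have hu1 : ∀ n, ‖u n‖ ≤ 1 := by
      intro n
      have := f.le_of_opNorm_le hf1 (lp.single (ENNReal.ofReal p) n (1:ℂ))
      rw [lp.norm_single hP1] at this
      simpa using this
    have hsn : ∀ n, ‖s n‖ = (1 + |(n:ℝ)|) ^ β * ‖u n‖ := fun n => by
      rw [hs]; simp only [norm_mul, Complex.norm_real]; rw [Real.norm_of_nonneg (by positivity)]
    have hsb : ∀ n, ‖s n‖ ≤ 1 * (1 + |(n:ℝ)|) ^ β := by
      intro n
      rw [hsn, one_mul]
      exact mul_le_of_le_one_right (by positivity) (hu1 n)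
    have hann : ∀ m, ∑' j, c j * s (j + m) = 0 := by
      intro m
      have h1 := (lp.hasSum_single ENNReal.ofReal_ne_top (v m)).mapL f
      have h2 : f (v m) = 0 := hfM _ (Submodule.subset_span ⟨m, rfl⟩)
      rw [h2] at h1
      have h3 : ∀ n, f (lp.single (ENNReal.ofReal p) n (v m n)) = c (n - m) * s n := by
        intro n
        have : lp.single (E := fun _ : ℤ => ℂ) (ENNReal.ofReal p) n (v m n) =
            (v m n) • lp.single (E := fun _ : ℤ => ℂ) (ENNReal.ofReal p) n (1:ℂ) := by
          rw [← lp.single_smul, smul_eq_mul, mul_one]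
        rw [this, map_smul, hva, smul_eq_mul]
        simp only [hs, hu]; ring
      have h4 := h1.tsum_eq
      simp only [h3] at h4
      rw [← h4, ← (Equiv.addRight m).tsum_eq (fun n => c (n - m) * s n)]
      simp
    have hc1 := summable_norm_of_wt hβ.le hc'
    have hZc : IsCompact (zeroSet c) :=
      (isClosed_singleton.preimage (fSum_continuous hc1) : IsClosed (fSum c ⁻¹' {0})).isCompact
    have hT : Summable fun n : ℤ => ‖s n ^ k‖ ^ 2 / (1 + |(n:ℝ)|) ^ (2 * (k * β)) := by
      refine hsum.congr fun n => ?_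
      rw [norm_pow, hsn, ← pow_mul, mul_comm k 2, mul_pow, ← Real.rpow_natCast (_ ^ β),
        ← Real.rpow_mul (by positivity)]
      have : β * ((2 * k : ℕ) : ℝ) = 2 * (k * β) := by push_cast; ring
      rw [this]
      have hw : 0 < (1 + |(n:ℝ)|) ^ (2 * (k * β)) := by positivity
      field_simp
      rfl
    have := final_van (σ := k * β) (by positivity) (by linarith) hT (kFold_compact k hZc)
      (by rw [← mul_assoc]; exact hcap)
      (kfold_van hβ.le hβ4 hsb hc' hann k) 0
    have h0 : s 0 = 0 := by
      exact pow_eq_zero_iff (by omega) |>.1 this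
    have : u 0 = 0 := by simpa [hs] using h0
    exact hfe this

/-- Theorem 3.2(b): let `1 < p < 2`, `β > 0`, `βq ≤ 1` where
`q = p/(p-1)`, `f ∈ A^1_β(𝕋)`, and let `k` be a positive integer with
`q/2 ≤ k ≤ 1/(2β)`. If `C_α(k × Z(f)) = 0` where `α = 1 - 2kβ`, then `f` is
cyclic in `A^p_β(𝕋)`. -/
theorem stmt7 (p q β : ℝ) (hp1 : 1 < p) (hp2 : p < 2) (hβ : 0 < β)
    (hq : q = p / (p - 1)) (hβq : β * q ≤ 1)
    (c : ℤ → ℂ) (hc : MemA 1 β c)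
    (k : ℕ) (hk : 0 < k) (hk1 : q / 2 ≤ (k : ℝ)) (hk2 : (k : ℝ) ≤ 1 / (2 * β))
    (hcap : CapacityZero (1 - 2 * (k : ℝ) * β) (kFold k (zeroSet c))) :
    IsCyclicA p β c := by
  exact main_thm p q β hp1 hp2 hβ hq c hc k hk hk1 hk2 hcap

end
end

section
/- Let 1 < p < ∞, β ≥ 0, q = p/(p−1), and f ∈ A^1_β(𝕋). If f is not cyclic in A^p_β(𝕋), then there exists a nonzero distribution S on 𝕋 whose Fourier coefficient sequence lies in ℓ^q_{−β}(ℤ) (i.e. ∑_{n∈ℤ} |Ŝ(n)|^q (1+|n|)^{−qβ} < ∞) and such that supp(S) ⊆ Z(f). -/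
open MeasureTheory Real Set Filter Topology ENNReal

noncomputable section

abbrev Ci := AddCircle (2 * Real.pi)

lemma norm_fc_le (n : ℤ) (g : C(Ci, ℂ)) : ‖fourierCoeff g n‖ ≤ 1 * ‖g‖ := by
  unfold fourierCoeff
  have h := norm_integral_le_of_norm_le_const (μ := AddCircle.haarAddCircle (T := 2 * Real.pi))
    (f := fun t => fourier (-n) t • g t) (C := ‖g‖) (by
      refine Filter.Eventually.of_forall fun t => ?_
      have h1 : ‖fourier (T := 2 * Real.pi) (-n) t‖ ≤ 1 := by
        have := (fourier (T := 2 * Real.pi) (-n)).norm_coe_le_norm t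
        rwa [fourier_norm] at this
      rw [norm_smul]
      have h2 := g.norm_coe_le_norm t
      have := norm_nonneg (g t)
      nlinarith [norm_nonneg (fourier (T := 2 * Real.pi) (-n) t)])
  simpa using h

lemma fc_integrable (g : C(Ci, ℂ)) : Integrable g (AddCircle.haarAddCircle (T := 2 * Real.pi)) :=
  g.continuous.integrable_of_hasCompactSupport (HasCompactSupport.of_compactSpace _)

/-- Fourier coefficient as a continuous linear functional. -/
def FC (n : ℤ) : C(Ci, ℂ) →L[ℂ] ℂ :=
  LinearMap.mkContinuous
    { toFun := fun g => fourierCoeff g n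
      map_add' := fun f g => by
        have := fourierCoeff.add (fc_integrable f) (fc_integrable g)
        exact congrFun this n
      map_smul' := fun c g => by
        exact fourierCoeff.const_smul g c n } 1 (fun g => norm_fc_le n g)

lemma FC_apply (n : ℤ) (g : C(Ci, ℂ)) : FC n g = fourierCoeff g n := rfl

lemma norm_FC_le (n : ℤ) (g : C(Ci, ℂ)) : ‖FC n g‖ ≤ ‖g‖ := by
  have := norm_fc_le n g
  rwa [one_mul] at this

lemma FC_fourier (n m : ℤ) : FC n (fourier m) = if n = m then 1 else 0 := by
  rw [FC_apply, fourierCoeff_fourier, Pi.single_apply]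

lemma FC_fourier_mul (n m : ℤ) (g : C(Ci, ℂ)) : FC n (fourier m * g) = FC (n - m) g := by
  simp only [FC_apply, fourierCoeff]
  refine integral_congr_ae (Filter.Eventually.of_forall fun t => ?_)
  simp only [ContinuousMap.coe_mul, Pi.mul_apply, smul_eq_mul]
  rw [← mul_assoc, ← fourier_add]
  congr 3
  ring

lemma FC_star (n : ℤ) (g : C(Ci, ℂ)) : FC n (star g) = star (FC (-n) g) := by
  simp only [FC_apply, fourierCoeff]
  rw [RCLike.star_def, ← integral_conj]
  refine integral_congr_ae (Filter.Eventually.of_forall fun t => ?_)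
  simp only [ContinuousMap.star_apply, smul_eq_mul, map_mul, neg_neg]
  rw [fourier_neg]
  rfl

/-- the weight -/
def wt (β : ℝ) (n : ℤ) : ℝ≥0∞ := ENNReal.ofReal ((1 + |(n : ℝ)|) ^ β)

/-- weighted Wiener norm -/
def nA (β : ℝ) (g : C(Ci, ℂ)) : ℝ≥0∞ := ∑' n : ℤ, ‖FC n g‖ₑ * wt β n

lemma wt_ne_top (β : ℝ) (n : ℤ) : wt β n ≠ ∞ := ENNReal.ofReal_ne_top

lemma one_le_wt {β : ℝ} (hβ : 0 ≤ β) (n : ℤ) : 1 ≤ wt β n := by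
  unfold wt
  rw [ENNReal.one_le_ofReal]
  exact Real.one_le_rpow (by linarith [abs_nonneg (n : ℝ)]) hβ

lemma wt_mul {β : ℝ} (hβ : 0 ≤ β) (m n : ℤ) : wt β (m + n) ≤ wt β m * wt β n := by
  unfold wt
  rw [← ENNReal.ofReal_mul (by positivity), ← Real.mul_rpow (by positivity) (by positivity)]
  refine ENNReal.ofReal_le_ofReal (Real.rpow_le_rpow (by positivity) ?_ hβ)
  push_cast
  have := abs_add_le (m : ℝ) n
  nlinarith [mul_nonneg (abs_nonneg (m : ℝ)) (abs_nonneg (n : ℝ))]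

lemma summable_FC {β : ℝ} (hβ : 0 ≤ β) {g : C(Ci, ℂ)} (h : nA β g ≠ ∞) :
    Summable (fun n => ‖FC n g‖) := by
  have h1 : ∑' n : ℤ, ‖FC n g‖ₑ ≠ ∞ := by
    refine ne_top_of_le_ne_top h (ENNReal.tsum_le_tsum fun n => ?_)
    exact le_mul_of_one_le_right' (one_le_wt hβ n)
  have := ENNReal.summable_toReal h1
  simpa using this

lemma hasSum_FC {β : ℝ} (hβ : 0 ≤ β) {g : C(Ci, ℂ)} (h : nA β g ≠ ∞) :
    HasSum (fun i => FC i g • fourier i) g :=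
  hasSum_fourier_series_of_summable (summable_FC hβ h).of_norm

lemma hasSum_conv {g : C(Ci, ℂ)} (hg : Summable (fun n => ‖FC n g‖)) (f : C(Ci, ℂ)) (n : ℤ) :
    HasSum (fun m => FC m g * FC (n - m) f) (FC n (g * f)) := by
  have h1 : HasSum (fun i => FC i g • fourier i) g :=
    hasSum_fourier_series_of_summable hg.of_norm
  have h2 := (FC n).hasSum (h1.mul_right f)
  refine h2.congr_fun ?_ |> fun h => h
  intro m
  simp only [smul_mul_assoc, map_smul, FC_fourier_mul, smul_eq_mul]

lemma nA_add (β : ℝ) (f g : C(Ci, ℂ)) : nA β (f + g) ≤ nA β f + nA β g := by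
  unfold nA
  rw [← ENNReal.tsum_add]
  refine ENNReal.tsum_le_tsum fun n => ?_
  rw [map_add, ← add_mul]
  gcongr
  exact enorm_add_le _ _

lemma nA_smul (β : ℝ) (c : ℂ) (g : C(Ci, ℂ)) : nA β (c • g) = ‖c‖ₑ * nA β g := by
  unfold nA
  rw [← ENNReal.tsum_mul_left]
  refine tsum_congr fun n => ?_
  rw [map_smul, smul_eq_mul, enorm_mul, mul_assoc]

lemma nA_zero (β : ℝ) : nA β 0 = 0 := by simp [nA]

lemma nA_sum {ι : Type*} (β : ℝ) (s : Finset ι) (f : ι → C(Ci, ℂ)) :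
    nA β (∑ i ∈ s, f i) ≤ ∑ i ∈ s, nA β (f i) := by
  classical
  induction s using Finset.induction_on with
  | empty => simp [nA_zero]
  | insert a s ha ih =>
    rw [Finset.sum_insert ha, Finset.sum_insert ha]
    exact (nA_add _ _ _).trans (by gcongr)

lemma nA_fourier (β : ℝ) (m : ℤ) : nA β (fourier m) = wt β m := by
  unfold nA
  rw [tsum_eq_single m]
  · simp [FC_fourier]
  · intro n hn
    simp [FC_fourier, hn]

lemma nA_mul {β : ℝ} (hβ : 0 ≤ β) {f : C(Ci, ℂ)} (hf : nA β f ≠ ∞) (g : C(Ci, ℂ)) :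
    nA β (f * g) ≤ nA β f * nA β g := by
  calc nA β (f * g) ≤ ∑' n : ℤ, ∑' m : ℤ, (‖FC m f‖ₑ * wt β m) * (‖FC (n - m) g‖ₑ * wt β (n - m)) := by
        refine ENNReal.tsum_le_tsum fun n => ?_
        rw [← (hasSum_conv (summable_FC hβ hf) g n).tsum_eq]
        calc _ ≤ (∑' m, ‖FC m f * FC (n - m) g‖ₑ) * wt β n := by
              gcongr
              exact enorm_tsum_le_tsum_enorm
          _ ≤ _ := by
              rw [← ENNReal.tsum_mul_right]
              refine ENNReal.tsum_le_tsum fun m => ?_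
              rw [enorm_mul]
              have := wt_mul hβ m (n - m)
              rw [add_sub_cancel] at this
              calc _ ≤ ‖FC m f‖ₑ * ‖FC (n - m) g‖ₑ * (wt β m * wt β (n - m)) := by gcongr
                _ = _ := by ring
    _ = ∑' m : ℤ, ∑' n : ℤ, (‖FC m f‖ₑ * wt β m) * (‖FC (n - m) g‖ₑ * wt β (n - m)) :=
        ENNReal.tsum_comm
    _ = nA β f * nA β g := by
        unfold nA
        rw [← ENNReal.tsum_mul_right]
        refine tsum_congr fun m => ?_
        rw [ENNReal.tsum_mul_left]
        congr 1
        exact (Equiv.subRight m).tsum_eq (fun n => ‖FC n g‖ₑ * wt β n)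

lemma nA_one {β : ℝ} : nA β 1 = 1 := by
  have : (1 : C(Ci, ℂ)) = fourier 0 := by ext; simp
  rw [this, nA_fourier]
  simp [wt]

lemma nA_pow {β : ℝ} (hβ : 0 ≤ β) {f : C(Ci, ℂ)} (hf : nA β f ≠ ∞) (k : ℕ) :
    nA β (f ^ k) ≤ nA β f ^ k := by
  induction k with
  | zero => simp [nA_one]
  | succ k ih =>
    rw [pow_succ', pow_succ']
    exact (nA_mul hβ hf _).trans (by gcongr)

lemma nA_star (β : ℝ) (f : C(Ci, ℂ)) : nA β (star f) = nA β f := by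
  unfold nA
  rw [← (Equiv.neg ℤ).tsum_eq]
  refine tsum_congr fun n => ?_
  simp [FC_star, wt]

/-- truncation -/
def trunc (g : C(Ci, ℂ)) (F : Finset ℤ) : C(Ci, ℂ) := ∑ i ∈ F, FC i g • fourier i

lemma FC_trunc (g : C(Ci, ℂ)) (F : Finset ℤ) (n : ℤ) :
    FC n (trunc g F) = if n ∈ F then FC n g else 0 := by
  unfold trunc
  simp [FC_fourier]

lemma tendsto_nA_trunc {β : ℝ} {g : C(Ci, ℂ)} (h : nA β g ≠ ∞) :
    Tendsto (fun F => nA β (g - trunc g F)) atTop (𝓝 0) := by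
  have h1 := ENNReal.tendsto_tsum_compl_atTop_zero h
  refine h1.congr fun F => ?_
  unfold nA
  rw [← tsum_subtype_eq_of_support_subset (s := {x | x ∉ F})]
  · refine tsum_congr fun n => ?_
    have : (n : ℤ) ∉ F := n.2
    rw [map_sub, FC_trunc, if_neg this, sub_zero]
  · intro n hn
    by_contra hh
    have hh : n ∈ F := not_not.1 hh
    apply hn
    simp [map_sub, FC_trunc, hh]

lemma nA_le_of_deg {β : ℝ} (hβ : 0 ≤ β) {b : ℕ} (hb : β + 1 ≤ b) {Q : C(Ci, ℂ)} {M : ℕ}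
    (h : ∀ n : ℤ, (M : ℤ) < |n| → FC n Q = 0) :
    nA β Q ≤ ENNReal.ofReal (2 * (1 + M : ℝ) ^ b * ‖Q‖) := by
  unfold nA
  rw [tsum_eq_sum (s := Finset.Icc (-(M : ℤ)) M)]
  · have hM : (1 : ℝ) ≤ 1 + M := by linarith [(Nat.cast_nonneg M : (0:ℝ) ≤ M)]
    calc _ ≤ ∑ n ∈ Finset.Icc (-(M : ℤ)) M, ENNReal.ofReal (‖Q‖ * (1 + M : ℝ) ^ β) := by
          refine Finset.sum_le_sum fun n hn => ?_
          rw [Finset.mem_Icc] at hn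
          unfold wt
          rw [← ofReal_norm, ← ENNReal.ofReal_mul (norm_nonneg _)]
          refine ENNReal.ofReal_le_ofReal ?_
          have h1 : |(n : ℝ)| ≤ M := by
            rw [abs_le]
            exact ⟨by exact_mod_cast hn.1, by exact_mod_cast hn.2⟩
          gcongr
          exact norm_FC_le n Q
      _ = ENNReal.ofReal ((2 * M + 1) * (‖Q‖ * (1 + M : ℝ) ^ β)) := by
          rw [Finset.sum_const, nsmul_eq_mul,
            ENNReal.ofReal_mul (p := (2 * M + 1 : ℝ)) (by positivity)]
          congr 1
          rw [Int.card_Icc]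
          have : ((M : ℤ) + 1 - -(M : ℤ)).toNat = 2 * M + 1 := by omega
          rw [this, ENNReal.ofReal_add (by positivity) (by positivity),
            ENNReal.ofReal_mul (by positivity)]
          simp
      _ ≤ _ := by
          refine ENNReal.ofReal_le_ofReal ?_
          have h2 : (1 + M : ℝ) * (1 + M : ℝ) ^ β ≤ (1 + M : ℝ) ^ b := by
            rw [← Real.rpow_natCast, mul_comm, ← Real.rpow_add_one (by positivity)]
            exact Real.rpow_le_rpow_of_exponent_le hM hb
          have h3 : 0 ≤ (1 + M : ℝ) ^ β := by positivity
          calc ((2 * M + 1) * (‖Q‖ * (1 + M : ℝ) ^ β)) ≤ (2 * (1 + M)) * (‖Q‖ * (1 + M : ℝ) ^ β) := by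
                gcongr; linarith
            _ = 2 * ((1 + M : ℝ) * (1 + M : ℝ) ^ β) * ‖Q‖ := by ring
            _ ≤ _ := by gcongr
  · intro n hn
    rw [h n]
    · simp
    · rw [Finset.mem_Icc] at hn
      by_contra hh
      exact hn (abs_le.1 (not_lt.1 hh))

lemma deg_pow {P : C(Ci, ℂ)} {d : ℕ} (h : ∀ n : ℤ, (d : ℤ) < |n| → FC n P = 0) (j : ℕ) :
    ∀ n : ℤ, ((d * j : ℕ) : ℤ) < |n| → FC n (P ^ j) = 0 := by
  have hs : Summable (fun n => ‖FC n P‖) := by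
    refine summable_of_ne_finset_zero (s := Finset.Icc (-(d : ℤ)) d) fun n hn => ?_
    rw [h n, norm_zero]
    rw [Finset.mem_Icc] at hn
    by_contra hh
    exact hn (abs_le.1 (not_lt.1 hh))
  induction j with
  | zero =>
    intro n hn
    have h1 : (1 : C(Ci, ℂ)) = fourier 0 := by ext; simp
    rw [pow_zero, h1, FC_fourier, if_neg]
    rintro rfl
    simp at hn
  | succ j ih =>
    intro n hn
    rw [pow_succ', ← (hasSum_conv hs _ n).tsum_eq]
    convert tsum_zero with m
    by_cases hm : (d : ℤ) < |m|
    · rw [h m hm, zero_mul]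
    · rw [ih (n - m), mul_zero]
      have := abs_add_le (n - m) m
      rw [sub_add_cancel] at this
      push_cast at hn ⊢
      rw [mul_add] at hn
      linarith

lemma nA_poly_pow {β : ℝ} (hβ : 0 ≤ β) {P : C(Ci, ℂ)} {d : ℕ}
    (h : ∀ n : ℤ, (d : ℤ) < |n| → FC n P = 0) {ρ : ℝ} (hρ : ‖P‖ < ρ) :
    ∃ C : ℝ, ∀ j : ℕ, nA β (P ^ j) ≤ ENNReal.ofReal (C * ρ ^ j) := by
  obtain ⟨b, hb⟩ := exists_nat_ge (β + 1)
  have hρ0 : 0 < ρ := (norm_nonneg _).trans_lt hρ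
  have hr : |‖P‖ / ρ| < 1 := by
    rw [abs_of_nonneg (by positivity), div_lt_one hρ0]; exact hρ
  have ht := tendsto_pow_const_mul_const_pow_of_abs_lt_one b hr
  obtain ⟨C1, hC1⟩ := ht.bddAbove_range
  obtain ⟨C2, hC2⟩ := (tendsto_pow_atTop_nhds_zero_of_abs_lt_one hr).bddAbove_range
  have key : ∀ j : ℕ, (1 + j : ℝ) ^ b * (‖P‖ / ρ) ^ j ≤ 2 ^ b * (|C1| + |C2|) := by
    intro j
    have h1 := (hC1 ⟨j, rfl⟩).trans (le_abs_self C1)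
    have h2 := (hC2 ⟨j, rfl⟩).trans (le_abs_self C2)
    simp only at h1 h2
    have h0 : 0 ≤ (‖P‖ / ρ) ^ j := by positivity
    rcases Nat.eq_zero_or_pos j with rfl | hj
    · simp at h1 h2 ⊢
      have : (1 : ℝ) ≤ 2 ^ b := one_le_pow₀ (by norm_num)
      nlinarith [abs_nonneg C1]
    · have hj : (1 : ℝ) ≤ j := by exact_mod_cast hj
      calc (1 + j : ℝ) ^ b * (‖P‖ / ρ) ^ j ≤ (2 * j : ℝ) ^ b * (‖P‖ / ρ) ^ j := by
            gcongr; linarith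
        _ = 2 ^ b * (j ^ b * (‖P‖ / ρ) ^ j) := by rw [mul_pow]; ring
        _ ≤ _ := by
            gcongr
            linarith [abs_nonneg C2]
  refine ⟨2 * (1 + d) ^ b * (2 ^ b * (|C1| + |C2|)), fun j => ?_⟩
  refine (nA_le_of_deg hβ hb (deg_pow h j)).trans (ENNReal.ofReal_le_ofReal ?_)
  have h1 : ‖P ^ j‖ ≤ ‖P‖ ^ j := by
    rcases Nat.eq_zero_or_pos j with rfl | hj
    · simp
    · exact norm_pow_le' P hj
  calc 2 * (1 + ((d * j : ℕ) : ℝ)) ^ b * ‖P ^ j‖ ≤ 2 * ((1 + d) * (1 + j)) ^ b * ‖P‖ ^ j := by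
        gcongr
        push_cast
        nlinarith [(Nat.cast_nonneg d : (0:ℝ) ≤ d), (Nat.cast_nonneg j : (0:ℝ) ≤ j)]
    _ = 2 * (1 + d) ^ b * ((1 + j : ℝ) ^ b * (‖P‖ / ρ) ^ j) * ρ ^ j := by
        rw [mul_pow, div_pow]
        field_simp
    _ ≤ _ := by
        exact mul_le_mul_of_nonneg_right
          (mul_le_mul_of_nonneg_left (key j) (by positivity)) (by positivity)

lemma nA_pow_tendsto {β : ℝ} (hβ : 0 ≤ β) {h : C(Ci, ℂ)} (hh : nA β h ≠ ∞) (h1 : ‖h‖ < 1) :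
    Tendsto (fun k : ℕ => nA β (h ^ k)) atTop (𝓝 0) := by
  obtain ⟨ε, hε, hε1⟩ : ∃ ε : ℝ, 0 < ε ∧ ‖h‖ + 3 * ε < 1 :=
    ⟨(1 - ‖h‖) / 4, by linarith, by linarith⟩
  have e1 := (tendsto_order.1 (tendsto_nA_trunc hh)).2 (ENNReal.ofReal ε) (by simpa using hε)
  have e2 : Tendsto (fun F => ‖trunc h F‖) atTop (𝓝 ‖h‖) :=
    (continuous_norm.tendsto _).comp (hasSum_FC hβ hh)
  have e3 := (tendsto_order.1 e2).2 (‖h‖ + ε) (by linarith)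
  obtain ⟨F, hF1, hF2⟩ := (e1.and e3).exists
  set P := trunc h F with hP
  obtain ⟨d, hd⟩ : ∃ d : ℕ, ∀ n : ℤ, (d : ℤ) < |n| → FC n P = 0 := by
    refine ⟨∑ i ∈ F, i.natAbs, fun n hn => ?_⟩
    rw [hP, FC_trunc, if_neg]
    intro hnF
    have := Finset.single_le_sum (f := fun i : ℤ => i.natAbs) (fun i _ => Nat.zero_le _) hnF
    rw [Int.abs_eq_natAbs] at hn
    have hn' : ∑ i ∈ F, i.natAbs < n.natAbs := by exact_mod_cast hn
    exact absurd hn' (not_lt.2 this)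
  obtain ⟨C, hC⟩ := nA_poly_pow hβ hd (ρ := ‖h‖ + 2 * ε) (by linarith)
  set r := h - P with hr
  have hrt : nA β r ≠ ∞ := hF1.ne_top
  have hb : ∀ k : ℕ, nA β (h ^ k) ≤ ENNReal.ofReal C * ENNReal.ofReal (‖h‖ + 3 * ε) ^ k := by
    intro k
    have hk : h = P + r := by rw [hr]; ring
    have hPP : ∀ j, nA β (P ^ j) ≠ ∞ := fun j => ne_top_of_le_ne_top ENNReal.ofReal_ne_top (hC j)
    rw [hk, add_pow]
    refine (nA_sum _ _ _).trans ?_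
    rw [← hk]
    have : ENNReal.ofReal (‖h‖ + 3 * ε) = ENNReal.ofReal (‖h‖ + 2 * ε) + ENNReal.ofReal ε := by
      rw [← ENNReal.ofReal_add (by positivity) hε.le]; ring_nf
    rw [this, add_pow, Finset.mul_sum]
    refine Finset.sum_le_sum fun j _ => ?_
    have e : P ^ j * r ^ (k - j) * ((k.choose j : ℕ) : C(Ci, ℂ)) =
        ((k.choose j : ℕ) : ℂ) • (P ^ j * r ^ (k - j)) := by
      ext t; simp [mul_comm]
    rw [e, nA_smul]
    have e' : ‖((k.choose j : ℕ) : ℂ)‖ₑ = ((k.choose j : ℕ) : ℝ≥0∞) := by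
      rw [← ofReal_norm]; simp
    rw [e', mul_comm, ← mul_assoc]
    gcongr
    refine (nA_mul hβ (hPP j) _).trans ?_
    rw [← mul_assoc]
    gcongr
    · refine (hC j).trans ?_
      rw [ENNReal.ofReal_mul' (by positivity), ENNReal.ofReal_pow (by positivity)]
    · exact (nA_pow hβ hrt _).trans (by gcongr)
  have hl : Tendsto (fun k : ℕ => ENNReal.ofReal C * ENNReal.ofReal (‖h‖ + 3 * ε) ^ k) atTop (𝓝 0) := by
    have := ENNReal.Tendsto.const_mul (a := ENNReal.ofReal C)
      (ENNReal.tendsto_pow_atTop_nhds_zero_of_lt_one (r := ENNReal.ofReal (‖h‖ + 3 * ε))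
        (by simpa using hε1)) (Or.inr ENNReal.ofReal_ne_top)
    simpa using this
  exact tendsto_of_tendsto_of_tendsto_of_le_of_le tendsto_const_nhds hl (fun _ => zero_le) hb

/-- the pairing -/
def Lam (u : ℤ → ℂ) (g : C(Ci, ℂ)) : ℂ := ∑' n : ℤ, FC n g * u n

lemma Lam_tsum {β : ℝ} {u : ℤ → ℂ} {B : ℝ≥0∞} (hu : ∀ n, ‖u n‖ₑ ≤ B * wt β n) (g : C(Ci, ℂ)) :
    ∑' n, ‖FC n g * u n‖ₑ ≤ B * nA β g := by
  unfold nA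
  rw [← ENNReal.tsum_mul_left]
  refine ENNReal.tsum_le_tsum fun n => ?_
  rw [enorm_mul]
  calc _ ≤ ‖FC n g‖ₑ * (B * wt β n) := by gcongr; exact hu n
    _ = _ := by ring

lemma Lam_summable {β : ℝ} {u : ℤ → ℂ} {B : ℝ≥0∞} (hB : B ≠ ∞) (hu : ∀ n, ‖u n‖ₑ ≤ B * wt β n)
    {g : C(Ci, ℂ)} (hg : nA β g ≠ ∞) : Summable (fun n => FC n g * u n) := by
  have h1 : ∑' n, ‖FC n g * u n‖ₑ ≠ ∞ :=
    ne_top_of_le_ne_top (ENNReal.mul_ne_top hB hg) (Lam_tsum hu g)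
  have := ENNReal.summable_toReal h1
  refine Summable.of_norm ?_
  simpa using this

lemma Lam_le {β : ℝ} {u : ℤ → ℂ} {B : ℝ≥0∞} (hu : ∀ n, ‖u n‖ₑ ≤ B * wt β n)
    (g : C(Ci, ℂ)) : ‖Lam u g‖ₑ ≤ B * nA β g :=
  enorm_tsum_le_tsum_enorm.trans (Lam_tsum hu g)

lemma Lam_add {β : ℝ} {u : ℤ → ℂ} {B : ℝ≥0∞} (hB : B ≠ ∞) (hu : ∀ n, ‖u n‖ₑ ≤ B * wt β n)
    {f g : C(Ci, ℂ)} (hf : nA β f ≠ ∞) (hg : nA β g ≠ ∞) : Lam u (f + g) = Lam u f + Lam u g := by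
  unfold Lam
  rw [← (Lam_summable hB hu hf).tsum_add (Lam_summable hB hu hg)]
  refine tsum_congr fun n => ?_
  rw [map_add, add_mul]

lemma Lam_smul (u : ℤ → ℂ) (c : ℂ) (g : C(Ci, ℂ)) : Lam u (c • g) = c * Lam u g := by
  unfold Lam
  rw [← tsum_mul_left]
  refine tsum_congr fun n => ?_
  rw [map_smul, smul_eq_mul, mul_assoc]

lemma nA_trunc_ne_top (β : ℝ) (g : C(Ci, ℂ)) (F : Finset ℤ) : nA β (trunc g F) ≠ ∞ := by
  refine ne_top_of_le_ne_top ?_ (nA_sum _ _ _)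
  refine ENNReal.sum_ne_top.2 fun i _ => ?_
  rw [nA_smul, nA_fourier]
  exact ENNReal.mul_ne_top enorm_ne_top (wt_ne_top _ _)

lemma nA_mul_ne_top {β : ℝ} (hβ : 0 ≤ β) {f g : C(Ci, ℂ)} (hf : nA β f ≠ ∞) (hg : nA β g ≠ ∞) :
    nA β (f * g) ≠ ∞ :=
  ne_top_of_le_ne_top (ENNReal.mul_ne_top hf hg) (nA_mul hβ hf g)

lemma Lam_mul_eq_zero {β : ℝ} (hβ : 0 ≤ β) {u : ℤ → ℂ} {B : ℝ≥0∞} (hB : B ≠ ∞)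
    (hu : ∀ n, ‖u n‖ₑ ≤ B * wt β n) {f : C(Ci, ℂ)} (hf : nA β f ≠ ∞)
    (hk : ∀ k : ℤ, Lam u (fourier k * f) = 0) {g : C(Ci, ℂ)} (hg : nA β g ≠ ∞) :
    Lam u (g * f) = 0 := by
  have hfin : ∀ F : Finset ℤ, Lam u (trunc g F * f) = 0 := by
    intro F
    unfold trunc
    induction F using Finset.induction_on with
    | empty => simp [Lam]
    | insert a s ha ih =>
      rw [Finset.sum_insert ha, add_mul, Lam_add hB hu, ih, smul_mul_assoc, Lam_smul, hk]
      · simp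
      · rw [smul_mul_assoc, nA_smul]
        refine ENNReal.mul_ne_top enorm_ne_top (nA_mul_ne_top hβ ?_ hf)
        rw [nA_fourier]; exact wt_ne_top _ _
      · exact nA_mul_ne_top hβ (nA_trunc_ne_top β g s) hf
  have hbd : ∀ᶠ F : Finset ℤ in atTop, ‖Lam u (g * f)‖ₑ ≤ B * (nA β (g - trunc g F) * nA β f) := by
    filter_upwards [(tendsto_order.1 (tendsto_nA_trunc hg)).2 1 (by simp)] with F hF
    have e : g * f = (g - trunc g F) * f + trunc g F * f := by ring
    have h1 := nA_mul_ne_top hβ hF.ne_top hf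
    rw [e, Lam_add hB hu h1 (nA_mul_ne_top hβ (nA_trunc_ne_top β g F) hf), hfin, add_zero]
    refine (Lam_le hu _).trans ?_
    gcongr
    exact nA_mul hβ hF.ne_top f
  have hl : Tendsto (fun F => B * (nA β (g - trunc g F) * nA β f)) atTop (𝓝 0) := by
    have := ENNReal.Tendsto.const_mul (a := B)
      (ENNReal.Tendsto.mul_const (b := nA β f) (tendsto_nA_trunc hg) (Or.inr hf)) (Or.inr hB)
    simpa using this
  have := ge_of_tendsto hl hbd
  simpa using this

lemma main_supp {β : ℝ} (hβ : 0 ≤ β) {u : ℤ → ℂ} {B : ℝ≥0∞} (hB : B ≠ ∞)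
    (hu : ∀ n, ‖u n‖ₑ ≤ B * wt β n) {f : C(Ci, ℂ)} (hf : nA β f ≠ ∞)
    (hk : ∀ k : ℤ, Lam u (fourier k * f) = 0) {φ : C(Ci, ℂ)} (hφ : nA β φ ≠ ∞)
    {V : C(Ci, ℂ)} (hV : nA β V ≠ ∞) (v : Ci → ℝ) (hv : ∀ t, V t = v t)
    (hv01 : ∀ t, v t ∈ Icc (0 : ℝ) 1) (hVφ : V * φ = φ) (hVf : ∀ t, f t = 0 → v t = 0) :
    Lam u φ = 0 := by
  obtain ⟨c, hc, hcf⟩ : ∃ c : ℝ, 0 < c ∧ c * ‖f‖ ^ 2 ≤ 1 := by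
    refine ⟨1 / (‖f‖ ^ 2 + 1), by positivity, ?_⟩
    rw [div_mul_eq_mul_div, one_mul, div_le_one (by positivity)]
    linarith
  set w : C(Ci, ℂ) := 1 - (c : ℂ) • (star f * f) with hw
  have hsf : nA β (star f) ≠ ∞ := by rw [nA_star]; exact hf
  have hone : nA β 1 ≠ ∞ := by rw [nA_one]; simp
  have hwt : nA β w ≠ ∞ := by
    have : w = 1 + (-(c : ℂ)) • (star f * f) := by rw [hw, neg_smul, sub_eq_add_neg]
    rw [this]
    refine ne_top_of_le_ne_top (ENNReal.add_ne_top.2 ⟨hone, ?_⟩) (nA_add _ _ _)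
    rw [nA_smul]
    exact ENNReal.mul_ne_top enorm_ne_top (nA_mul_ne_top hβ hsf hf)
  set h := V * w with hh
  have hht : nA β h ≠ ∞ := nA_mul_ne_top hβ hV hwt
  have hnorm : ‖h‖ < 1 := by
    rw [ContinuousMap.norm_lt_iff _ one_pos]
    intro t
    have hwv : w t = ((1 - c * ‖f t‖ ^ 2 : ℝ) : ℂ) := by
      simp only [hw, ContinuousMap.coe_sub, ContinuousMap.coe_one, ContinuousMap.coe_smul,
        ContinuousMap.coe_mul, Pi.sub_apply, Pi.one_apply, Pi.smul_apply, Pi.mul_apply,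
        ContinuousMap.star_apply, smul_eq_mul]
      rw [RCLike.star_def, Complex.conj_mul']
      push_cast
      ring
    have h1 : h t = ((v t * (1 - c * ‖f t‖ ^ 2) : ℝ) : ℂ) := by
      rw [hh, ContinuousMap.mul_apply, hv, hwv]; push_cast; ring
    rw [h1, Complex.norm_real, Real.norm_eq_abs]
    have h2 : c * ‖f t‖ ^ 2 ≤ 1 := by
      refine le_trans ?_ hcf
      have := f.norm_coe_le_norm t
      gcongr
    obtain ⟨h3, h4⟩ := hv01 t
    rw [abs_of_nonneg (mul_nonneg h3 (by linarith))]
    by_cases hft : f t = 0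
    · rw [hVf t hft]; simp
    · have : 0 < c * ‖f t‖ ^ 2 := by
        have := norm_pos_iff.2 hft
        positivity
      nlinarith
  have hwk : ∀ k : ℕ, nA β (φ * w ^ k) ≠ ∞ := fun k =>
    nA_mul_ne_top hβ hφ (ne_top_of_le_ne_top (ENNReal.pow_ne_top hwt) (nA_pow hβ hwt k))
  have hstep : ∀ k : ℕ, Lam u (φ * w ^ k) = Lam u φ := by
    intro k
    induction k with
    | zero => simp
    | succ k ih =>
      have e : φ * w ^ (k + 1) = φ * w ^ k + (-(c : ℂ)) • (φ * w ^ k * star f * f) := by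
        rw [pow_succ, ← mul_assoc]
        nth_rewrite 2 [hw]
        rw [mul_sub, mul_one, mul_smul_comm, neg_smul, sub_eq_add_neg, mul_assoc (φ * w ^ k)]
      have h1 := nA_mul_ne_top hβ (hwk k) hsf
      rw [e, Lam_add hB hu (hwk k), Lam_smul, Lam_mul_eq_zero hβ hB hu hf hk h1, ih]
      · simp
      · rw [nA_smul]
        exact ENNReal.mul_ne_top enorm_ne_top (nA_mul_ne_top hβ h1 hf)
  have hVk : ∀ k : ℕ, φ * h ^ k = φ * w ^ k := by
    intro k
    have : ∀ k : ℕ, φ * V ^ k = φ := by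
      intro k
      induction k with
      | zero => simp
      | succ k ih => rw [pow_succ, ← mul_assoc, ih]; exact (mul_comm φ V).trans hVφ
    rw [hh, mul_pow, ← mul_assoc, this]
  have hbd : ∀ k : ℕ, ‖Lam u φ‖ₑ ≤ B * (nA β φ * nA β (h ^ k)) := by
    intro k
    rw [← hstep k, ← hVk k]
    refine (Lam_le hu _).trans ?_
    gcongr
    exact nA_mul hβ hφ _
  have hl : Tendsto (fun k : ℕ => B * (nA β φ * nA β (h ^ k))) atTop (𝓝 0) := by
    have := ENNReal.Tendsto.const_mul (a := B)
      (ENNReal.Tendsto.const_mul (a := nA β φ) (nA_pow_tendsto hβ hht hnorm) (Or.inr hφ))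
      (Or.inr hB)
    simpa using this
  have := ge_of_tendsto' hl hbd
  simpa using this

lemma smooth_deriv {φ : Ci → ℂ} (hφ : SmoothOnCircle φ) :
    ∃ ψ : Ci → ℂ, SmoothOnCircle ψ ∧
      ∀ n : ℤ, fourierCoeff ψ n = Complex.I * n * fourierCoeff φ n := by
  have hφ' : ContDiff ℝ (⊤ : ℕ∞) fun x : ℝ => φ (↑x) := hφ
  set F : ℝ → ℂ := fun x : ℝ => φ (↑x) with hF
  have hFp : Function.Periodic F (2 * Real.pi) := fun x => by simp [hF]
  have hper : Function.Periodic (deriv F) (2 * Real.pi) := by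
    intro x
    have h1 : (fun y => F (y + 2 * Real.pi)) = F := funext hFp
    rw [← deriv_comp_add_const, h1]
  have hd : ContDiff ℝ (⊤ : ℕ∞) (deriv F) := by
    exact (contDiff_infty_iff_deriv.1 hφ').2
  refine ⟨hper.lift, ?_, ?_⟩
  · exact hd
  · intro n
    rw [fourierCoeff_eq_intervalIntegral _ n 0, fourierCoeff_eq_intervalIntegral _ n 0]
    simp only [Function.Periodic.lift_coe, smul_eq_mul, zero_add]
    have hdF : ∀ x, HasDerivAt F (deriv F x) x := fun x =>
      ((hφ'.differentiable (by simp)) x).hasDerivAt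
    have hfo : ∀ x : ℝ, HasDerivAt (fun y : ℝ => fourier (-n) (y : Ci))
        (-(Complex.I * n) * fourier (-n) (x : Ci)) x := by
      intro x
      convert hasDerivAt_fourier_neg (2 * Real.pi) n x using 1
      have : (Real.pi : ℂ) ≠ 0 := by exact_mod_cast Real.pi_ne_zero
      push_cast
      field_simp
    have hcf : Continuous (fun y : ℝ => fourier (-n) (y : Ci)) :=
      (fourier (T := 2 * Real.pi) (-n)).continuous.comp (AddCircle.continuous_mk' _)
    have hcF : Continuous F := hφ'.continuous
    have hcd : Continuous (deriv F) := hd.continuous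
    have key := intervalIntegral.integral_eq_sub_of_hasDerivAt (a := 0) (b := 2 * Real.pi)
      (fun x _ => (hfo x).mul (hdF x)) (Continuous.intervalIntegrable (by fun_prop) _ _)
    have hz : F (2 * Real.pi) = F 0 := by simpa using hFp 0
    have hz' : fourier (-n) ((2 * Real.pi : ℝ) : Ci) = fourier (-n) ((0 : ℝ) : Ci) := by
      rw [AddCircle.coe_period]; simp
    simp only [Pi.mul_apply] at key
    rw [hz, hz', sub_self, intervalIntegral.integral_add
      (Continuous.intervalIntegrable (by fun_prop) _ _)
      (Continuous.intervalIntegrable (by fun_prop) _ _)] at key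
    simp only [mul_assoc] at key
    rw [intervalIntegral.integral_const_mul] at key
    have key2 : ∫ (x : ℝ) in (0 : ℝ)..2 * Real.pi, fourier (-n) (x : Ci) * deriv F x =
        Complex.I * n * ∫ (x : ℝ) in (0 : ℝ)..2 * Real.pi, fourier (-n) (x : Ci) * F x := by
      linear_combination key
    rw [key2, mul_smul_comm]

lemma smooth_deriv_iter {φ : Ci → ℂ} (hφ : SmoothOnCircle φ) (m : ℕ) :
    ∃ ψ : Ci → ℂ, SmoothOnCircle ψ ∧
      ∀ n : ℤ, fourierCoeff ψ n = (Complex.I * n) ^ m * fourierCoeff φ n := by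
  induction m with
  | zero => exact ⟨φ, hφ, by simp⟩
  | succ m ih =>
    obtain ⟨ψ, h1, h2⟩ := ih
    obtain ⟨χ, h3, h4⟩ := smooth_deriv h1
    refine ⟨χ, h3, fun n => ?_⟩
    rw [h4, h2]; ring

lemma smooth_cont {φ : Ci → ℂ} (hφ : SmoothOnCircle φ) : Continuous φ := by
  have h : Continuous fun x : ℝ => φ (↑x) := ContDiff.continuous hφ
  exact (QuotientAddGroup.isQuotientMap_mk (AddSubgroup.zmultiples (2 * Real.pi))).continuous_iff.2 h

lemma smooth_nA {β : ℝ} (φ : C(Ci, ℂ)) (hφ : SmoothOnCircle φ) : nA β φ ≠ ∞ := by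
  obtain ⟨b, hb⟩ := exists_nat_ge β
  obtain ⟨ψ, h1, h2⟩ := smooth_deriv_iter hφ (b + 2)
  set Ψ : C(Ci, ℂ) := ⟨ψ, smooth_cont h1⟩
  have hs : Summable (fun n : ℤ => ‖FC n φ‖ * (1 + |(n : ℝ)|) ^ β) := by
    have hs0 : Summable (fun n : ℤ => (2 ^ b * ‖Ψ‖) * (1 / (n : ℝ) ^ 2)) :=
      (Real.summable_one_div_int_pow.2 (by norm_num)).mul_left _
    refine Summable.of_norm_bounded_eventually hs0 ?_
    have : ∀ᶠ n : ℤ in cofinite, n ≠ 0 := (Set.finite_singleton (0 : ℤ)).eventually_cofinite_notMem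
    filter_upwards [this] with n hn
    have hn1 : (1 : ℝ) ≤ |(n : ℝ)| := by exact_mod_cast Int.one_le_abs hn
    have h3 : |(n : ℝ)| ^ (b + 2) * ‖FC n φ‖ ≤ ‖Ψ‖ := by
      have := norm_FC_le n Ψ
      rw [FC_apply] at this
      have e : fourierCoeff Ψ n = (Complex.I * n) ^ (b + 2) * fourierCoeff φ n := h2 n
      rw [e, norm_mul, norm_pow, norm_mul, Complex.norm_I, one_mul, Complex.norm_intCast] at this
      exact this
    rw [Real.norm_of_nonneg (by positivity)]
    calc ‖FC n φ‖ * (1 + |(n : ℝ)|) ^ β ≤ ‖FC n φ‖ * (2 * |(n : ℝ)|) ^ b := by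
          gcongr
          rw [← Real.rpow_natCast]
          calc (1 + |(n : ℝ)|) ^ β ≤ (1 + |(n : ℝ)|) ^ (b : ℝ) :=
                Real.rpow_le_rpow_of_exponent_le (by linarith) hb
            _ ≤ _ := by gcongr; linarith
      _ = 2 ^ b * (|(n : ℝ)| ^ (b + 2) * ‖FC n φ‖) * (1 / (n : ℝ) ^ 2) := by
          rw [← sq_abs (n : ℝ), mul_pow, pow_add]
          field_simp
      _ ≤ _ := by gcongr
  unfold nA
  have := hs.tsum_ofReal_ne_top
  convert this using 3 with n
  unfold wt
  rw [ENNReal.ofReal_mul (norm_nonneg _), ofReal_norm]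

lemma exists_bump {K Z : Set Ci} (hK : IsClosed K) (hZ : IsClosed Z) (hd : Disjoint Z K) :
    ∃ v : Ci → ℝ, (∀ t, v t ∈ Icc (0 : ℝ) 1) ∧ (∀ t ∈ Z, v t = 0) ∧ (∀ t ∈ K, v t = 1) ∧
      SmoothOnCircle (fun t => (v t : ℂ)) := by
  set e : Ci → ℂ := fun t => fourier 1 t with he
  have hec : Continuous e := (fourier (T := 2 * Real.pi) 1).continuous
  have hinj : Function.Injective e := by
    intro a b hab
    simp only [he, fourier_one] at hab
    exact AddCircle.injective_toCircle (by positivity) (Subtype.ext hab)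
  have hs : IsClosed (e '' Z) := (hZ.isCompact.image hec).isClosed
  have ht : IsClosed (e '' K) := (hK.isCompact.image hec).isClosed
  obtain ⟨g, g0, g1, g2⟩ := exists_contMDiffMap_zero_one_of_isClosed (n := (⊤ : ℕ∞))
    (modelWithCornersSelf ℝ ℂ) hs ht ((Set.disjoint_image_iff hinj).2 hd)
  refine ⟨fun t => g (e t), fun t => g2 _, fun t htz => g0 ⟨t, htz, rfl⟩,
    fun t htk => g1 ⟨t, htk, rfl⟩, ?_⟩
  have hg : ContDiff ℝ (⊤ : ℕ∞) g := g.contMDiff.contDiff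
  unfold SmoothOnCircle
  have h1 : ContDiff ℝ (⊤ : ℕ∞) (fun x : ℝ => e (x : Ci)) := by
    simp only [he, fourier_coe_apply]
    have h0 : ContDiff ℝ (⊤ : ℕ∞) (fun x : ℝ => (x : ℂ)) := Complex.ofRealCLM.contDiff
    exact ((contDiff_const.mul h0).div_const _).cexp
  exact Complex.ofRealCLM.contDiff.comp (hg.comp h1)

lemma dual_summable {p q : ℝ} (hpq : p.HolderConjugate q) [Fact (1 ≤ ENNReal.ofReal p)]
    (L : lp (fun _ : ℤ => ℂ) (ENNReal.ofReal p) →L[ℂ] ℂ) :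
    Summable (fun n : ℤ => ‖L (lp.single (ENNReal.ofReal p) n 1)‖ ^ q) := by
  classical
  have hp0 : 0 < p := hpq.pos
  have hq0 : 0 < q := hpq.symm.pos
  have hpr : (ENNReal.ofReal p).toReal = p := ENNReal.toReal_ofReal hp0.le
  set s : ℤ → ℂ := fun n => L (lp.single (ENNReal.ofReal p) n 1) with hs
  refine summable_of_sum_le (c := ‖L‖ ^ q) (fun n => by positivity) fun F => ?_
  set A := ∑ n ∈ F, ‖s n‖ ^ q with hA
  set y : ℤ → ℂ := fun n => star (s n) * ((‖s n‖ ^ (q - 2) : ℝ) : ℂ) with hy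
  have h1 : ∀ n, y n * s n = ((‖s n‖ ^ q : ℝ) : ℂ) := by
    intro n
    by_cases h0 : s n = 0
    · simp [h0, Real.zero_rpow hq0.ne']
    · have : 0 < ‖s n‖ := norm_pos_iff.2 h0
      have e : ‖s n‖ ^ q = ‖s n‖ ^ 2 * ‖s n‖ ^ (q - 2) := by
        rw [← Real.rpow_natCast, ← Real.rpow_add this]; norm_num
      rw [e, hy]
      simp only
      rw [mul_right_comm, RCLike.star_def, Complex.conj_mul']
      push_cast
      ring
  have h2 : ∀ n, ‖y n‖ ^ p = ‖s n‖ ^ q := by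
    intro n
    by_cases h0 : s n = 0
    · simp [hy, h0, Real.zero_rpow hq0.ne', Real.zero_rpow hp0.ne']
    · have : 0 < ‖s n‖ := norm_pos_iff.2 h0
      have e : ‖y n‖ = ‖s n‖ ^ (q - 1) := by
        rw [hy]
        simp only
        rw [norm_mul, norm_star, Complex.norm_real, Real.norm_of_nonneg (by positivity)]
        nth_rewrite 1 [← Real.rpow_one ‖s n‖]
        rw [← Real.rpow_add this]; ring_nf
      rw [e, ← Real.rpow_mul this.le]
      congr 1
      exact hpq.symm.sub_one_mul_conj
  have h3 : L (∑ n ∈ F, lp.single (ENNReal.ofReal p) n (y n)) = (A : ℂ) := by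
    rw [map_sum, hA]
    push_cast
    refine Finset.sum_congr rfl fun n _ => ?_
    have : lp.single (E := fun _ : ℤ => ℂ) (ENNReal.ofReal p) n (y n)
        = y n • lp.single (ENNReal.ofReal p) n 1 := by
      rw [← lp.single_smul]; simp
    rw [this, map_smul, smul_eq_mul]
    have := h1 n
    exact this
  have h4 : ‖∑ n ∈ F, lp.single (E := fun _ : ℤ => ℂ) (ENNReal.ofReal p) n (y n)‖ ^ p = A := by
    have := lp.norm_sum_single (E := fun _ : ℤ => ℂ) (p := ENNReal.ofReal p) (by rw [hpr]; exact hp0) y F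
    rw [hpr] at this
    rw [this]
    exact Finset.sum_congr rfl fun n _ => h2 n
  have hA0 : 0 ≤ A := Finset.sum_nonneg fun n _ => by positivity
  have h5 : A ≤ ‖L‖ * A ^ (1 / p) := by
    have := L.le_opNorm (∑ n ∈ F, lp.single (E := fun _ : ℤ => ℂ) (ENNReal.ofReal p) n (y n))
    rw [h3, Complex.norm_real, Real.norm_of_nonneg hA0] at this
    rw [← h4, ← Real.rpow_mul (norm_nonneg _), mul_one_div_cancel hp0.ne', Real.rpow_one, h4]
    exact this
  rcases hA0.eq_or_lt with h0 | h0
  · rw [← h0]; positivity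
  · have h6 : A = A ^ (1 / q) * A ^ (1 / p) := by
      rw [← Real.rpow_add h0]
      have := hpq.inv_add_inv_eq_one
      rw [one_div, one_div, add_comm, this, Real.rpow_one]
    have h7 : A ^ (1 / q) ≤ ‖L‖ := by
      have hpos : 0 < A ^ (1 / p) := by positivity
      refine le_of_mul_le_mul_right ?_ hpos
      rw [← h6]; exact h5
    calc A = (A ^ (1 / q)) ^ q := by
          rw [← Real.rpow_mul hA0, one_div_mul_cancel hq0.ne', Real.rpow_one]
      _ ≤ _ := by gcongr

lemma hahn {E : Type*} [NormedAddCommGroup E] [NormedSpace ℂ E] (M : Submodule ℂ E) (x : E)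
    (hx : x ∉ closure (M : Set E)) : ∃ L : E →L[ℂ] ℂ, L x ≠ 0 ∧ ∀ y ∈ M, L y = 0 := by
  have hcl : IsClosed (M.topologicalClosure : Set E) := M.isClosed_topologicalClosure
  have hmem : x ∉ M.topologicalClosure := hx
  have hne : M.topologicalClosure.mkQL x ≠ 0 := by
    intro h
    exact hmem ((Submodule.Quotient.mk_eq_zero _).1 h)
  have := hcl
  obtain ⟨g, -, hg⟩ := exists_dual_vector ℂ (M.topologicalClosure.mkQL x) (norm_ne_zero_iff.2 hne)
  refine ⟨g.comp M.topologicalClosure.mkQL, ?_, fun y hy => ?_⟩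
  · rw [ContinuousLinearMap.comp_apply, hg]
    exact Complex.ofReal_ne_zero.2 (norm_ne_zero_iff.2 hne)
  · rw [ContinuousLinearMap.comp_apply]
    have : M.topologicalClosure.mkQL y = 0 :=
      (Submodule.Quotient.mk_eq_zero _).2 (M.le_topologicalClosure hy)
    rw [this, map_zero]

lemma exists_functional {p q β : ℝ} (hpq : p.HolderConjugate q) (hβ : 0 ≤ β)
    {c : ℤ → ℂ} (hc : MemA 1 β c) (hnc : ¬ IsCyclicA p β c) :
    ∃ u : ℤ → ℂ, u 0 ≠ 0 ∧ MemA q (-β) u ∧ (∃ B : ℝ≥0∞, B ≠ ∞ ∧ ∀ n, ‖u n‖ₑ ≤ B * wt β n) ∧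
      ∀ k : ℤ, ∑' n, c (n - k) * u n = 0 := by
  classical
  have hp0 : 0 < p := hpq.pos
  have hpr : (ENNReal.ofReal p).toReal = p := ENNReal.toReal_ofReal hp0.le
  have h1p : 1 ≤ ENNReal.ofReal p := by rw [ENNReal.one_le_ofReal]; exact hpq.lt.le
  have : Fact (1 ≤ ENNReal.ofReal p) := ⟨h1p⟩
  set w : ℤ → ℝ := fun n => (1 + |(n : ℝ)|) ^ β with hw
  have hw0 : ∀ n, 0 < w n := fun n => by simp only [hw]; positivity
  have hwm : ∀ m n, w (m + n) ≤ w m * w n := by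
    intro m n
    simp only [hw]
    rw [← Real.mul_rpow (by positivity) (by positivity)]
    refine Real.rpow_le_rpow (by positivity) ?_ hβ
    push_cast
    have := abs_add_le (m : ℝ) n
    nlinarith [mul_nonneg (abs_nonneg (m : ℝ)) (abs_nonneg (n : ℝ))]
  have hcs : Summable (fun n => ‖c n‖ * w n) := by
    simpa [MemA] using hc
  have hx : ∀ k : ℤ, Memℓp (E := fun _ : ℤ => ℂ) (fun n => c (n - k) * (w n : ℂ)) (ENNReal.ofReal p) := by
    intro k
    refine Memℓp.of_exponent_ge (q := 1) (memℓp_gen ?_) h1p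
    simp only [ENNReal.toReal_one, Real.rpow_one]
    have hs := (((Equiv.subRight k).summable_iff).2 hcs).mul_left (w k)
    refine Summable.of_nonneg_of_le (fun n => norm_nonneg _) (fun n => ?_) hs
    rw [norm_mul, Complex.norm_real, Real.norm_of_nonneg (hw0 n).le]
    simp only [Function.comp, Equiv.subRight_apply]
    have := hwm k (n - k)
    rw [add_sub_cancel] at this
    calc _ ≤ ‖c (n - k)‖ * (w k * w (n - k)) := by gcongr
      _ = _ := by ring
  set x : ℤ → lp (fun _ : ℤ => ℂ) (ENNReal.ofReal p) := fun k => ⟨_, hx k⟩ with hxdef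
  have hxa : ∀ k n, (x k : ∀ _ : ℤ, ℂ) n = c (n - k) * (w n : ℂ) := fun k n => rfl
  have hcl : lp.single (E := fun _ : ℤ => ℂ) (ENNReal.ofReal p) 0 1 ∉
      closure (Submodule.span ℂ (Set.range x) : Set (lp (fun _ : ℤ => ℂ) (ENNReal.ofReal p))) := by
    intro hmem
    apply hnc
    intro ε hε
    obtain ⟨y, hy, hd⟩ := Metric.mem_closure_iff.1 hmem ε hε
    obtain ⟨l, rfl⟩ := (Finsupp.mem_span_range_iff_exists_finsupp).1 hy
    refine ⟨l, l.hasFiniteSupport, ?_⟩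
    rw [dist_eq_norm, lp.norm_eq_tsum_rpow (by rw [hpr]; exact hp0), hpr] at hd
    unfold normA wSum
    refine lt_of_eq_of_lt ?_ hd
    congr 1
    refine tsum_congr fun n => ?_
    have hco : (l.sum fun i a => a • x i : lp (fun _ : ℤ => ℂ) (ENNReal.ofReal p)) n
        = convSeq l c n * (w n : ℂ) := by
      unfold convSeq
      rw [tsum_eq_sum (s := l.support), Finsupp.sum, lp.coeFn_sum, Finset.sum_apply,
        Finset.sum_mul]
      · refine Finset.sum_congr rfl fun i _ => ?_
        rw [lp.coeFn_smul, Pi.smul_apply, hxa, smul_eq_mul, mul_assoc]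
      · intro i hi
        rw [Finsupp.notMem_support_iff.1 hi, zero_mul]
    have hde : (lp.single (E := fun _ : ℤ => ℂ) (ENNReal.ofReal p) 0 1) n
        = (if n = 0 then (1 : ℂ) else 0) * (w n : ℂ) := by
      by_cases hn : n = 0
      · subst hn
        rw [lp.single_apply_self]; simp [hw]
      · rw [lp.single_apply_ne _ _ _ hn]; simp [hn]
    rw [lp.coeFn_sub, Pi.sub_apply, hco, hde, ← sub_mul, norm_mul, Complex.norm_real,
      Real.norm_of_nonneg (hw0 n).le, Real.mul_rpow (norm_nonneg _) (hw0 n).le]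
    simp only [hw]
    rw [← Real.rpow_mul (by positivity), mul_comm β p]
  obtain ⟨L, hL0, hL⟩ := hahn _ _ hcl
  set s : ℤ → ℂ := fun n => L (lp.single (ENNReal.ofReal p) n 1) with hs
  have hsum := dual_summable hpq L
  refine ⟨fun n => s n * w n, ?_, ?_, ⟨‖L‖ₑ, enorm_ne_top, fun n => ?_⟩, fun k => ?_⟩
  · exact mul_ne_zero hL0 (by exact_mod_cast (hw0 0).ne')
  · unfold MemA
    refine hsum.congr fun n => ?_
    rw [norm_mul, Complex.norm_real, Real.norm_of_nonneg (hw0 n).le,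
      Real.mul_rpow (norm_nonneg _) (hw0 n).le]
    simp only [hw]
    rw [← Real.rpow_mul (by positivity), mul_assoc, ← Real.rpow_add (by positivity)]
    have : β * q + q * -β = 0 := by ring
    rw [this, Real.rpow_zero, mul_one]
  · rw [enorm_mul]
    have h1 : ‖(w n : ℂ)‖ₑ = wt β n := by
      rw [← ofReal_norm, Complex.norm_real, Real.norm_of_nonneg (hw0 n).le]; rfl
    rw [h1]
    gcongr
    rw [← ofReal_norm, ← ofReal_norm]
    refine ENNReal.ofReal_le_ofReal ?_
    have := L.le_opNorm (lp.single (ENNReal.ofReal p) n 1)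
    rw [lp.norm_single (by simpa using hp0)] at this
    simpa using this
  · have h1 := L.hasSum (lp.hasSum_single ENNReal.ofReal_ne_top (x k))
    rw [hL _ (Submodule.subset_span ⟨k, rfl⟩)] at h1
    rw [← h1.tsum_eq]
    refine tsum_congr fun n => ?_
    have : lp.single (E := fun _ : ℤ => ℂ) (ENNReal.ofReal p) n (x k n)
        = x k n • lp.single (ENNReal.ofReal p) n 1 := by
      rw [← lp.single_smul]; simp
    rw [this, map_smul, smul_eq_mul, hxa]
    simp only [hs]
    ring

lemma exists_fun {β : ℝ} (hβ : 0 ≤ β) {c : ℤ → ℂ} (hc : MemA 1 β c) :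
    ∃ f : C(Ci, ℂ), (∀ n, FC n f = c n) ∧ (∀ t, f t = fSum c t) ∧ nA β f ≠ ∞ := by
  have hcs : Summable (fun n : ℤ => ‖c n‖ * (1 + |(n : ℝ)|) ^ β) := by
    simpa [MemA] using hc
  have hc1 : Summable (fun n : ℤ => ‖c n‖) := by
    refine Summable.of_nonneg_of_le (fun n => norm_nonneg _) (fun n => ?_) hcs
    exact le_mul_of_one_le_right (norm_nonneg _)
      (Real.one_le_rpow (by linarith [abs_nonneg (n : ℝ)]) hβ)
  have hs : Summable (fun n : ℤ => c n • (fourier n : C(Ci, ℂ))) := by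
    refine Summable.of_norm ?_
    simpa [norm_smul, fourier_norm] using hc1
  obtain ⟨f, hf⟩ := hs
  have hFC : ∀ n, FC n f = c n := by
    intro n
    have h1 := (FC n).hasSum hf
    rw [← h1.tsum_eq, tsum_eq_single n]
    · simp [FC_fourier]
    · intro m hm
      simp [FC_fourier, hm.symm]
  refine ⟨f, hFC, fun t => ?_, ?_⟩
  · have h1 := (ContinuousMap.evalCLM ℂ t).hasSum hf
    have h2 : f t = ∑' n, (ContinuousMap.evalCLM ℂ t) (c n • (fourier n : C(Ci, ℂ))) := h1.tsum_eq.symm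
    rw [h2]
    rfl
  · unfold nA
    have := hcs.tsum_ofReal_ne_top
    convert this using 3 with n
    unfold wt
    rw [ENNReal.ofReal_mul (norm_nonneg _), ofReal_norm, hFC]

/-- Proposition 2.6(1): let `1 < p < ∞`, `β ≥ 0`,
`q = p/(p-1)`, and `f ∈ A^1_β(𝕋)`. If `f` is not cyclic in `A^p_β(𝕋)`, then
there is a nonzero distribution `S` whose Fourier coefficients lie in
`ℓ^q_{-β}(ℤ)` and whose support is contained in `Z(f)`. -/
theorem stmt8 (p q β : ℝ) (hp : 1 < p) (hq : q = p / (p - 1)) (hβ : 0 ≤ β)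
    (c : ℤ → ℂ) (hc : MemA 1 β c)
    (hnc : ¬ IsCyclicA p β c) :
    ∃ s : ℤ → ℂ, s ≠ 0 ∧ MemA q (-β) s ∧ DistSuppIn s (zeroSet c) := by
  have hpq : p.HolderConjugate q := by
    rw [Real.holderConjugate_iff]
    refine ⟨hp, ?_⟩
    have : p - 1 ≠ 0 := by linarith
    have : p ≠ 0 := by linarith
    rw [hq]
    field_simp
    ring
  obtain ⟨u, hu0, hum, ⟨B, hB, hu⟩, hk⟩ := exists_functional hpq hβ hc hnc
  obtain ⟨f, hf, hft, hfn⟩ := exists_fun hβ hc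
  refine ⟨fun n => u (-n), ?_, ?_, ?_⟩
  · intro h
    apply hu0
    simpa using congrFun h 0
  · have := (Equiv.neg ℤ).summable_iff.2 hum
    unfold MemA
    refine this.congr fun n => ?_
    simp
  · intro φ hφ hsupp
    set Φ : C(Ci, ℂ) := ⟨φ, smooth_cont hφ⟩ with hΦ
    have hZ : IsClosed (zeroSet c) := by
      have : zeroSet c = f ⁻¹' {0} := by
        ext t
        change fSum c t = 0 ↔ f t = 0
        rw [hft]
      rw [this]
      exact isClosed_singleton.preimage f.continuous
    obtain ⟨v, hv01, hvZ, hvK, hvs⟩ := exists_bump (isClosed_tsupport φ) hZ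
      (Set.disjoint_left.2 fun t h1 h2 => hsupp h2 h1)
    set V : C(Ci, ℂ) := ⟨fun t => (v t : ℂ), smooth_cont hvs⟩ with hV
    have key : Lam u Φ = 0 := by
      refine main_supp hβ hB hu hfn (fun k => ?_) (smooth_nA Φ hφ) (V := V) (smooth_nA V hvs) v
        (fun t => rfl) hv01 ?_ (fun t ht => hvZ t ?_)
      · rw [← hk k]
        unfold Lam
        refine tsum_congr fun n => ?_
        rw [FC_fourier_mul, hf]
      · ext t
        change (v t : ℂ) * φ t = φ t
        by_cases h : t ∈ tsupport φ
        · rw [hvK t h]; simp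
        · rw [image_eq_zero_of_notMem_tsupport h]; simp
      · change fSum c t = 0
        rw [← hft]; exact ht
    rw [← key]
    unfold Lam
    rw [← (Equiv.neg ℤ).tsum_eq]
    refine tsum_congr fun n => ?_
    rw [FC_apply]
    simp only [Equiv.neg_apply, neg_neg]
    rw [mul_comm]
    rfl

end
end

section
/- Let 1 ≤ p < ∞ and β ≥ 0, let f ∈ A^1_β(𝕋), and let S be a distribution on 𝕋 whose Fourier coefficient sequence lies in ℓ^p_{−β}(ℤ) (i.e. ∑_{n∈ℤ} |Ŝ(n)|^p (1+|n|)^{−pβ} < ∞). If ⟨S, e_n f⟩ = ∑_{m∈ℤ} Ŝ(m) (e_n f)^{\widehat{}}(−m) = 0 for all n ∈ ℤ, where e_n(t) = e^{int}, then supp(S) ⊆ Z(f). -/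
open MeasureTheory Real Set Filter Topology ENNReal

noncomputable section

lemma aux_parts (g : ℝ → ℂ) (hg : ContDiff ℝ (⊤ : ℕ∞) g) (hper : Function.Periodic g (2 * Real.pi))
    (n : ℤ) :
    ∫ x in (0:ℝ)..(2 * Real.pi), Complex.exp (-(Complex.I * n * x)) * deriv g x =
      (Complex.I * n) * ∫ x in (0:ℝ)..(2 * Real.pi), Complex.exp (-(Complex.I * n * x)) * g x := by
  have hgd : ∀ x, HasDerivAt g (deriv g x) x := fun x =>
    ((hg.differentiable (by simp)) x).hasDerivAt
  have hgc : Continuous (deriv g) := hg.continuous_deriv (by simp)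
  have he : ∀ x : ℝ, HasDerivAt (fun x : ℝ => Complex.exp (-(Complex.I * n * x)))
      (-(Complex.I * n) * Complex.exp (-(Complex.I * n * x))) x := by
    intro x
    have h1 : HasDerivAt (fun x : ℝ => (-(Complex.I * n * (x:ℂ)))) (-(Complex.I * n * 1)) x :=
      ((Complex.ofRealCLM.hasDerivAt (x := x)).const_mul (Complex.I * n)).neg
    convert! h1.cexp using 1
    ring
  have hec : Continuous (fun x : ℝ => Complex.exp (-(Complex.I * n * x))) := by fun_prop
  have h := intervalIntegral.integral_mul_deriv_eq_deriv_mul (a := 0) (b := 2 * Real.pi)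
    (u := fun x : ℝ => Complex.exp (-(Complex.I * n * x))) (v := g)
    (u' := fun x : ℝ => -(Complex.I * n) * Complex.exp (-(Complex.I * n * x))) (v' := deriv g)
    (fun x _ => he x) (fun x _ => hgd x)
    ((continuous_const.mul hec).intervalIntegrable _ _) (hgc.intervalIntegrable _ _)
  rw [h]
  have h0 : g (2 * Real.pi) = g 0 := by simpa using hper 0
  have h1 : Complex.exp (-(Complex.I * n * ((2 * Real.pi : ℝ) : ℂ))) = 1 := by
    rw [Complex.exp_eq_one_iff]
    exact ⟨-n, by push_cast; ring⟩
  simp only [h1, h0]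
  simp only [mul_assoc]
  simp only [neg_mul, intervalIntegral.integral_neg, intervalIntegral.integral_const_mul, mul_assoc]
  simp

lemma aux_decay (k : ℕ) : ∀ g : ℝ → ℂ, ContDiff ℝ (⊤ : ℕ∞) g → Function.Periodic g (2 * Real.pi) →
    ∃ C : ℝ, ∀ n : ℤ, |(n : ℝ)| ^ k *
      ‖∫ x in (0:ℝ)..(2 * Real.pi), Complex.exp (-(Complex.I * n * x)) * g x‖ ≤ C := by
  induction k with
  | zero =>
    intro g hg hper
    refine ⟨∫ x in (0:ℝ)..(2 * Real.pi), ‖g x‖, fun n => ?_⟩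
    simp only [pow_zero, one_mul]
    refine (intervalIntegral.norm_integral_le_integral_norm (by positivity)).trans (le_of_eq ?_)
    congr 1
    ext x
    rw [norm_mul, Complex.norm_exp]
    simp
  | succ k ih =>
    intro g hg hper
    obtain ⟨C, hC⟩ := ih (deriv g) (ContDiff.iterate_deriv 1 hg) (by
      intro x
      have : (fun y => g (y + 2 * Real.pi)) = g := funext hper
      rw [← deriv_comp_add_const, this])
    refine ⟨C, fun n => ?_⟩
    have := hC n
    rw [aux_parts g hg hper n, norm_mul] at this
    simpa [pow_succ, mul_assoc] using this

lemma aux_coeff (φ : AddCircle (2 * Real.pi) → ℂ) (n : ℤ) :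
    fourierCoeff φ n = (1 / (2 * Real.pi)) •
      ∫ x in (0:ℝ)..(2 * Real.pi), Complex.exp (-(Complex.I * n * x)) * φ x := by
  rw [fourierCoeff_eq_intervalIntegral φ n 0, zero_add]
  congr 1
  apply intervalIntegral.integral_congr
  intro x _
  simp only [fourier_coe_apply, smul_eq_mul]
  congr 2
  push_cast
  have : (Real.pi : ℂ) ≠ 0 := by exact_mod_cast Real.pi_ne_zero
  field_simp

lemma aux_summable (β : ℝ) (φ : AddCircle (2 * Real.pi) → ℂ) (hφ : SmoothOnCircle φ) :
    Summable fun n : ℤ => ‖fourierCoeff φ n‖ * (1 + |(n : ℝ)|) ^ β := by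
  obtain ⟨k, hk⟩ := exists_nat_ge β
  obtain ⟨C, hC⟩ := aux_decay (k + 2) (fun x : ℝ => φ x) hφ (by
    intro x
    simp)
  have hs : Summable fun n : ℤ => (2 ^ k * (1 / (2 * Real.pi)) * C) * (1 / |(n : ℝ)| ^ 2) := by
    apply Summable.mul_left
    have := Real.summable_one_div_int_pow (p := 2)
    simpa using this
  refine Summable.of_norm_bounded_eventually hs ?_
  have : ∀ᶠ n : ℤ in cofinite, n ≠ 0 := by
    rw [Filter.eventually_cofinite]
    exact (Set.finite_singleton (0:ℤ)).subset (fun x hx => by simpa using hx)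
  filter_upwards [this] with n hn
  have hn1 : (1 : ℝ) ≤ |(n : ℝ)| := by
    exact_mod_cast Int.one_le_abs hn
  have h1 : (1 + |(n : ℝ)|) ^ β ≤ 2 ^ k * |(n : ℝ)| ^ k := by
    calc (1 + |(n : ℝ)|) ^ β ≤ (1 + |(n : ℝ)|) ^ (k : ℝ) :=
          Real.rpow_le_rpow_of_exponent_le (by linarith) hk
      _ = (1 + |(n : ℝ)|) ^ k := Real.rpow_natCast _ _
      _ ≤ (2 * |(n : ℝ)|) ^ k := by gcongr; linarith
      _ = _ := mul_pow _ _ _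
  rw [Real.norm_of_nonneg (by positivity), aux_coeff, norm_smul, mul_one_div,
    le_div_iff₀ (by positivity), Real.norm_of_nonneg (by positivity)]
  have := hC n
  set N := ‖∫ x in (0:ℝ)..(2 * Real.pi), Complex.exp (-(Complex.I * n * x)) * φ x‖
  calc 1 / (2 * Real.pi) * N * (1 + |(n : ℝ)|) ^ β * |(n : ℝ)| ^ 2
      ≤ 1 / (2 * Real.pi) * N * (2 ^ k * |(n : ℝ)| ^ k) * |(n : ℝ)| ^ 2 := by gcongr
    _ = 2 ^ k * (1 / (2 * Real.pi)) * (|(n : ℝ)| ^ (k + 2) * N) := by ring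
    _ ≤ _ := by gcongr

lemma aux_continuous (φ : AddCircle (2 * Real.pi) → ℂ) (hφ : SmoothOnCircle φ) : Continuous φ := by
  have h : Continuous fun x : ℝ => φ x := ContDiff.continuous hφ
  exact (QuotientAddGroup.isQuotientMap_mk (N := AddSubgroup.zmultiples (2 * Real.pi))).continuous_iff.2 h

lemma aux_summable' (φ : AddCircle (2 * Real.pi) → ℂ) (hφ : SmoothOnCircle φ) :
    Summable (fourierCoeff φ) := by
  have := aux_summable 0 φ hφ
  simp only [Real.rpow_zero, mul_one] at this
  exact this.of_norm

lemma aux_conv (φ ψ : AddCircle (2 * Real.pi) → ℂ) (hφ : SmoothOnCircle φ) (hψ : SmoothOnCircle ψ)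
    (h0 : ∀ t, φ t * ψ t = 0) (n : ℤ) :
    ∑' k : ℤ, fourierCoeff φ k * fourierCoeff ψ (n - k) = 0 := by
  have hφc := aux_continuous φ hφ
  have hψc := aux_continuous ψ hψ
  let Φ : C(AddCircle (2 * Real.pi), ℂ) := ⟨φ, hφc⟩
  have hs : Summable (fourierCoeff Φ) := aux_summable' φ hφ
  have hsum : ∀ t, HasSum (fun k => fourierCoeff φ k • fourier k t) (φ t) :=
    has_pointwise_sum_fourier_series_of_summable (f := Φ) hs
  obtain ⟨M, hM⟩ : ∃ M, ∀ t, ‖ψ t‖ ≤ M := by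
    obtain ⟨M, hM⟩ := (isCompact_range hψc).isBounded.exists_norm_le
    exact ⟨M, fun t => hM _ ⟨t, rfl⟩⟩
  have hM0 : 0 ≤ M := (norm_nonneg _).trans (hM 0)
  have key := hasSum_integral_of_summable_integral_norm (μ := AddCircle.haarAddCircle)
    (F := fun (k : ℤ) t => (fourierCoeff φ k • fourier k t) * (fourier (-n) t * ψ t))
    (fun k => by
      apply Continuous.integrable_of_hasCompactSupport _ (HasCompactSupport.of_compactSpace _)
      fun_prop)
    (by
      refine Summable.of_nonneg_of_le (fun k => by positivity) (fun k => ?_)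
        ((aux_summable' φ hφ).norm.mul_right M)
      calc _ ≤ ∫ t : AddCircle (2 * Real.pi), ‖fourierCoeff φ k‖ * M ∂AddCircle.haarAddCircle := by
            apply integral_mono
            · apply Continuous.integrable_of_hasCompactSupport _ (HasCompactSupport.of_compactSpace _)
              fun_prop
            · exact integrable_const _
            · intro t
              have e : ∀ m : ℤ, ‖(fourier m t : ℂ)‖ = 1 := fun m => Circle.norm_coe _
              change ‖(fourierCoeff φ k • fourier k t) * (fourier (-n) t * ψ t)‖ ≤ _
              rw [norm_mul, norm_smul, norm_mul, e, e, mul_one, one_mul]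
              exact mul_le_mul_of_nonneg_left (hM t) (norm_nonneg _)
        _ = _ := by simp)
  have hz : ∀ t, ∑' k : ℤ, (fourierCoeff φ k • fourier k t) * (fourier (-n) t * ψ t) = 0 := by
    intro t
    rw [tsum_mul_right, (hsum t).tsum_eq]
    linear_combination (fourier (-n) t) * h0 t
  simp only [hz, integral_zero] at key
  rw [← key.tsum_eq]
  congr 1
  ext k
  have hu : fourierCoeff ψ (n - k) =
      ∫ t, fourier (-(n - k)) t • ψ t ∂AddCircle.haarAddCircle := rfl
  rw [hu, ← smul_eq_mul, ← integral_smul]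
  congr 1
  ext t
  have : fourier (-(n - k)) t = fourier k t * fourier (-n) t := by
    rw [← fourier_add]; congr 1; ring_nf
  simp only [this, smul_eq_mul]
  ring

lemma aux_bump (φ : AddCircle (2 * Real.pi) → ℂ) (t : AddCircle (2 * Real.pi))
    (ht : t ∉ tsupport φ) : ∃ b : AddCircle (2 * Real.pi) → ℂ, SmoothOnCircle b ∧
      (∀ x, b x * φ x = 0) ∧ b t ≠ 0 := by
  let g : AddCircle (2 * Real.pi) → ℝ := fun x => (fourier 1 (x - t)).re
  have hg : Continuous g := by
    refine Complex.continuous_re.comp ((map_continuous (fourier 1)).comp ?_)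
    fun_prop
  have hg1 : ∀ x, x ≠ t → g x < 1 := by
    intro x hx
    have hn : ‖(fourier 1 (x - t) : ℂ)‖ = 1 := Circle.norm_coe _
    have hle : g x ≤ 1 := hn ▸ Complex.re_le_norm _
    refine lt_of_le_of_ne hle fun h => hx ?_
    have h2 : (fourier 1 (x - t) : ℂ) = 1 := by
      have h3 := Complex.re_eq_norm.1 (show (fourier 1 (x - t) : ℂ).re = ‖(fourier 1 (x - t) : ℂ)‖ by
        rw [hn]; exact h)
      rw [Complex.eq_re_of_ofReal_le h3]
      change ((g x : ℝ) : ℂ) = 1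
      rw [h]; simp
    rw [fourier_one] at h2
    have h3 : AddCircle.toCircle (x - t) = AddCircle.toCircle (0 : AddCircle (2 * Real.pi)) := by
      rw [AddCircle.toCircle_zero]
      exact Subtype.ext h2
    exact sub_eq_zero.1 (AddCircle.injective_toCircle (by positivity) h3)
  obtain ⟨r, hr, hrK⟩ : ∃ r < (1 : ℝ), ∀ x ∈ tsupport φ, g x ≤ r := by
    rcases (tsupport φ).eq_empty_or_nonempty with h | h
    · exact ⟨0, by norm_num, by simp [h]⟩
    · obtain ⟨x, hx, hmax⟩ := (isClosed_tsupport φ).isCompact.exists_isMaxOn h hg.continuousOn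
      exact ⟨g x, hg1 x (fun h => ht (h ▸ hx)), fun y hy => hmax hy⟩
  refine ⟨fun x => (Real.smoothTransition (g x - r) : ℂ), ?_, ?_, ?_⟩
  · obtain ⟨t0, rfl⟩ := QuotientAddGroup.mk_surjective t
    have : ∀ x : ℝ, g x = Real.cos (x - t0) := by
      intro x
      change (fourier 1 ((x : AddCircle (2 * Real.pi)) - (t0 : AddCircle (2 * Real.pi)))).re = _
      rw [← AddCircle.coe_sub, fourier_coe_apply, ← Complex.exp_ofReal_mul_I_re]
      congr 2
      push_cast
      have : (Real.pi : ℂ) ≠ 0 := by exact_mod_cast Real.pi_ne_zero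
      field_simp
    unfold SmoothOnCircle
    simp only [this]
    refine Complex.ofRealCLM.contDiff.comp (Real.smoothTransition.contDiff.comp ?_)
    exact (Real.contDiff_cos.comp (contDiff_id.sub contDiff_const)).sub contDiff_const
  · intro x
    beta_reduce
    by_cases hx : x ∈ tsupport φ
    · rw [Real.smoothTransition.zero_of_nonpos (by linarith [hrK x hx])]; simp
    · rw [image_eq_zero_of_notMem_tsupport hx]; simp
  · have : g t = 1 := by simp [g]
    beta_reduce
    rw [this]
    exact_mod_cast (Real.smoothTransition.pos_of_pos (by linarith)).ne'

lemma aux_char {A : Type*} [NormedCommRing A] [NormedAlgebra ℂ A] [CompleteSpace A] (β : ℝ)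
    (τ : ℤ → A) (h0 : τ 0 = 1) (hadd : ∀ k l, τ (k + l) = τ k * τ l)
    (hb : ∀ k : ℤ, ‖τ k‖ ≤ (1 + |(k : ℝ)|) ^ β) (J : Ideal A) (hJ : J ≠ ⊤) :
    ∃ t : AddCircle (2 * Real.pi), ∀ a : ℤ → ℂ,
      Summable (fun k : ℤ => ‖a k‖ * (1 + |(k : ℝ)|) ^ β) →
      (∑' k : ℤ, a k • τ k) ∈ J → fSum a t = 0 := by
  obtain ⟨M, hM, hJM⟩ := J.exists_le_maximal hJ
  let χ := M.toCharacterSpace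
  have hχ : ∀ a ∈ J, χ a = 0 := fun a ha => M.toCharacterSpace_apply_eq_zero_of_mem (hJM ha)
  have hpos : ∀ k : ℕ, χ (τ k) = χ (τ 1) ^ k := by
    intro k
    induction k with
    | zero => simp [h0]
    | succ k ih => rw [Nat.cast_succ, hadd, map_mul, ih, pow_succ]
  have hinv : χ (τ 1) * χ (τ (-1)) = 1 := by
    rw [← map_mul, ← hadd]; simp [h0]
  have hneg : ∀ k : ℕ, χ (τ (-k)) = χ (τ (-1)) ^ k := by
    intro k
    induction k with
    | zero => simp [h0]
    | succ k ih =>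
      rw [Nat.cast_succ, neg_add, hadd, map_mul, ih, pow_succ]
  have hle : ∀ k : ℤ, ‖χ (τ k)‖ ≤ (1 + |(k : ℝ)|) ^ β * ‖(1 : A)‖ := fun k =>
    (AlgHom.norm_apply_le_self_mul_norm_one χ (τ k)).trans (by gcongr; exact hb k)
  have hgrow : ∀ x : ℝ, (∀ k : ℕ, x ^ k ≤ (1 + (k : ℝ)) ^ β * ‖(1 : A)‖) → x ≤ 1 := by
    intro x hx
    by_contra! hx1
    have h2 : Tendsto (fun k : ℕ => (1 + (k : ℝ)) ^ β * ‖(1 : A)‖ / x ^ k) atTop (𝓝 0) := by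
      obtain ⟨m, hm⟩ := exists_nat_ge β
      have h3 := (tendsto_pow_const_div_const_pow_of_one_lt m hx1).comp (tendsto_add_atTop_nat 1)
      have h4 := h3.const_mul (x * ‖(1 : A)‖)
      rw [mul_zero] at h4
      refine squeeze_zero (fun k => by positivity) (fun k => ?_) h4
      simp only [Function.comp]
      have : (1 + (k : ℝ)) ^ β ≤ (1 + (k : ℝ)) ^ m := by
        rw [← Real.rpow_natCast]
        exact Real.rpow_le_rpow_of_exponent_le (by linarith [Nat.cast_nonneg (α := ℝ) k]) hm
      have hx0 : x ≠ 0 := by positivity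
      calc (1 + (k : ℝ)) ^ β * ‖(1 : A)‖ / x ^ k ≤ (1 + (k : ℝ)) ^ m * ‖(1 : A)‖ / x ^ k := by gcongr
        _ = _ := by push_cast; rw [pow_succ]; field_simp; ring
    obtain ⟨k, hk⟩ := (h2.eventually (gt_mem_nhds (zero_lt_one))).exists
    rw [div_lt_one (by positivity)] at hk
    exact absurd (hx k) (not_le.2 hk)
  have hz1 : ‖χ (τ 1)‖ ≤ 1 := hgrow _ fun k => by
    rw [← norm_pow, ← hpos]; simpa using hle k
  have hz2 : ‖χ (τ (-1))‖ ≤ 1 := hgrow _ fun k => by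
    rw [← norm_pow, ← hneg]; simpa using hle (-k)
  have hz : ‖χ (τ 1)‖ = 1 := by
    have h5 := congrArg norm hinv
    rw [norm_mul, norm_one] at h5
    nlinarith [norm_nonneg (χ (τ 1)), norm_nonneg (χ (τ (-1)))]
  obtain ⟨t, ht⟩ : ∃ t : AddCircle (2 * Real.pi), (fourier 1 t : ℂ) = χ (τ 1) := by
    refine ⟨((Complex.arg (χ (τ 1)) : ℝ) : AddCircle (2 * Real.pi)), ?_⟩
    rw [fourier_coe_apply]
    conv_rhs => rw [← Complex.norm_mul_exp_arg_mul_I (χ (τ 1)), hz]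
    have : (Real.pi : ℂ) ≠ 0 := by exact_mod_cast Real.pi_ne_zero
    rw [Complex.ofReal_one, one_mul]
    congr 1
    push_cast
    field_simp
  have hpos' : ∀ k : ℕ, (fourier (k : ℤ) t : ℂ) = (fourier 1 t) ^ k := by
    intro k
    induction k with
    | zero => simp
    | succ k ih => rw [Nat.cast_succ, fourier_add, ih, pow_succ]
  have hf : ∀ k : ℤ, χ (τ k) = fourier k t := by
    intro k
    obtain ⟨n, rfl | rfl⟩ := k.eq_nat_or_neg
    · rw [hpos, hpos', ht]
    · have h6 : χ (τ n) * χ (τ (-n)) = 1 := by rw [← map_mul, ← hadd]; simp [h0]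
      have h7 : (fourier (n : ℤ) t : ℂ) * fourier (-(n : ℤ)) t = 1 := by
        rw [← fourier_add, add_neg_cancel, fourier_zero]
      rw [hpos, ← ht, ← hpos'] at h6
      exact mul_left_cancel₀ (left_ne_zero_of_mul_eq_one h7) (h6.trans h7.symm)
  refine ⟨t, fun a ha haJ => ?_⟩
  have hsum : Summable fun k : ℤ => a k • τ k := by
    refine Summable.of_norm_bounded ha fun k => ?_
    rw [norm_smul]
    gcongr
    exact hb k
  have := hχ _ haJ
  rw [Summable.map_tsum hsum χ (map_continuous χ)] at this
  simpa [fSum, map_smul, hf] using this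

lemma aux_char' {B : Type*} [NormedRing B] [NormedAlgebra ℂ B] [CompleteSpace B] (β : ℝ)
    (τ : ℤ → B) (h0 : τ 0 = 1) (hadd : ∀ k l, τ (k + l) = τ k * τ l)
    (hb : ∀ k : ℤ, ‖τ k‖ ≤ (1 + |(k : ℝ)|) ^ β) (J : Ideal B) (hJ : (1 : B) ∉ J) :
    ∃ t : AddCircle (2 * Real.pi), ∀ a : ℤ → ℂ,
      Summable (fun k : ℤ => ‖a k‖ * (1 + |(k : ℝ)|) ^ β) →
      (∑' k : ℤ, a k • τ k) ∈ J → fSum a t = 0 := by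
  let A : Subalgebra ℂ B := Subalgebra.centralizer ℂ (Set.centralizer (Set.range τ))
  have hcomm : ∀ x ∈ Set.range τ, ∀ y ∈ Set.range τ, x * y = y * x := by
    rintro _ ⟨k, rfl⟩ _ ⟨l, rfl⟩
    rw [← hadd, ← hadd, add_comm]
  have hclosed : IsClosed (A : Set B) := Set.isClosed_centralizer _
  let _ : NormedCommRing A :=
    { (inferInstance : NormedRing A) with
      mul_comm := fun x y => Subtype.ext
        (Set.centralizer_centralizer_comm_of_comm hcomm _ x.2 _ y.2) }
  let _ : NormedAlgebra ℂ A := Subalgebra.toNormedAlgebra A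
  have : CompleteSpace A := hclosed.completeSpace_coe
  have hmem : ∀ k, τ k ∈ A := fun k => Set.subset_centralizer_centralizer ⟨k, rfl⟩
  obtain ⟨t, ht⟩ := aux_char (A := A) β (fun k => ⟨τ k, hmem k⟩) (Subtype.ext h0)
    (fun k l => Subtype.ext (hadd k l)) hb (Ideal.comap A.val J) (by
      rw [Ne, Ideal.eq_top_iff_one]
      exact hJ)
  refine ⟨t, fun a ha haJ => ht a ha ?_⟩
  have hsum : Summable fun k : ℤ => a k • (⟨τ k, hmem k⟩ : A) := by
    refine Summable.of_norm_bounded ha fun k => ?_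
    rw [norm_smul]
    gcongr
    exact hb k
  rw [Ideal.mem_comap]
  have := Summable.map_tsum hsum A.val continuous_subtype_val
  rw [this]
  exact haJ

lemma aux_weight (β : ℝ) (hβ : 0 ≤ β) (n k : ℤ) :
    (1 + |((n - k : ℤ) : ℝ)|) ^ β ≤ (1 + |(n : ℝ)|) ^ β * (1 + |(k : ℝ)|) ^ β := by
  rw [← Real.mul_rpow (by positivity) (by positivity)]
  apply Real.rpow_le_rpow (by positivity) _ hβ
  push_cast
  nlinarith [abs_sub (n : ℝ) k, abs_nonneg (n : ℝ), abs_nonneg (k : ℝ),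
    mul_nonneg (abs_nonneg (n : ℝ)) (abs_nonneg (k : ℝ))]

lemma aux_shift (β : ℝ) (hβ : 0 ≤ β) (k : ℤ) :
    ∃ T : BoundedContinuousFunction ℤ ℂ →L[ℂ] BoundedContinuousFunction ℤ ℂ,
      ‖T‖ ≤ (1 + |(k : ℝ)|) ^ β ∧ ∀ u n, T u n =
        u (n - k) * (((1 + |((n - k : ℤ) : ℝ)|) ^ β / (1 + |(n : ℝ)|) ^ β : ℝ) : ℂ) := by
  have hbd : ∀ (u : BoundedContinuousFunction ℤ ℂ) (n : ℤ),
      ‖u (n - k) * (((1 + |((n - k : ℤ) : ℝ)|) ^ β / (1 + |(n : ℝ)|) ^ β : ℝ) : ℂ)‖ ≤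
        (1 + |(k : ℝ)|) ^ β * ‖u‖ := by
    intro u n
    rw [norm_mul, Complex.norm_real, Real.norm_of_nonneg (by positivity), mul_comm]
    gcongr
    · rw [div_le_iff₀ (by positivity), mul_comm]
      exact aux_weight β hβ n k
    · exact u.norm_coe_le_norm _
  refine ⟨LinearMap.mkContinuous
    { toFun := fun u => BoundedContinuousFunction.ofNormedAddCommGroupDiscrete
        (fun n : ℤ => u (n - k) * (((1 + |((n - k : ℤ) : ℝ)|) ^ β / (1 + |(n : ℝ)|) ^ β : ℝ) : ℂ))
        _ (hbd u)
      map_add' := fun u v => by ext n; simp [add_mul]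
      map_smul' := fun c u => by ext n; simp [mul_assoc] } ((1 + |(k : ℝ)|) ^ β) ?_, ?_, ?_⟩
  · intro u
    exact BoundedContinuousFunction.norm_ofNormedAddCommGroup_le _ (by positivity) (hbd u)
  · exact LinearMap.mkContinuous_norm_le _ (by positivity) _
  · intro u n
    rfl

lemma aux_comm {B : Type*} [NormedRing B] [NormedAlgebra ℂ B]
    (τ : ℤ → B) (hadd : ∀ k l, τ (k + l) = τ k * τ l) (a b : ℤ → ℂ) :
    (∑' k : ℤ, a k • τ k) * (∑' k : ℤ, b k • τ k) =
      (∑' k : ℤ, b k • τ k) * (∑' k : ℤ, a k • τ k) := by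
  have h1 : ∀ k l, Commute (τ k) (τ l) := fun k l => by
    rw [Commute, SemiconjBy, ← hadd, ← hadd, add_comm]
  have h2 : ∀ k, Commute (∑' k : ℤ, b k • τ k) (τ k) := fun k =>
    (Commute.tsum_right _ fun l => (h1 k l).smul_right _).symm
  exact (Commute.tsum_right _ fun k => (h2 k).smul_right _).symm

lemma aux_mul {B : Type*} [NormedRing B] [NormedAlgebra ℂ B] [CompleteSpace B] (β : ℝ) (hβ : 0 ≤ β)
    (τ : ℤ → B) (hadd : ∀ k l, τ (k + l) = τ k * τ l)
    (hb : ∀ k : ℤ, ‖τ k‖ ≤ (1 + |(k : ℝ)|) ^ β) (a b : ℤ → ℂ)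
    (ha : Summable (fun k : ℤ => ‖a k‖ * (1 + |(k : ℝ)|) ^ β))
    (hb' : Summable (fun k : ℤ => ‖b k‖ * (1 + |(k : ℝ)|) ^ β))
    (hconv : ∀ n : ℤ, ∑' k : ℤ, a k * b (n - k) = 0) :
    (∑' k : ℤ, a k • τ k) * (∑' k : ℤ, b k • τ k) = 0 := by
  have hsumm : ∀ a : ℤ → ℂ, Summable (fun k : ℤ => ‖a k‖ * (1 + |(k : ℝ)|) ^ β) →
      Summable (fun k : ℤ => ‖a k • τ k‖) := by
    intro a ha
    refine Summable.of_nonneg_of_le (fun k => norm_nonneg _) (fun k => ?_) ha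
    rw [norm_smul]
    gcongr
    exact hb k
  let e : ℤ × ℤ ≃ ℤ × ℤ :=
    { toFun := fun x => (x.2, x.1 - x.2)
      invFun := fun x => (x.1 + x.2, x.1)
      left_inv := fun x => by simp
      right_inv := fun x => by simp }
  rw [tsum_mul_tsum_of_summable_norm (hsumm a ha) (hsumm b hb')]
  have hS := summable_mul_of_summable_norm (hsumm a ha) (hsumm b hb')
  rw [← e.tsum_eq]
  rw [Summable.tsum_prod (f := fun x : ℤ × ℤ => a (e x).1 • τ (e x).1 * b (e x).2 • τ (e x).2)
    (e.summable_iff.2 hS)]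
  have : ∀ n k : ℤ, a (e (n, k)).1 • τ (e (n, k)).1 * b (e (n, k)).2 • τ (e (n, k)).2 =
      (a k * b (n - k)) • τ n := by
    intro n k
    simp only [e, Equiv.coe_fn_mk]
    rw [smul_mul_smul_comm, ← hadd, add_sub_cancel]
  simp only [this]
  have hz : ∀ n : ℤ, ∑' k : ℤ, (a k * b (n - k)) • τ n = 0 := by
    intro n
    have hn : ∀ a : ℤ → ℂ, Summable (fun k : ℤ => ‖a k‖ * (1 + |(k : ℝ)|) ^ β) →
        Summable (fun k : ℤ => ‖a k‖) := fun a ha =>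
      Summable.of_nonneg_of_le (fun k => norm_nonneg _) (fun k =>
        le_mul_of_one_le_right (norm_nonneg _)
          (Real.one_le_rpow (by linarith [abs_nonneg (k : ℝ)]) hβ)) ha
    have h : Summable fun k : ℤ => a k * b (n - k) :=
      (summable_mul_of_summable_norm (hn a ha) (hn b hb')).comp_injective
        (i := fun k : ℤ => (k, n - k)) (fun x y hxy => congrArg Prod.fst hxy)
    rw [h.tsum_smul_const, hconv n, zero_smul]
  simp [hz]

/-- Lemma 2.4: let `1 ≤ p < ∞`, `β ≥ 0`, `f ∈ A^1_β(𝕋)`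
with coefficients `c`, and let `S` be a distribution with coefficients
`s ∈ ℓ^p_{-β}(ℤ)`. If `⟨S, e_n f⟩ = ∑_m Ŝ(m) (e_n f)^(−m) = ∑_m s(m) c(−m−n) = 0`
for all `n ∈ ℤ`, then `supp S ⊆ Z(f)`. -/
theorem stmt10 (p β : ℝ) (hp : 1 ≤ p) (hβ : 0 ≤ β)
    (c : ℤ → ℂ) (hc : MemA 1 β c)
    (s : ℤ → ℂ) (hs : MemA p (-β) s)
    (horth : ∀ n : ℤ, ∑' m : ℤ, s m * c (-m - n) = 0) :
    DistSuppIn s (zeroSet c) := by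
  have hwpos : ∀ n : ℤ, 0 < (1 + |(n : ℝ)|) ^ β := fun n => by positivity
  have hc' : Summable fun n : ℤ => ‖c n‖ * (1 + |(n : ℝ)|) ^ β := by
    simpa [MemA] using hc
  -- the normalised bounded sequence
  obtain ⟨C, hC⟩ : ∃ C : ℝ, ∀ n : ℤ,
      ‖s n / (((1 + |(n : ℝ)|) ^ β : ℝ) : ℂ)‖ ≤ C := by
    have hp0 : 0 < p := by linarith
    refine ⟨(∑' n : ℤ, ‖s n‖ ^ p * (1 + |(n : ℝ)|) ^ (p * -β)) ^ (1 / p), fun n => ?_⟩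
    have h1 := hs.le_tsum n (fun j _ => by positivity)
    have h2 : ‖s n / (((1 + |(n : ℝ)|) ^ β : ℝ) : ℂ)‖ =
        (‖s n‖ ^ p * (1 + |(n : ℝ)|) ^ (p * -β)) ^ (1 / p) := by
      rw [norm_div, Complex.norm_real, Real.norm_of_nonneg (hwpos n).le,
        Real.mul_rpow (by positivity) (by positivity), ← Real.rpow_mul (by positivity),
        ← Real.rpow_mul (by positivity), mul_one_div_cancel hp0.ne', Real.rpow_one,
        show p * -β * (1 / p) = -β by field_simp, Real.rpow_neg (by positivity), div_eq_mul_inv]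
    rw [h2]
    exact Real.rpow_le_rpow (by positivity) h1 (by positivity)
  let u : BoundedContinuousFunction ℤ ℂ :=
    BoundedContinuousFunction.ofNormedAddCommGroupDiscrete _ C hC
  have hu : ∀ n, u n = s n / (((1 + |(n : ℝ)|) ^ β : ℝ) : ℂ) := fun n => rfl
  choose τ hτb hτ using aux_shift β hβ
  have hw0 : ∀ n : ℤ, (((1 + |(n : ℝ)|) ^ β : ℝ) : ℂ) ≠ 0 := fun n => by
    exact_mod_cast (hwpos n).ne'
  have hτ0 : τ 0 = 1 := by
    ext v n
    rw [hτ, sub_zero, div_self (hwpos n).ne']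
    simp
  have hτadd : ∀ k l, τ (k + l) = τ k * τ l := by
    intro k l
    ext v n
    rw [mul_apply_eq_comp, hτ, hτ, hτ, show n - (k + l) = n - k - l by ring]
    push_cast [-Int.cast_sub]
    have := hw0 (n - k)
    have := hw0 n
    push_cast [-Int.cast_sub] at *
    field_simp
  have hsumm : ∀ a : ℤ → ℂ, Summable (fun k : ℤ => ‖a k‖ * (1 + |(k : ℝ)|) ^ β) →
      Summable (fun k : ℤ => ‖a k • τ k‖) := by
    intro a ha
    refine Summable.of_nonneg_of_le (fun k => norm_nonneg _) (fun k => ?_) ha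
    rw [norm_smul]
    gcongr
    exact hτb k
  -- action of the operators on `u`
  have hact : ∀ a : ℤ → ℂ, Summable (fun k : ℤ => ‖a k‖ * (1 + |(k : ℝ)|) ^ β) → ∀ n : ℤ,
      (∑' k : ℤ, a k • τ k) u n =
        (∑' k : ℤ, a k * s (n - k)) * ((((1 + |(n : ℝ)|) ^ β : ℝ) : ℂ))⁻¹ := by
    intro a ha n
    have hS := (hsumm a ha).of_norm.hasSum
    have h1 := hS.mapL (ContinuousLinearMap.apply ℂ (BoundedContinuousFunction ℤ ℂ) u)
    have h2 := h1.mapL (BoundedContinuousFunction.evalCLM ℂ n)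
    have h3 := h2.tsum_eq
    rw [← tsum_mul_right]
    refine h3.symm.trans (tsum_congr fun k => ?_)
    change (a k • τ k u) n = _
    rw [BoundedContinuousFunction.smul_apply, hτ, hu, smul_eq_mul]
    have := hw0 (n - k)
    have := hw0 n
    push_cast [-Int.cast_sub] at *
    field_simp
  have hcu : (∑' k : ℤ, c k • τ k) u = 0 := by
    ext n
    rw [hact c hc' n]
    have h1 := horth (-n)
    have h2 : ∑' k : ℤ, c k * s (n - k) = 0 := by
      rw [← h1, ← (Equiv.subLeft n).tsum_eq]
      refine tsum_congr fun k => ?_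
      simp only [Equiv.subLeft_apply]
      rw [mul_comm, show n - (n - k) = k by ring, show -k - -n = n - k by ring]
    rw [h2]
    simp
  intro φ hφ hsupp
  have hφs := aux_summable β φ hφ
  set P := ∑' k : ℤ, fourierCoeff φ k • τ k with hP
  -- commutation
  have hcommute : ∀ a : ℤ → ℂ, Summable (fun k : ℤ => ‖a k‖ * (1 + |(k : ℝ)|) ^ β) →
      (∑' k : ℤ, a k • τ k) * P = P * (∑' k : ℤ, a k • τ k) := by
    exact fun a _ => aux_comm τ hτadd a _
  -- annihilator of `P u`
  let J : Ideal (BoundedContinuousFunction ℤ ℂ →L[ℂ] BoundedContinuousFunction ℤ ℂ) :=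
    { carrier := {a | a (P u) = 0}
      add_mem' := fun {a b} ha hb => by
        change (a + b) (P u) = 0
        rw [add_apply, show a (P u) = 0 from ha, show b (P u) = 0 from hb,
          add_zero]
      zero_mem' := rfl
      smul_mem' := fun a b hb => by
        change a (b (P u)) = 0
        rw [show b (P u) = 0 from hb, map_zero] }
  have h1J : 1 ∈ J := by
    by_contra hJ
    obtain ⟨t, ht⟩ := aux_char' β τ hτ0 hτadd hτb J hJ
    have htz : t ∈ zeroSet c := by
      refine ht c hc' ?_
      change ((∑' k : ℤ, c k • τ k) * P) u = 0
      rw [hcommute c hc', mul_apply_eq_comp, hcu, map_zero]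
    obtain ⟨b, hbs, hbφ, hbt⟩ := aux_bump φ t (fun h => hsupp h htz)
    have hb := aux_summable β b hbs
    have h2 : fSum (fourierCoeff b) t = 0 := by
      refine ht _ hb ?_
      change ((∑' k : ℤ, fourierCoeff b k • τ k) * P) u = 0
      rw [hP, aux_mul β hβ τ hτadd hτb _ _ hb hφs (aux_conv b φ hbs hφ hbφ)]
      rfl
    apply hbt
    rw [← h2]
    exact (has_pointwise_sum_fourier_series_of_summable
      (f := (⟨b, aux_continuous b hbs⟩ : C(AddCircle (2 * Real.pi), ℂ)))
      (aux_summable' b hbs) t).tsum_eq.symm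
  have hPu : P u = 0 := h1J
  have h3 := hact _ hφs 0
  rw [← hP, hPu] at h3
  have h4 : ∑' k : ℤ, fourierCoeff φ k * s (0 - k) = 0 := by simpa using h3.symm
  rw [← h4, ← (Equiv.neg ℤ).tsum_eq]
  refine tsum_congr fun k => ?_
  simp [mul_comm]

end
end
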